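/- Every pure double circulant singly even self-dual binary code of length 96 with minimum weight 16 has automorphism group of order exactly 96, where the automorphism group is the group of coordinate permutations mapping the code onto itself. -/

import Mathlib

/-- The standard inner product on `ι → ZMod 2`. -/
def dot {ι : Type*} [Fintype ι] (x y : ι → ZMod 2) : ZMod 2 := ∑ i, x i * y i

/-- A binary linear code is self-dual if it coincides with its dual. -/
def IsSelfDual {ι : Type*} [Fintype ι] (C : Submodule (ZMod 2) (ι → ZMod 2)) : Prop :=
  ∀ x, x ∈ C ↔ ∀ y ∈ C, dot x y = 0

/-- `C` has minimum (nonzero) weight exactly `d`. -/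
def MinWeightIs {ι : Type*} [Fintype ι] (C : Submodule (ZMod 2) (ι → ZMod 2)) (d : ℕ) : Prop :=
  (∃ x ∈ C, x ≠ 0 ∧ hammingNorm x = d) ∧ ∀ x ∈ C, x ≠ 0 → d ≤ hammingNorm x

/-- `A_i(C)`: the number of codewords of `C` of Hamming weight `i`. -/
noncomputable def weightEnum {ι : Type*} [Fintype ι] (C : Submodule (ZMod 2) (ι → ZMod 2)) (i : ℕ) : ℕ :=
  Set.ncard {x : ι → ZMod 2 | x ∈ C ∧ hammingNorm x = i}

/-- Two codes are equivalent if a coordinate permutation maps one onto the other. -/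
def CodeEquiv {ι : Type*} [Fintype ι] (C C' : Submodule (ZMod 2) (ι → ZMod 2)) : Prop :=
  ∃ σ : Equiv.Perm ι, Submodule.map (LinearMap.funLeft (ZMod 2) (ZMod 2) ⇑σ) C = C'

/-- The order of the automorphism group of a code: the number of coordinate
permutations mapping the code onto itself. -/
noncomputable def autGroupOrder {ι : Type*} [Fintype ι] (C : Submodule (ZMod 2) (ι → ZMod 2)) : ℕ :=
  Nat.card {σ : Equiv.Perm ι // Submodule.map (LinearMap.funLeft (ZMod 2) (ZMod 2) ⇑σ) C = C}

/-- A circulant matrix: each row is the cyclic shift of the previous one. -/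
def IsCirculant {n : ℕ} (R : Matrix (Fin n) (Fin n) (ZMod 2)) : Prop :=
  ∃ v : Fin n → ZMod 2, R = Matrix.circulant v

/-- The pure double circulant code with generator matrix `(I_n | R)`. -/
def pureDCC {n : ℕ} (R : Matrix (Fin n) (Fin n) (ZMod 2)) :
    Submodule (ZMod 2) (Fin n ⊕ Fin n → ZMod 2) :=
  Submodule.span (ZMod 2)
    (Set.range fun i : Fin n =>
      Sum.elim (fun j => if j = i then (1 : ZMod 2) else 0) (R i))

/-- A bordered matrix: first row `(0,1,…,1)`, first column `(0,1,…,1)ᵀ`, and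
lower-right block an `n × n` circulant matrix. -/
def IsBorderMatrix {n : ℕ} (B : Matrix (Fin (n + 1)) (Fin (n + 1)) (ZMod 2)) : Prop :=
  B 0 0 = 0 ∧ (∀ j, j ≠ 0 → B 0 j = 1) ∧ (∀ i, i ≠ 0 → B i 0 = 1) ∧
  ∃ R' : Matrix (Fin n) (Fin n) (ZMod 2), IsCirculant R' ∧
    ∀ i j : Fin n, B i.succ j.succ = R' i j

/-- The bordered double circulant code with generator matrix `(I_{n+1} | B)`. -/
def borderedDCC {n : ℕ} (B : Matrix (Fin (n + 1)) (Fin (n + 1)) (ZMod 2)) :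
    Submodule (ZMod 2) (Fin (n + 1) ⊕ Fin (n + 1) → ZMod 2) :=
  Submodule.span (ZMod 2)
    (Set.range fun i : Fin (n + 1) =>
      Sum.elim (fun j => if j = i then (1 : ZMod 2) else 0) (B i))

namespace DC

/-- the group algebra of the cyclic group of order 48, as functions -/
@[ext] structure Cv where
  c : Fin 48 → ZMod 2

instance : CoeFun Cv (fun _ => Fin 48 → ZMod 2) := ⟨Cv.c⟩

theorem cv_ext {f g : Cv} (h : ∀ i, f i = g i) : f = g := Cv.ext (funext h)

instance : Add Cv := ⟨fun f g => ⟨fun i => f i + g i⟩⟩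
instance : Zero Cv := ⟨⟨fun _ => 0⟩⟩
instance : Neg Cv := ⟨fun f => f⟩
instance : Mul Cv := ⟨fun f g => ⟨(Matrix.circulant f.c).mulVec g.c⟩⟩
instance : One Cv := ⟨⟨Pi.single 0 1⟩⟩

theorem add_ap (f g : Cv) (i : Fin 48) : (f + g) i = f i + g i := rfl
theorem zero_ap (i : Fin 48) : (0 : Cv) i = 0 := rfl

theorem circ_inj {f g : Cv} (h : Matrix.circulant f.c = Matrix.circulant g.c) : f = g :=
  Cv.ext (Matrix.circulant_injective h)
theorem circ_mul (f g : Cv) :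
    Matrix.circulant (f * g).c = Matrix.circulant f.c * Matrix.circulant g.c :=
  (Matrix.circulant_mul f.c g.c).symm
theorem circ_one : Matrix.circulant (1 : Cv).c = 1 :=
  Matrix.circulant_single_one (ZMod 2) (Fin 48)
theorem circ_add (f g : Cv) :
    Matrix.circulant (f + g).c = Matrix.circulant f.c + Matrix.circulant g.c := rfl
theorem circ_zero : Matrix.circulant (0 : Cv).c = 0 := rfl

theorem z2 (x : ZMod 2) : x = 0 ∨ x = 1 := by revert x; decide
theorem z2add (x : ZMod 2) : x + x = 0 := by revert x; decide

instance : CommRing Cv where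
  add_assoc a b c := cv_ext fun i => add_assoc _ _ _
  add_comm a b := cv_ext fun i => add_comm _ _
  zero_add a := cv_ext fun i => zero_add _
  add_zero a := cv_ext fun i => add_zero _
  neg_add_cancel a := cv_ext fun i => z2add _
  nsmul := nsmulRec
  zsmul := zsmulRec
  left_distrib a b c := circ_inj (by simp only [circ_mul, circ_add, mul_add])
  right_distrib a b c := circ_inj (by simp only [circ_mul, circ_add, add_mul])
  zero_mul a := circ_inj (by rw [circ_mul, circ_zero, zero_mul])
  mul_zero a := circ_inj (by rw [circ_mul, circ_zero, mul_zero])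
  mul_assoc a b c := circ_inj (by simp only [circ_mul, mul_assoc])
  one_mul a := circ_inj (by rw [circ_mul, circ_one, one_mul])
  mul_one a := circ_inj (by rw [circ_mul, circ_one, mul_one])
  mul_comm a b := circ_inj (by rw [circ_mul, circ_mul]; exact Matrix.circulant_mul_comm _ _)

theorem mul_ap (f g : Cv) (k : Fin 48) : (f * g) k = ∑ i, f i * g (k - i) := by
  have : (f * g) k = ∑ i, f (k - i) * g i := rfl
  rw [this]
  refine Fintype.sum_equiv (Equiv.subLeft k) _ _ ?_
  intro i
  simp

theorem one_ap (k : Fin 48) : (1 : Cv) k = if k = 0 then 1 else 0 := by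
  have : (1 : Cv) k = (Pi.single 0 1 : Fin 48 → ZMod 2) k := rfl
  rw [this, Pi.single_apply]

theorem cv_add_self (f : Cv) : f + f = 0 := cv_ext fun _ => z2add _
theorem cv_add_cancel (f g : Cv) : f + (f + g) = g := by
  rw [← add_assoc, cv_add_self, zero_add]
theorem cv_eq_of_add {f g : Cv} (h : f + g = 0) : f = g := by
  have := congrArg (f + ·) h
  simp only [cv_add_cancel, add_zero] at this
  exact this.symm

/-- monomial shift -/
def shf (i : Fin 48) (f : Cv) : Cv := ⟨fun k => f (k - i)⟩
/-- composition with an automorphism of the cyclic group -/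
def mu (φ : Fin 48 ≃+ Fin 48) (f : Cv) : Cv := ⟨fun k => f (φ k)⟩
def star (f : Cv) : Cv := ⟨fun k => f (-k)⟩
/-- monomial -/
def X (i : Fin 48) : Cv := shf i 1

theorem shf_ap (i k : Fin 48) (f : Cv) : shf i f k = f (k - i) := rfl
theorem mu_ap (φ) (k : Fin 48) (f : Cv) : mu φ f k = f (φ k) := rfl
theorem star_ap (k : Fin 48) (f : Cv) : star f k = f (-k) := rfl

theorem X_mul (i : Fin 48) (f : Cv) : X i * f = shf i f := by
  refine cv_ext fun k => ?_
  rw [mul_ap]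
  simp only [X, shf_ap, one_ap]
  rw [Finset.sum_eq_single i]
  · simp
  · intro b _ hb
    rw [if_neg (fun h => hb (sub_eq_zero.mp h)), zero_mul]
  · simp

theorem shf_mul (i : Fin 48) (f g : Cv) : shf i f * g = shf i (f * g) := by
  rw [← X_mul, ← X_mul, mul_assoc]
theorem mul_shf (i : Fin 48) (f g : Cv) : f * shf i g = shf i (f * g) := by
  rw [mul_comm, shf_mul, mul_comm]
theorem shf_add (i : Fin 48) (f g : Cv) : shf i (f + g) = shf i f + shf i g := rfl
theorem shf_shf (i j : Fin 48) (f : Cv) : shf i (shf j f) = shf (i + j) f := by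
  refine cv_ext fun k => ?_
  simp only [shf_ap]; congr 1; abel
theorem shf_zero (f : Cv) : shf 0 f = f := cv_ext fun k => by simp [shf_ap]
theorem mu_add (φ) (f g : Cv) : mu φ (f + g) = mu φ f + mu φ g := rfl
theorem mu_mul (φ) (f g : Cv) : mu φ (f * g) = mu φ f * mu φ g := by
  refine cv_ext fun k => ?_
  simp only [mu_ap, mul_ap]
  refine (Fintype.sum_equiv φ.toEquiv _ _ ?_).symm
  intro i; simp
theorem mu_one (φ) : mu φ 1 = 1 := cv_ext fun k => by simp [mu_ap, one_ap]
theorem star_eq (f : Cv) : star f = mu (AddEquiv.neg (Fin 48)) f := rfl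
theorem star_add (f g : Cv) : star (f + g) = star f + star g := rfl
theorem star_mul (f g : Cv) : star (f * g) = star f * star g := by
  rw [star_eq, mu_mul]; rfl
theorem star_one : star 1 = 1 := by rw [star_eq, mu_one]
theorem star_star (f : Cv) : star (star f) = f := cv_ext fun k => by simp [star_ap]
theorem star_shf (i : Fin 48) (f : Cv) : star (shf i f) = shf (-i) (star f) := by
  refine cv_ext fun k => ?_
  simp only [shf_ap, star_ap]; congr 1; abel
theorem star_mu (φ) (f : Cv) : star (mu φ f) = mu φ (star f) :=
  cv_ext fun k => by simp [mu_ap, star_ap]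
theorem mu_shf (φ : Fin 48 ≃+ Fin 48) (i : Fin 48) (f : Cv) :
    mu φ (shf (φ i) f) = shf i (mu φ f) :=
  cv_ext fun k => by simp [mu_ap, shf_ap]

def wt (f : Cv) : ℕ := hammingNorm f.c

theorem wt_def (f : Cv) : wt f = (Finset.univ.filter fun i => f i ≠ 0).card := rfl
theorem wt_shf (i) (f : Cv) : wt (shf i f) = wt f := by
  rw [wt_def, wt_def]
  refine Finset.card_equiv (Equiv.subRight i) ?_
  intro k; rw [Finset.mem_filter_univ, Finset.mem_filter_univ]; rfl
theorem wt_mu (φ) (f : Cv) : wt (mu φ f) = wt f := by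
  rw [wt_def, wt_def]
  refine Finset.card_equiv φ.toEquiv ?_
  intro k; rw [Finset.mem_filter_univ, Finset.mem_filter_univ]; rfl
theorem wt_star (f : Cv) : wt (star f) = wt f := by rw [star_eq, wt_mu]

/-- the code of `f` -/
def code (f : Cv) : Submodule (ZMod 2) (Fin 48 ⊕ Fin 48 → ZMod 2) :=
  pureDCC (Matrix.circulant (fun i => f (-i)))

/-- codeword with information part `a` -/
def wd (f a : Cv) : Fin 48 ⊕ Fin 48 → ZMod 2 := Sum.elim a.c (a * f).c

theorem mem_code (f : Cv) (x : Fin 48 ⊕ Fin 48 → ZMod 2) :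
    x ∈ code f ↔ ∃ a : Cv, x = wd f a := by
  unfold code pureDCC
  rw [Submodule.mem_span_range_iff_exists_fun]
  have key : ∀ a : Cv, (∑ i, a i • (Sum.elim (fun j => if j = i then (1 : ZMod 2) else 0)
      (Matrix.circulant (fun i => f (-i)) i))) = wd f a := by
    intro a
    funext p
    rw [Finset.sum_apply]
    rcases p with j | j
    · simp [wd]
    · simp only [wd, Pi.smul_apply, Sum.elim_inr, Matrix.circulant_apply, smul_eq_mul, neg_sub]
      exact (mul_ap a f j).symm
  constructor
  · rintro ⟨a, h⟩; exact ⟨⟨a⟩, by rw [← key, ← h]⟩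
  · rintro ⟨a, h⟩; exact ⟨a.c, by rw [h, key]⟩

theorem wd_mem (f a : Cv) : wd f a ∈ code f := (mem_code f _).2 ⟨a, rfl⟩

theorem hn_sum (x : Fin 48 ⊕ Fin 48 → ZMod 2) :
    hammingNorm x = hammingNorm (fun i => x (Sum.inl i)) + hammingNorm (fun i => x (Sum.inr i)) := by
  simp only [hammingNorm, Finset.card_filter, Fintype.sum_sum_type]

theorem hn_wd (f a : Cv) : hammingNorm (wd f a) = wt a + wt (a * f) := by
  rw [hn_sum]; rfl

structure P (f : Cv) : Prop where
  U : f * star f = 1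
  S : wt f % 4 = 1
  M : ∀ a : Cv, a ≠ 0 → 16 ≤ wt a + wt (a * f)

def Concl (f : Cv) : Prop := autGroupOrder (code f) = 96

/-! ### weights of sums -/
theorem hn_add {ι : Type} [Fintype ι] (x y : ι → ZMod 2) :
    hammingNorm (x + y) + 2 * (Finset.univ.filter fun i => x i ≠ 0 ∧ y i ≠ 0).card
      = hammingNorm x + hammingNorm y := by
  classical
  simp only [hammingNorm, Finset.card_filter, Finset.mul_sum, ← Finset.sum_add_distrib]
  refine Finset.sum_congr rfl fun i _ => ?_
  have : ∀ a b : ZMod 2, ((if a + b ≠ 0 then 1 else 0) + 2 * (if a ≠ 0 ∧ b ≠ 0 then 1 else 0) : ℕ)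
    = (if a ≠ 0 then 1 else 0) + (if b ≠ 0 then 1 else 0) := by decide
  exact this _ _

theorem dot_card {ι : Type} [Fintype ι] (x y : ι → ZMod 2) :
    dot x y = ((Finset.univ.filter fun i => x i ≠ 0 ∧ y i ≠ 0).card : ZMod 2) := by
  classical
  unfold dot
  rw [Finset.card_filter, Nat.cast_sum]
  refine Finset.sum_congr rfl fun i _ => ?_
  have : ∀ a b : ZMod 2, a * b = ((if a ≠ 0 ∧ b ≠ 0 then 1 else 0 : ℕ) : ZMod 2) := by decide
  exact this _ _

theorem X_ap (i k : Fin 48) : X i k = if k = i then 1 else 0 := by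
  simp [X, shf_ap, one_ap, sub_eq_zero]

theorem wd_add (f a b : Cv) : wd f (a + b) = wd f a + wd f b := by
  funext p
  rcases p with j | j
  · rfl
  · simp only [wd, add_mul]; rfl

theorem dot_wd (f a b : Cv) : dot (wd f a) (wd f b) = (a * star b + (a * f) * star (b * f)) 0 := by
  simp only [dot, Fintype.sum_sum_type, wd, Sum.elim_inl, Sum.elim_inr, add_ap, mul_ap (_) (star _),
    star_ap, zero_sub, neg_neg]

theorem cv_induct {Q : Cv → Prop} (h0 : Q 0) (hX : ∀ i, Q (X i)) (ha : ∀ a b, Q a → Q b → Q (a + b))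
    (a : Cv) : Q a := by
  have h1 : ∀ s : Finset (Fin 48), ∀ a : Cv, (∀ i, a i ≠ 0 → i ∈ s) → Q a := by
    intro s
    induction s using Finset.induction_on with
    | empty =>
      intro a h
      have : a = 0 := cv_ext fun i => by
        by_contra hi; exact absurd (h i hi) (by simp)
      rw [this]; exact h0
    | insert j s hj ih =>
      intro a h
      rcases z2 (a j) with h0 | h1
      · refine ih a fun i hi => ?_
        have := h i hi
        rcases Finset.mem_insert.1 this with rfl | h2
        · exact absurd h0 hi
        · exact h2
      · rw [← cv_add_cancel (X j) a]
        refine ha _ _ (hX j) (ih _ fun i hi => ?_)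
        have hij : i ≠ j := by
          rintro rfl
          apply hi; rw [add_ap, X_ap, if_pos rfl, h1]; decide
        have : a i ≠ 0 := by
          rw [add_ap, X_ap, if_neg hij, zero_add] at hi; exact hi
        exact (Finset.mem_insert.1 (h i this)).resolve_left hij
  exact h1 Finset.univ a (fun i _ => Finset.mem_univ i)

theorem wt_X (i) : wt (X i) = 1 := by
  rw [X, wt_shf, wt_def]
  have : (Finset.univ.filter fun i => (1 : Cv) i ≠ 0) = {0} := by
    ext k; simp [one_ap]
  rw [this]; rfl

theorem wt_zero : wt 0 = 0 := hammingNorm_zero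
theorem wd_zero (f : Cv) : wd f 0 = 0 := by
  funext p
  rcases p with j | j
  · rfl
  · simp only [wd, zero_mul]; rfl

theorem dot_unit {f : Cv} (U : f * star f = 1) (a b : Cv) : dot (wd f a) (wd f b) = 0 := by
  rw [dot_wd, star_mul, show a * f * (star b * star f) = a * star b * (f * star f) by ring, U, mul_one,
    cv_add_self]; rfl

theorem wt_mod {f : Cv} (U : f * star f = 1) (c : ℕ) (hc : (1 + wt f + c) % 4 = 0) (h2 : c % 2 = 0)
    (a : Cv) : (hammingNorm (wd f a) + c * wt a) % 4 = 0 := by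
  induction a using cv_induct with
  | h0 => rw [wd_zero, wt_zero]; simp
  | hX i => rw [hn_wd, wt_X, X_mul, wt_shf]; simpa using hc
  | ha a b iha ihb =>
    have h1 := hn_add (wd f a) (wd f b)
    have h3 := dot_card (wd f a) (wd f b)
    rw [dot_unit U] at h3
    have h4 := (ZMod.natCast_eq_zero_iff _ 2).1 h3.symm
    rw [← wd_add] at h1
    have h5 : wt (a + b) + 2 * _ = wt a + wt b := hn_add a.c b.c
    obtain ⟨c, rfl⟩ : ∃ d, c = 2 * d := ⟨c / 2, by omega⟩
    obtain ⟨m, hm⟩ := h4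
    rw [hm] at h1
    generalize (Finset.univ.filter fun i => a.c i ≠ 0 ∧ b.c i ≠ 0).card = n at h5
    have h6 := congrArg (c * ·) h5
    simp only [mul_add] at h6
    have h7 : 2 * c * wt (a + b) + 4 * (c * n) = 2 * c * wt a + 2 * c * wt b := by nlinarith
    have e1 : c * (2 * n) = 2 * (c * n) := by ring
    generalize 2 * c * wt (a + b) = t1 at *
    generalize 2 * c * wt a = t2 at *
    generalize 2 * c * wt b = t3 at *
    omega

theorem P_of_hyp (f : Cv) (hsd : IsSelfDual (code f)) (hse : ∃ x ∈ code f, hammingNorm x % 4 = 2)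
    (hmin : MinWeightIs (code f) 16) : P f := by
  have U : f * star f = 1 := by
    refine cv_ext fun k => ?_
    have h := (hsd (wd f 1)).1 (wd_mem _ _) (wd f (X k)) (wd_mem _ _)
    rw [dot_wd, star_mul, one_mul, X, star_shf, star_one, shf_mul, one_mul, mul_shf, one_mul, add_ap,
      shf_ap, shf_ap, sub_neg_eq_add, zero_add] at h
    have := congrArg ((1 : Cv) k + ·) h
    simpa [← add_assoc, z2add] using this
  have hodd : (1 + wt f) % 2 = 0 := by
    have h := (hsd (wd f 1)).1 (wd_mem _ _) (wd f 1) (wd_mem _ _)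
    have h1 := hn_add (wd f 1) (wd f 1)
    rw [dot_card] at h
    have h4 := (ZMod.natCast_eq_zero_iff _ 2).1 h
    rw [← wd_add, cv_add_self, wd_zero, hammingNorm_zero, hn_wd, one_mul, ← shf_zero 1, ← X, wt_X] at h1
    rw [← shf_zero 1, ← X] at h4
    omega
  refine ⟨U, ?_, ?_⟩
  · by_contra hS
    obtain ⟨x, hx, h2⟩ := hse
    obtain ⟨a, rfl⟩ := (mem_code f x).1 hx
    have := wt_mod U 0 (by omega) rfl a
    omega
  · intro a ha
    rw [← hn_wd]
    refine hmin.2 _ (wd_mem _ _) fun h => ha ?_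
    refine cv_ext fun i => ?_
    exact congrFun h (Sum.inl i)

theorem P.even {f : Cv} (h : P f) {a : Cv} (ha : wt a + wt (a * f) = 16) : wt a % 2 = 0 := by
  have := wt_mod h.U 2 (by have := h.S; omega) rfl a
  rw [hn_wd, ha] at this
  omega

theorem P.ne {f : Cv} (h : P f) : ∃ a, a * f = 1 := ⟨star f, by rw [mul_comm]; exact h.U⟩

/-! ### equivalences -/
theorem mem_aut {ι : Type} [Fintype ι] (D : Submodule (ZMod 2) (ι → ZMod 2)) (σ : Equiv.Perm ι) :
    Submodule.map (LinearMap.funLeft (ZMod 2) (ZMod 2) ⇑σ) D = D ↔ ∀ x, x ∈ D ↔ x ∘ σ ∈ D := by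
  constructor
  · intro h x
    constructor
    · intro hx; rw [← h]; exact ⟨x, hx, rfl⟩
    · intro hx
      rw [← h] at hx
      obtain ⟨y, hy, hyx⟩ := hx
      have : y = x := by
        funext i
        have := congrFun hyx (σ.symm i)
        simpa [LinearMap.funLeft] using this
      exact this ▸ hy
  · intro h
    ext x
    constructor
    · rintro ⟨y, hy, rfl⟩; exact (h y).1 hy
    · intro hx
      refine ⟨x ∘ σ.symm, (h _).2 ?_, ?_⟩
      · rwa [Function.comp_assoc, Equiv.symm_comp_self]
      · funext i; simp [LinearMap.funLeft]

theorem aut_equiv {ι : Type} [Fintype ι] (C C' : Submodule (ZMod 2) (ι → ZMod 2)) (e : Equiv.Perm ι)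
    (h : ∀ x, x ∈ C' ↔ x ∘ e ∈ C) : autGroupOrder C' = autGroupOrder C := by
  unfold autGroupOrder
  refine Nat.card_congr (Equiv.subtypeEquiv (MulAut.conj e⁻¹).toEquiv ?_)
  intro σ
  rw [mem_aut, mem_aut]
  have hc : ∀ x, x ∈ C ↔ x ∘ e.symm ∈ C' := by
    intro x; rw [h, Function.comp_assoc, Equiv.symm_comp_self]; rfl
  simp only [MulEquiv.toEquiv_eq_coe, EquivLike.coe_coe, MulAut.conj_apply, inv_inv]
  constructor
  · intro hs x
    rw [hc, hs, h]; rfl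
  · intro hs x
    rw [h, hs, hc]
    have : (x ∘ ⇑e) ∘ ⇑(e⁻¹ * σ * e) ∘ ⇑e.symm = x ∘ σ := by
      funext i; simp
    rw [Function.comp_assoc, this]

theorem Concl_shf (i : Fin 48) (f : Cv) : Concl (shf i f) ↔ Concl f := by
  unfold Concl
  rw [aut_equiv (code f) (code (shf i f)) (Equiv.sumCongr (Equiv.refl _) (Equiv.addRight i))]
  intro x
  rw [mem_code, mem_code]
  refine exists_congr fun a => ?_
  have : wd f a = wd (shf i f) a ∘ (Equiv.sumCongr (Equiv.refl _) (Equiv.addRight i)) := by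
    funext p
    rcases p with j | j
    · rfl
    · simp [wd, mul_shf, shf_ap]
  rw [this]
  constructor
  · rintro rfl; rfl
  · intro h
    exact (Equiv.surjective _).injective_comp_right h

theorem Concl_mu (φ : Fin 48 ≃+ Fin 48) (f : Cv) : Concl (mu φ f) ↔ Concl f := by
  unfold Concl
  rw [aut_equiv (code (mu φ f)) (code f) (Equiv.sumCongr φ.toEquiv φ.toEquiv)]
  intro x
  rw [mem_code, mem_code]
  have : ∀ a, wd (mu φ f) (mu φ a) = wd f a ∘ (Equiv.sumCongr φ.toEquiv φ.toEquiv) := by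
    intro a
    funext p
    rcases p with j | j
    · rfl
    · simp [wd, ← mu_mul, mu_ap]
  constructor
  · rintro ⟨a, rfl⟩; exact ⟨mu φ a, (this a).symm⟩
  · rintro ⟨a, h⟩
    refine ⟨mu φ.symm a, ?_⟩
    have h2 : mu φ (mu φ.symm a) = a := cv_ext fun k => by simp [mu_ap]
    rw [← h2, this] at h
    exact (Equiv.surjective _).injective_comp_right h

theorem P_shf (i : Fin 48) {f : Cv} (h : P f) : P (shf i f) := by
  refine ⟨?_, ?_, ?_⟩
  · rw [star_shf, shf_mul, mul_shf, shf_shf, add_neg_cancel, shf_zero, h.U]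
  · rw [wt_shf, h.S]
  · intro a ha; rw [mul_shf, wt_shf]; exact h.M a ha

theorem P_mu (φ : Fin 48 ≃+ Fin 48) {f : Cv} (h : P f) : P (mu φ f) := by
  refine ⟨?_, ?_, ?_⟩
  · rw [star_mu, ← mu_mul, h.U, mu_one]
  · rw [wt_mu, h.S]
  · intro a ha
    obtain ⟨b, rfl⟩ : ∃ b, a = mu φ b := ⟨mu φ.symm a, cv_ext fun k => by simp [mu_ap]⟩
    rw [← mu_mul, wt_mu, wt_mu]
    refine h.M _ fun h0 => ha ?_
    rw [h0]; rfl

end DC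

namespace DC
abbrev Pt := Fin 48 ⊕ Fin 48

def IsAut (f : Cv) (σ : Equiv.Perm Pt) : Prop := ∀ x, x ∈ code f ↔ x ∘ σ ∈ code f

theorem IsAut.mul {f σ ρ} (h : IsAut f σ) (h' : IsAut f ρ) : IsAut f (σ * ρ) := fun x => by
  rw [h x, h' (x ∘ σ)]; rfl
theorem IsAut.inv {f σ} (h : IsAut f σ) : IsAut f σ⁻¹ := fun x => by
  rw [h (x ∘ _)]
  have : (x ∘ ⇑σ⁻¹) ∘ ⇑σ = x := by funext i; simp
  rw [this]

def sft (i : Fin 48) : Equiv.Perm Pt := Equiv.sumCongr (Equiv.addRight i) (Equiv.addRight i)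
def tau : Equiv.Perm Pt := (Equiv.sumCongr (Equiv.neg _) (Equiv.neg _)).trans (Equiv.sumComm _ _)

theorem sft_inl (i j) : sft i (Sum.inl j) = Sum.inl (j + i) := rfl
theorem sft_inr (i j) : sft i (Sum.inr j) = Sum.inr (j + i) := rfl
theorem tau_inl (j) : tau (Sum.inl j) = Sum.inr (-j) := rfl
theorem tau_inr (j) : tau (Sum.inr j) = Sum.inl (-j) := rfl
theorem tau_tau : (tau : Pt → Pt) ∘ tau = id := by
  funext p; rcases p with j | j <;> simp [tau_inl, tau_inr]

theorem wd_sft (f a : Cv) (i) : wd f a ∘ sft i = wd f (shf (-i) a) := by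
  funext p
  rcases p with j | j
  · simp [wd, sft_inl, shf_ap]
  · simp [wd, sft_inr, shf_mul, shf_ap]
theorem wd_tau {f : Cv} (U : f * star f = 1) (a : Cv) : wd f a ∘ tau = wd f (star (a * f)) := by
  have : star (a * f) * f = star a := by
    rw [star_mul, mul_assoc, mul_comm (star f), U, mul_one]
  funext p
  rcases p with j | j
  · simp [wd, tau_inl, star_ap]
  · simp [wd, tau_inr, this, star_ap]

theorem aut_sft (f : Cv) (i) : IsAut f (sft i) := by
  have h : ∀ i x, x ∈ code f → x ∘ sft i ∈ code f := by
    intro i x hx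
    obtain ⟨a, rfl⟩ := (mem_code f x).1 hx
    rw [wd_sft]; exact wd_mem _ _
  intro x
  refine ⟨h i x, fun hx => ?_⟩
  have := h (-i) _ hx
  have e : (x ∘ ⇑(sft i)) ∘ ⇑(sft (-i)) = x := by
    funext p; rcases p with j | j <;> simp [sft_inl, sft_inr]
  rwa [e] at this
theorem aut_tau {f : Cv} (U : f * star f = 1) : IsAut f tau := by
  have h : ∀ x, x ∈ code f → x ∘ tau ∈ code f := by
    intro x hx
    obtain ⟨a, rfl⟩ := (mem_code f x).1 hx
    rw [wd_tau U]; exact wd_mem _ _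
  intro x
  refine ⟨h x, fun hx => ?_⟩
  have := h _ hx
  rwa [Function.comp_assoc, tau_tau, Function.comp_id] at this

open Classical in
noncomputable def lam (f : Cv) (p q : Pt) : ℕ :=
  (Finset.univ.filter fun x : Pt → ZMod 2 =>
    (x ∈ code f ∧ hammingNorm x = 16) ∧ x p ≠ 0 ∧ x q ≠ 0).card

theorem hn_comp (x : Pt → ZMod 2) (σ : Equiv.Perm Pt) : hammingNorm (x ∘ σ) = hammingNorm x := by
  unfold hammingNorm
  refine Finset.card_equiv σ ?_
  intro k; rw [Finset.mem_filter_univ, Finset.mem_filter_univ]; rfl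

theorem lam_aut {f σ} (h : IsAut f σ) (p q : Pt) : lam f (σ p) (σ q) = lam f p q := by
  classical
  unfold lam
  refine Finset.card_equiv (Equiv.arrowCongr σ.symm (Equiv.refl _)) ?_
  intro x
  rw [Finset.mem_filter_univ, Finset.mem_filter_univ]
  have e : (Equiv.arrowCongr σ.symm (Equiv.refl _)) x = x ∘ σ := rfl
  rw [e, ← h x, hn_comp]; rfl

structure Sep (f : Cv) (j j' : Fin 48) : Prop where
  h1 : ∀ q : Pt, q ≠ Sum.inl 0 → q ≠ Sum.inr j → lam f (Sum.inl 0) q ≠ lam f (Sum.inl 0) (Sum.inr j)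
  h2 : ∀ q : Pt, q ≠ Sum.inl 0 → q ≠ Sum.inr j' → lam f (Sum.inl 0) q ≠ lam f (Sum.inl 0) (Sum.inr j')
  gen : ∀ i : Fin 48, ∃ n : Fin 48, i = n * (j - j')

theorem fix_step {f : Cv} {j j'} (hs : Sep f j j') {σ} (h : IsAut f σ)
    (h0 : σ (Sum.inl 0) = Sum.inl 0) : σ (Sum.inr j) = Sum.inr j ∧ σ (Sum.inr j') = Sum.inr j' := by
  have key : ∀ q : Pt, q ≠ Sum.inl 0 → σ q ≠ Sum.inl 0 := by
    intro q hq h1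
    exact hq (σ.injective (h1.trans h0.symm))
  have e : ∀ q, lam f (Sum.inl 0) (σ q) = lam f (Sum.inl 0) q := by
    intro q
    have := lam_aut h (Sum.inl 0) q
    rwa [h0] at this
  constructor
  · by_contra hc
    exact hs.h1 _ (key _ (by simp)) hc (e _)
  · by_contra hc
    exact hs.h2 _ (key _ (by simp)) hc (e _)

theorem fixL {f : Cv} {j j'} (hs : Sep f j j') {σ} (h : IsAut f σ) {i}
    (h0 : σ (Sum.inl i) = Sum.inl i) :
    σ (Sum.inr (j + i)) = Sum.inr (j + i) ∧ σ (Sum.inr (j' + i)) = Sum.inr (j' + i) := by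
  have h1 : IsAut f ((sft i)⁻¹ * σ * sft i) := ((aut_sft f i).inv.mul h).mul (aut_sft f i)
  have h2 := fix_step hs h1 (by
    simp only [Equiv.Perm.mul_apply, sft_inl, zero_add, h0]
    rw [Equiv.Perm.inv_eq_iff_eq, sft_inl, zero_add])
  simp only [Equiv.Perm.mul_apply, sft_inr, Equiv.Perm.inv_eq_iff_eq] at h2
  exact h2

theorem fixR {f : Cv} (U : f * star f = 1) {j j'} (hs : Sep f j j') {σ} (h : IsAut f σ) {i}
    (h0 : σ (Sum.inr i) = Sum.inr i) :
    σ (Sum.inl (i - j)) = Sum.inl (i - j) ∧ σ (Sum.inl (i - j')) = Sum.inl (i - j') := by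
  have h1 : IsAut f ((tau)⁻¹ * σ * tau) := ((aut_tau U).inv.mul h).mul (aut_tau U)
  have h2 := fixL hs h1 (i := -i) (by
    simp only [Equiv.Perm.mul_apply, tau_inl, neg_neg, h0]
    rw [Equiv.Perm.inv_eq_iff_eq, tau_inl, neg_neg])
  simp only [Equiv.Perm.mul_apply, tau_inr, Equiv.Perm.inv_eq_iff_eq, neg_add, neg_neg] at h2
  rw [sub_eq_add_neg, sub_eq_add_neg, add_comm i, add_comm i]
  exact h2

theorem fix_all {f : Cv} (U : f * star f = 1) {j j'} (hs : Sep f j j') {σ} (h : IsAut f σ)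
    (h0 : σ (Sum.inl 0) = Sum.inl 0) : σ = 1 := by
  have st : ∀ i, σ (Sum.inl i) = Sum.inl i → σ (Sum.inl (i + (j - j'))) = Sum.inl (i + (j - j')) := by
    intro i hi
    have := (fixR U hs h (fixL hs h hi).1).2
    have e : j + i - j' = i + (j - j') := by abel
    rwa [e] at this
  have hn : ∀ n : ℕ, σ (Sum.inl (n • (j - j'))) = Sum.inl (n • (j - j')) := by
    intro n
    induction n with
    | zero => simpa using h0
    | succ n ih => rw [succ_nsmul]; exact st _ ih
  have hL : ∀ i, σ (Sum.inl i) = Sum.inl i := by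
    intro i
    obtain ⟨n, hn'⟩ := hs.gen i
    have e : i = n.val • (j - j') := by
      rw [hn']; generalize j - j' = d
      have : ∀ n d : Fin 48, n * d = n.val • d := by
        intro n d
        obtain ⟨n, hn⟩ := n
        induction n with
        | zero => simp
        | succ n ih =>
          have := ih (by omega)
          simp only [succ_nsmul] at this ⊢
          rw [← this]
          ext
          simp [Fin.val_mul, Fin.val_add, Nat.add_mul]
      exact this n d
    rw [e]; exact hn _
  ext p
  rcases p with i | i
  · rw [hL]; rfl
  · have := (fixL hs h (hL (i - j))).1
    rw [add_sub_cancel] at this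
    rw [this]; rfl

theorem aut96 {f : Cv} (U : f * star f = 1) {j j'} (hs : Sep f j j') : Concl f := by
  unfold Concl autGroupOrder
  have e : {σ : Equiv.Perm Pt // Submodule.map (LinearMap.funLeft (ZMod 2) (ZMod 2) ⇑σ) (code f) = code f}
      ≃ Pt := by
    refine Equiv.ofBijective (fun σ => σ.1 (Sum.inl 0)) ⟨?_, ?_⟩
    · rintro ⟨σ, h⟩ ⟨ρ, h'⟩ e
      have a1 : IsAut f σ := (mem_aut _ _).1 h
      have a2 : IsAut f ρ := (mem_aut _ _).1 h'
      have := fix_all U hs (a2.inv.mul a1) (by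
        simp only [Equiv.Perm.mul_apply, Equiv.Perm.inv_eq_iff_eq]; exact e)
      rw [inv_mul_eq_one] at this
      exact Subtype.ext this.symm
    · intro p
      rcases p with i | i
      · exact ⟨⟨sft i, (mem_aut _ _).2 (aut_sft f i)⟩, by simp [sft_inl]⟩
      · exact ⟨⟨sft i * tau, (mem_aut _ _).2 ((aut_sft f i).mul (aut_tau U))⟩, by
          simp [sft_inr, tau_inl]⟩
  rw [Nat.card_congr e]; simp
end DC

namespace DC

theorem cvsum_ap {ι : Type*} (s : Finset ι) (F : ι → Cv) (k) : (∑ i ∈ s, F i) k = ∑ i ∈ s, F i k := by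
  classical
  induction s using Finset.induction_on with
  | empty => rfl
  | insert a s ha ih => rw [Finset.sum_insert ha, Finset.sum_insert ha, add_ap, ih]

def bv (x : ℕ) : Cv := ⟨fun i => if x.testBit i.val then 1 else 0⟩
theorem bv_ap (x : ℕ) (i : Fin 48) : bv x i = if x.testBit i.val then 1 else 0 := rfl
theorem bv_ne (x : ℕ) (i : Fin 48) : bv x i ≠ 0 ↔ x.testBit i.val = true := by
  rw [bv_ap]; split <;> simp_all

theorem bv_xor (x y : ℕ) : bv (x ^^^ y) = bv x + bv y := cv_ext fun i => by
  rw [add_ap, bv_ap, bv_ap, bv_ap, Nat.testBit_xor]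
  cases x.testBit i.val <;> cases y.testBit i.val <;> decide
theorem bv_zero : bv 0 = 0 := cv_ext fun i => by simp [bv_ap, zero_ap]
theorem bv_inj {x y : ℕ} (hx : x < 2 ^ 48) (hy : y < 2 ^ 48) (h : bv x = bv y) : x = y := by
  refine Nat.eq_of_testBit_eq fun i => ?_
  by_cases hi : i < 48
  · have := congrFun (congrArg Cv.c h) ⟨i, hi⟩
    simp only [bv_ap] at this
    cases h1 : x.testBit i <;> cases h2 : y.testBit i <;> simp_all
  · have h48 : 2 ^ 48 ≤ 2 ^ i := Nat.pow_le_pow_right (by norm_num) (by omega)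
    rw [Nat.testBit_lt_two_pow (hx.trans_le h48), Nat.testBit_lt_two_pow (hy.trans_le h48)]
theorem bv_two_pow (p : Fin 48) : bv (2 ^ p.val) = X p := cv_ext fun i => by
  rw [bv_ap, X_ap, Nat.testBit_two_pow]
  by_cases h : i = p
  · simp [h]
  · have : ¬ p.val = i.val := fun e => h (Fin.ext e.symm)
    simp [h, this]
theorem bv_one : bv 1 = 1 := by
  have := bv_two_pow 0
  rw [X, shf_zero] at this; exact this

theorem bv_surj (f : Cv) : ∃ x < 2 ^ 48, bv x = f := by
  refine ⟨Nat.ofBits fun i : Fin 48 => decide (f i ≠ 0), Nat.ofBits_lt_two_pow _, ?_⟩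
  refine cv_ext fun i => ?_
  rw [bv_ap, Nat.testBit_ofBits_lt _ _ i.isLt]
  rcases z2 (f i) with h | h <;> simp [h]

/-! rotation -/
def rot (p x : ℕ) : ℕ := (x % 2 ^ (48 - p)) * 2 ^ p + x / 2 ^ (48 - p)

theorem rot_lt {p x : ℕ} (hp : p ≤ 48) (hx : x < 2 ^ 48) : rot p x < 2 ^ 48 := by
  unfold rot
  have e : 2 ^ 48 = 2 ^ (48 - p) * 2 ^ p := by rw [← pow_add]; congr 1; omega
  have h1 : x % 2 ^ (48 - p) < 2 ^ (48 - p) := Nat.mod_lt _ (by positivity)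
  have h2 : x / 2 ^ (48 - p) < 2 ^ p := by rw [Nat.div_lt_iff_lt_mul (by positivity), mul_comm, ← e]; exact hx
  rw [e]
  have h3 : (x % 2 ^ (48 - p) + 1) * 2 ^ p ≤ 2 ^ (48 - p) * 2 ^ p := Nat.mul_le_mul_right _ h1
  rw [add_mul, one_mul] at h3
  omega

theorem bv_rot (p : Fin 48) {x : ℕ} (hx : x < 2 ^ 48) : bv (rot p x) = shf p (bv x) := by
  refine cv_ext fun j => ?_
  rw [bv_ap, shf_ap, bv_ap]
  have h2 : x / 2 ^ (48 - p.val) < 2 ^ p.val := by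
    rw [Nat.div_lt_iff_lt_mul (by positivity), ← pow_add]
    have : p.val + (48 - p.val) = 48 := by omega
    rw [this]; exact hx
  have : (rot p.val x).testBit j.val = x.testBit (j - p).val := by
    unfold rot
    rw [mul_comm, Nat.testBit_two_pow_mul_add _ h2, Fin.val_sub]
    split
    · rw [Nat.testBit_div_two_pow]
      congr 1
      rw [Nat.mod_eq_of_lt (by omega)]
      omega
    · rw [Nat.testBit_mod_two_pow]
      have h3 : (48 - p.val + j.val) % 48 = j.val - p.val := by omega
      rw [h3]
      have : j.val - p.val < 48 - p.val := by omega
      simp [this]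
  rw [this]

def rotq (q x : ℕ) : ℕ := Nat.add (Nat.mod (Nat.mul q x) 281474976710656) (Nat.div (Nat.mul q x) 281474976710656)
theorem rotq_eq {p : ℕ} (hp : p ≤ 48) (x : ℕ) : rotq (2 ^ p) x = rot p x := by
  have e : 281474976710656 = 2 ^ p * 2 ^ (48 - p) := by
    rw [← pow_add, Nat.add_sub_cancel' hp]; norm_num
  have : rotq (2 ^ p) x = (2 ^ p * x) % 281474976710656 + (2 ^ p * x) / 281474976710656 := rfl
  rw [this, e, Nat.mul_mod_mul_left, Nat.mul_div_mul_left _ _ (by positivity), rot, mul_comm]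

/-! set bits -/
def sb (x : ℕ) : Finset ℕ := (Finset.range 48).filter fun i => x.testBit i = true
theorem mem_sb {x i : ℕ} : i ∈ sb x ↔ i < 48 ∧ x.testBit i = true := by simp [sb]

theorem low_bit (x : ℕ) (hx : x ≠ 0) : ∃ p, x.testBit p = true ∧ x - (x &&& (x - 1)) = 2 ^ p ∧
    ∀ i, (x &&& (x - 1)).testBit i = (x.testBit i && decide (i ≠ p)) := by
  induction x using Nat.strong_induction_on with
  | _ x ih =>
  rcases Nat.even_or_odd' x with ⟨y, rfl | rfl⟩
  · have hy : y ≠ 0 := by omega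
    obtain ⟨p, h1, h2, h3⟩ := ih y (by omega) hy
    have e : 2 * y &&& (2 * y - 1) = 2 * (y &&& (y - 1)) := by
      refine Nat.eq_of_testBit_eq fun i => ?_
      have : 2 * y - 1 = 2 * (y - 1) + 1 := by omega
      rw [this]
      cases i with
      | zero => simp
      | succ i =>
        rw [Nat.testBit_and, Nat.testBit_succ, Nat.testBit_succ, Nat.testBit_succ]
        have a1 : 2 * y / 2 = y := by omega
        have a2 : (2 * (y - 1) + 1) / 2 = y - 1 := by omega
        have a3 : 2 * (y &&& (y - 1)) / 2 = y &&& (y - 1) := by omega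
        rw [a1, a2, a3, Nat.testBit_and]
    refine ⟨p + 1, ?_, ?_, ?_⟩
    · rw [Nat.testBit_succ]; simpa using h1
    · rw [e, ← Nat.mul_sub, h2, pow_succ]; ring
    · intro i
      rw [e]
      cases i with
      | zero => simp
      | succ i =>
        rw [Nat.testBit_succ, Nat.testBit_succ]
        have a1 : 2 * y / 2 = y := by omega
        have a3 : 2 * (y &&& (y - 1)) / 2 = y &&& (y - 1) := by omega
        rw [a1, a3, h3]
        simp
  · refine ⟨0, by simp, ?_, ?_⟩
    · have e : 2 * y + 1 &&& (2 * y + 1 - 1) = 2 * y := by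
        refine Nat.eq_of_testBit_eq fun i => ?_
        rw [Nat.add_sub_cancel]
        cases i with
        | zero => simp
        | succ i =>
          rw [Nat.testBit_and, Nat.testBit_succ, Nat.testBit_succ]
          have a1 : 2 * y / 2 = y := by omega
          have a2 : (2 * y + 1) / 2 = y := by omega
          rw [a1, a2, Bool.and_self]
      rw [e]; omega
    · intro i
      rw [Nat.add_sub_cancel]
      cases i with
      | zero => simp
      | succ i =>
        rw [Nat.testBit_and, Nat.testBit_succ, Nat.testBit_succ]
        have a1 : 2 * y / 2 = y := by omega
        have a2 : (2 * y + 1) / 2 = y := by omega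
        rw [a1, a2]; simp

noncomputable def force {α : Type} (x : ℕ) (k : ℕ → α) : α := Nat.rec (k 0) (fun n _ => k (Nat.succ n)) x
theorem force_eq {α : Type} (x : ℕ) (k : ℕ → α) : force x k = k x := by
  cases x <;> rfl
noncomputable def lazy {α : Type} (x : ℕ) (k : ℕ → α) : α := k x
theorem lazy_eq {α : Type} (x : ℕ) (k : ℕ → α) : lazy x k = k x := rfl

noncomputable def bf (g : ℕ → ℕ → ℕ) (n : ℕ) : ℕ → ℕ → ℕ :=
  Nat.rec (fun _ acc => acc) (fun _ ih x acc =>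
    Bool.rec (force (Nat.land x (Nat.sub x 1)) fun y => force (g (Nat.sub x y) acc) fun a => ih y a) acc
      (Nat.beq x 0)) n

theorem bf_zero (g) (x acc) : bf g 0 x acc = acc := rfl
theorem bf_succ (g) (n x acc) : bf g (n + 1) x acc =
    if x = 0 then acc else bf g n (x &&& (x - 1)) (g (x - (x &&& (x - 1))) acc) := by
  have : bf g (n + 1) x acc = Bool.rec (force (Nat.land x (Nat.sub x 1)) fun y =>
    force (g (Nat.sub x y) acc) fun a => bf g n y a) acc (Nat.beq x 0) := rfl
  rw [this, force_eq, force_eq]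
  by_cases h : x = 0
  · subst h; rfl
  · have hb : Nat.beq x 0 = false := by
      cases x with
      | zero => exact absurd rfl h
      | succ n => rfl
    rw [if_neg h, hb]; rfl

theorem bf_spec {β : Type*} [AddCommMonoid β] (g : ℕ → ℕ → ℕ) (I : ℕ → Prop) (h : ℕ → β) (φ : ℕ → β)
    (hg : ∀ p < 48, ∀ acc, I acc → I (g (2 ^ p) acc) ∧ h (g (2 ^ p) acc) = φ p + h acc) (n x acc : ℕ)
    (hx : x < 2 ^ 48) (hn : (sb x).card ≤ n) (hI : I acc) :
    I (bf g n x acc) ∧ h (bf g n x acc) = ∑ p ∈ sb x, φ p + h acc := by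
  induction n generalizing x acc with
  | zero =>
    have : sb x = ∅ := Finset.card_eq_zero.1 (by omega)
    rw [bf_zero, this]; simp [hI]
  | succ n ih =>
    rw [bf_succ]
    split
    · next h0 => subst h0; simp [sb, hI]
    · next h0 =>
      obtain ⟨p, h1, h2, h3⟩ := low_bit x h0
      have hp : p < 48 := by
        by_contra hc
        have h48 : 2 ^ 48 ≤ 2 ^ p := Nat.pow_le_pow_right (by norm_num) (by omega)
        rw [Nat.testBit_lt_two_pow (hx.trans_le h48)] at h1
        simp at h1
      have hs : sb (x &&& (x - 1)) = (sb x).erase p := by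
        ext i; rw [mem_sb, Finset.mem_erase, mem_sb, h3]; simp; tauto
      have hps : p ∈ sb x := mem_sb.2 ⟨hp, h1⟩
      have hg' := hg p hp acc hI
      rw [h2]
      have := ih (x &&& (x - 1)) (g (2 ^ p) acc) (lt_of_le_of_lt Nat.and_le_left hx)
        (by rw [hs, Finset.card_erase_of_mem hps]; omega) hg'.1
      refine ⟨this.1, ?_⟩
      rw [this.2, hs, hg'.2, ← Finset.add_sum_erase _ _ hps]
      abel

theorem sb_card (x : ℕ) : (sb x).card ≤ 48 := by
  have := Finset.card_filter_le (Finset.range 48) fun i => x.testBit i = true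
  simpa [sb] using this

theorem sum_sb {β : Type*} [AddCommMonoid β] (x : ℕ) (φ : ℕ → β) :
    ∑ p ∈ sb x, φ p = ∑ i : Fin 48, if x.testBit i.val then φ i.val else 0 := by
  rw [sb, Finset.sum_filter, Finset.sum_range]

theorem wt_bv (x : ℕ) : wt (bv x) = (sb x).card := by
  rw [wt_def, Finset.card_eq_sum_ones, Finset.card_eq_sum_ones, sum_sb, Finset.sum_filter]
  refine Finset.sum_congr rfl fun i _ => ?_
  simp only [bv_ne]

theorem cv_sum_X (a : Cv) : a = ∑ i, if a i ≠ 0 then X i else 0 := by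
  refine cv_ext fun k => ?_
  rw [cvsum_ap, Finset.sum_eq_single k]
  · rcases z2 (a k) with h | h <;> simp [h, X_ap, zero_ap]
  · intro b _ hb
    split
    · rw [X_ap, if_neg (Ne.symm hb)]
    · rfl
  · simp

noncomputable def mulN (a r : ℕ) : ℕ := bf (fun q acc => Nat.xor acc (rotq q r)) 48 a 0

theorem mulN_spec {a r : ℕ} (ha : a < 2 ^ 48) (hr : r < 2 ^ 48) :
    mulN a r < 2 ^ 48 ∧ bv (mulN a r) = bv a * bv r := by
  have := bf_spec (fun q acc => Nat.xor acc (rotq q r)) (fun x => x < 2 ^ 48) bv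
    (fun p => shf (Fin.ofNat 48 p) (bv r)) ?_ 48 a 0 ha (sb_card a) (by norm_num)
  · refine ⟨this.1, ?_⟩
    rw [mulN, this.2, bv_zero, add_zero, sum_sb]
    conv_rhs => rw [cv_sum_X (bv a), Finset.sum_mul]
    refine Finset.sum_congr rfl fun i _ => ?_
    simp only [bv_ne, ite_mul, zero_mul, X_mul]
    have : Fin.ofNat 48 i.val = i := by ext; simp
    rw [this]
  · intro p hp acc hacc
    rw [rotq_eq hp.le]
    refine ⟨Nat.xor_lt_two_pow hacc (rot_lt hp.le hr), ?_⟩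
    have h1 := bv_rot ⟨p, hp⟩ hr
    have h2 : bv (acc.xor (rot p r)) = bv acc + bv (rot p r) := bv_xor _ _
    have : Fin.ofNat 48 p = ⟨p, hp⟩ := by ext; simp [Nat.mod_eq_of_lt hp]
    rw [h2, h1, this, add_comm]

/-! multipliers -/
noncomputable def mulm (k x : ℕ) : ℕ := bf (fun q acc => Nat.xor acc (Nat.mod (Nat.pow q k) 281474976710655)) 48 x 0

theorem pow_fold (p k : ℕ) : (2 ^ p) ^ k % 281474976710655 = 2 ^ (p * k % 48) := by
  rw [← pow_mul]
  conv_lhs => rw [← Nat.div_add_mod (p * k) 48, pow_add, pow_mul]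
  have h : (2 ^ 48) ^ (p * k / 48) % 281474976710655 = 1 := by
    rw [Nat.pow_mod]; norm_num
  rw [Nat.mul_mod, h, one_mul, Nat.mod_mod]
  refine Nat.mod_eq_of_lt ?_
  have : 2 ^ (p * k % 48) ≤ 2 ^ 47 := Nat.pow_le_pow_right (by norm_num) (by omega)
  exact lt_of_le_of_lt this (by norm_num)

/-- multiplication by `k`, with inverse `k'` -/
def mulEq (k k' : Fin 48) (h : k * k' = 1) : Fin 48 ≃+ Fin 48 where
  toFun j := k' * j
  invFun j := k * j
  left_inv j := by
    have : ∀ k k' j : Fin 48, k * (k' * j) = (k * k') * j := fun a b c => (Fin.mul_assoc a b c).symm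
    simp only [this, h]; exact Fin.one_mul j
  right_inv j := by
    have : ∀ k k' j : Fin 48, k' * (k * j) = (k * k') * j := fun a b c => by
      rw [← Fin.mul_assoc, Fin.mul_comm b a]
    simp only [this, h]; exact Fin.one_mul j
  map_add' a b := by
    ext
    simp [Fin.val_mul, Fin.val_add, Nat.mul_add]

theorem mulm_spec (k k' : Fin 48) (h : k * k' = 1) {x : ℕ} (hx : x < 2 ^ 48) :
    mulm k x < 2 ^ 48 ∧ bv (mulm k x) = mu (mulEq k k' h) (bv x) := by
  have := bf_spec (fun q acc => Nat.xor acc (Nat.mod (Nat.pow q k) 281474976710655)) (fun x => x < 2 ^ 48) bv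
    (fun p => X (Fin.ofNat 48 (p * k))) ?_ 48 x 0 hx (sb_card x) (by norm_num)
  · refine ⟨this.1, ?_⟩
    rw [mulm, this.2, bv_zero, add_zero, sum_sb]
    conv_rhs => rw [cv_sum_X (bv x)]
    have hmu : ∀ (F : Fin 48 → Cv), mu (mulEq k k' h) (∑ i, F i) = ∑ i, mu (mulEq k k' h) (F i) := by
      intro F
      refine cv_ext fun j => ?_
      rw [mu_ap, cvsum_ap, cvsum_ap]; rfl
    rw [hmu]
    refine Finset.sum_congr rfl fun i _ => ?_
    simp only [bv_ne]
    split
    · refine cv_ext fun j => ?_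
      rw [mu_ap, X_ap, X_ap]
      have : Fin.ofNat 48 (i.val * k.val) = (mulEq k k' h).symm i := by
        have e : (mulEq k k' h).symm i = k * i := rfl
        rw [e]; ext; simp [Fin.val_mul, mul_comm]
      rw [this]
      simp only [AddEquiv.eq_symm_apply]
    · rfl
  · intro p hp acc hacc
    have e : Nat.mod (Nat.pow (2 ^ p) k) 281474976710655 = 2 ^ (p * k % 48) := pow_fold p k
    rw [e]
    have hlt : p * k.val % 48 < 48 := Nat.mod_lt _ (by norm_num)
    refine ⟨Nat.xor_lt_two_pow hacc (Nat.pow_lt_pow_right (by norm_num) hlt), ?_⟩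
    have h2 : bv (acc.xor (2 ^ (p * k.val % 48))) = bv acc + bv (2 ^ (p * k.val % 48)) := bv_xor _ _
    have h3 := bv_two_pow (Fin.ofNat 48 (p * k.val))
    rw [Fin.val_ofNat] at h3
    rw [h2, h3, add_comm]

end DC

namespace DC

theorem tb_cons (W x A i : ℕ) (hx : x < 2 ^ W) :
    (x + 2 ^ W * A).testBit i = if i < W then x.testBit i else A.testBit (i - W) := by
  rw [add_comm, Nat.testBit_two_pow_mul_add _ hx]

theorem land_cons {W x m : ℕ} (A M : ℕ) (hx : x < 2 ^ W) (hm : m < 2 ^ W) :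
    (x + 2 ^ W * A) &&& (m + 2 ^ W * M) = (x &&& m) + 2 ^ W * (A &&& M) := by
  refine Nat.eq_of_testBit_eq fun i => ?_
  rw [Nat.testBit_and, tb_cons _ _ _ _ hx, tb_cons _ _ _ _ hm,
    tb_cons _ _ _ _ (lt_of_le_of_lt Nat.and_le_left hx)]
  split <;> rw [Nat.testBit_and]

theorem xor_cons {W x m : ℕ} (A M : ℕ) (hx : x < 2 ^ W) (hm : m < 2 ^ W) :
    (x + 2 ^ W * A) ^^^ (m + 2 ^ W * M) = (x ^^^ m) + 2 ^ W * (A ^^^ M) := by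
  refine Nat.eq_of_testBit_eq fun i => ?_
  rw [Nat.testBit_xor, tb_cons _ _ _ _ hx, tb_cons _ _ _ _ hm,
    tb_cons _ _ _ _ (Nat.xor_lt_two_pow hx hm)]
  split <;> rw [Nat.testBit_xor]

theorem lor_cons {W x m : ℕ} (A M : ℕ) (hx : x < 2 ^ W) (hm : m < 2 ^ W) :
    (x + 2 ^ W * A) ||| (m + 2 ^ W * M) = (x ||| m) + 2 ^ W * (A ||| M) := by
  refine Nat.eq_of_testBit_eq fun i => ?_
  rw [Nat.testBit_or, tb_cons _ _ _ _ hx, tb_cons _ _ _ _ hm,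
    tb_cons _ _ _ _ (Nat.or_lt_two_pow hx hm)]
  split <;> rw [Nat.testBit_or]

theorem shr_cons {W s x m : ℕ} (A M : ℕ) (hs : s ≤ W) (hx : x < 2 ^ W) (hm : m < 2 ^ (W - s)) :
    ((x + 2 ^ W * A) >>> s) &&& (m + 2 ^ W * M) = ((x >>> s) &&& m) + 2 ^ W * ((A >>> s) &&& M) := by
  have hm' : m < 2 ^ W := hm.trans_le (Nat.pow_le_pow_right (by norm_num) (by omega))
  refine Nat.eq_of_testBit_eq fun i => ?_
  rw [Nat.testBit_and, Nat.testBit_shiftRight, tb_cons _ _ _ _ hx, tb_cons _ _ _ _ hm',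
    tb_cons _ _ _ _ (lt_of_le_of_lt Nat.and_le_right hm')]
  by_cases h : i < W
  · rw [if_pos h, if_pos h, Nat.testBit_and, Nat.testBit_shiftRight]
    by_cases h2 : s + i < W
    · rw [if_pos h2]
    · have : m.testBit i = false := Nat.testBit_lt_two_pow
        (hm.trans_le (Nat.pow_le_pow_right (by norm_num) (by omega)))
      rw [this, Bool.and_false, Bool.and_false]
  · rw [if_neg h, if_neg h, if_neg (by omega), Nat.testBit_and, Nat.testBit_shiftRight]
    congr 2; omega

noncomputable def P2 (s m x : ℕ) : ℕ := Nat.add (Nat.land x m) (Nat.land (Nat.shiftRight x s) m)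
theorem P2_eq (s m x : ℕ) : P2 s m x = (x &&& m) + ((x >>> s) &&& m) := rfl
noncomputable def Y3 (m1 m2 m4 x : ℕ) : ℕ := P2 4 m4 (P2 2 m2 (Nat.sub x (Nat.land (Nat.shiftRight x 1) m1)))
theorem Y3_eq (m1 m2 m4 x : ℕ) : Y3 m1 m2 m4 x = P2 4 m4 (P2 2 m2 (x - ((x >>> 1) &&& m1))) := rfl

theorem P2_cons {W s x m : ℕ} (A M : ℕ) (hs : s ≤ W) (hx : x < 2 ^ W) (hm : m < 2 ^ (W - s)) :
    P2 s (m + 2 ^ W * M) (x + 2 ^ W * A) = P2 s m x + 2 ^ W * P2 s M A := by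
  have hm' : m < 2 ^ W := hm.trans_le (Nat.pow_le_pow_right (by norm_num) (by omega))
  rw [P2_eq, P2_eq, P2_eq, land_cons _ _ hx hm', shr_cons _ _ hs hx hm]; ring

theorem shr1_le (x m : ℕ) : (x >>> 1) &&& m ≤ x := by
  refine Nat.and_le_left.trans ?_
  rw [Nat.shiftRight_eq_div_pow]; exact Nat.div_le_self _ _

theorem P2_lt {W s m : ℕ} (x : ℕ) (hs : 1 ≤ s) (hW : s ≤ W) (hm : m < 2 ^ (W - s)) : P2 s m x < 2 ^ W := by
  rw [P2_eq]
  have h1 : x &&& m ≤ m := Nat.and_le_right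
  have h2 : (x >>> s) &&& m ≤ m := Nat.and_le_right
  have h3 : 2 ^ (W - s) * 2 ≤ 2 ^ W := by
    rw [← pow_succ]; exact Nat.pow_le_pow_right (by norm_num) (by omega)
  omega

theorem Y3_cons {W x m1 m2 m4 : ℕ} (A M1 M2 M4 : ℕ) (hW : 4 ≤ W) (hx : x < 2 ^ W) (h1 : m1 < 2 ^ (W - 1))
    (h2 : m2 < 2 ^ (W - 2)) (h4 : m4 < 2 ^ (W - 4)) :
    Y3 (m1 + 2 ^ W * M1) (m2 + 2 ^ W * M2) (m4 + 2 ^ W * M4) (x + 2 ^ W * A) =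
      Y3 m1 m2 m4 x + 2 ^ W * Y3 M1 M2 M4 A := by
  rw [Y3_eq, Y3_eq, Y3_eq, shr_cons _ _ (by omega) hx h1]
  have e : x + 2 ^ W * A - ((x >>> 1 &&& m1) + 2 ^ W * (A >>> 1 &&& M1)) =
      (x - (x >>> 1 &&& m1)) + 2 ^ W * (A - (A >>> 1 &&& M1)) := by
    have a1 := shr1_le x m1
    have a2 := Nat.mul_le_mul_left (2 ^ W) (shr1_le A M1)
    rw [Nat.mul_sub]
    omega
  have hx' : x - (x >>> 1 &&& m1) < 2 ^ W := lt_of_le_of_lt (Nat.sub_le _ _) hx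
  rw [e, P2_cons _ _ (by omega) hx' h2, P2_cons _ _ (by omega) (P2_lt _ (by omega) (by omega) h2) h4]

def pcn (n x : ℕ) : ℕ := ∑ i ∈ Finset.range n, (x.testBit i).toNat
theorem pcn_add (W n b A : ℕ) (hb : b < 2 ^ W) : pcn (W + n) (b + 2 ^ W * A) = pcn W b + pcn n A := by
  unfold pcn
  rw [Finset.sum_range_add]
  congr 1
  · refine Finset.sum_congr rfl fun i hi => ?_
    rw [tb_cons _ _ _ _ hb, if_pos (Finset.mem_range.1 hi)]
  · refine Finset.sum_congr rfl fun i hi => ?_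
    rw [tb_cons _ _ _ _ hb, if_neg (by omega), Nat.add_sub_cancel_left]

abbrev pc (x : ℕ) : ℕ := (sb x).card
theorem pc_eq (x : ℕ) : pc x = pcn 48 x := by
  rw [pc, pcn, sb, Finset.card_filter]
  refine Finset.sum_congr rfl fun i _ => ?_
  cases x.testBit i <;> rfl

noncomputable def pc8 (b : ℕ) : ℕ := Nat.rec (motive := fun _ => ℕ → ℕ) (fun _ => 0)
  (fun _ ih b => Nat.add (Nat.mod b 2) (ih (Nat.div b 2))) 8 b
noncomputable def chk8 : Bool := Nat.rec true (fun b ih => Bool.rec false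
  (Bool.rec false ih (Nat.ble (pc8 b) 8)) (Nat.beq (Y3 85 51 15 b) (pc8 b))) 256
theorem pc8_eq (b : ℕ) : pc8 b = pcn 8 b := by
  have t : ∀ x : ℕ, (x.testBit 0).toNat = x % 2 := by
    intro x; rw [Nat.testBit_zero]; rcases Nat.mod_two_eq_zero_or_one x with h | h <;> simp [h]
  have s : ∀ n x, pcn (n + 1) x = x % 2 + pcn n (x / 2) := by
    intro n x
    unfold pcn
    rw [Finset.sum_range_succ', t, add_comm]
    congr 1
    refine Finset.sum_congr rfl fun i _ => ?_
    rw [Nat.testBit_succ]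
  rw [s, s, s, s, s, s, s, s]; rfl
theorem chk8_true : chk8 = true := by decide +kernel
theorem byte_ok (b : ℕ) (hb : b < 256) : Y3 85 51 15 b = pcn 8 b ∧ pcn 8 b ≤ 8 := by
  have key : ∀ n, (Nat.rec true (fun b ih => Bool.rec false
    (Bool.rec false ih (Nat.ble (pc8 b) 8)) (Nat.beq (Y3 85 51 15 b) (pc8 b))) n : Bool) = true →
      ∀ b < n, Y3 85 51 15 b = pcn 8 b ∧ pcn 8 b ≤ 8 := by
    intro n
    induction n with
    | zero => intro _ b hb; omega
    | succ n ih =>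
      intro h b hb
      dsimp only at h
      cases h1 : Nat.beq (Y3 85 51 15 n) (pc8 n) with
      | false => rw [h1] at h; exact absurd h (by simp)
      | true =>
        rw [h1] at h
        cases h2 : Nat.ble (pc8 n) 8 with
        | false => rw [h2] at h; exact absurd h (by simp)
        | true =>
          rw [h2] at h
          rcases Nat.lt_succ_iff_lt_or_eq.1 hb with h3 | rfl
          · exact ih h b h3
          · rw [← pc8_eq]
            exact ⟨Nat.eq_of_beq_eq_true h1, Nat.le_of_ble_eq_true h2⟩
  exact key 256 chk8_true b hb

theorem field_ok (x : ℕ) (hx : x < 2 ^ 48) : ∃ y0 y1 y2 y3 y4 y5, y0 ≤ 8 ∧ y1 ≤ 8 ∧ y2 ≤ 8 ∧ y3 ≤ 8 ∧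
    y4 ≤ 8 ∧ y5 ≤ 8 ∧ pc x = y0 + y1 + y2 + y3 + y4 + y5 ∧
    Y3 0x555555555555 0x333333333333 0x0f0f0f0f0f0f x =
      y0 + 256 * (y1 + 256 * (y2 + 256 * (y3 + 256 * (y4 + 256 * y5)))) := by
  have st : ∀ (b A M1 M2 M4 : ℕ), b < 256 → Y3 (85 + 256 * M1) (51 + 256 * M2) (15 + 256 * M4) (b + 256 * A)
      = pcn 8 b + 256 * Y3 M1 M2 M4 A := by
    intro b A M1 M2 M4 hb
    have := Y3_cons (W := 8) (x := b) (m1 := 85) (m2 := 51) (m4 := 15) A M1 M2 M4 (by norm_num)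
      (by omega) (by norm_num) (by norm_num) (by norm_num)
    norm_num only at this
    rw [this, (byte_ok b hb).1]
  have hb : ∀ i, x / 256 ^ i % 256 < 256 := fun i => Nat.mod_lt _ (by norm_num)
  obtain ⟨b0, b1, b2, b3, b4, b5, h0, h1, h2, h3, h4, h5, e⟩ : ∃ b0 b1 b2 b3 b4 b5, b0 < 256 ∧ b1 < 256 ∧
      b2 < 256 ∧ b3 < 256 ∧ b4 < 256 ∧ b5 < 256 ∧
      x = b0 + 256 * (b1 + 256 * (b2 + 256 * (b3 + 256 * (b4 + 256 * (b5 + 256 * 0))))) := by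
    refine ⟨x % 256, x / 256 % 256, x / 65536 % 256, x / 16777216 % 256, x / 4294967296 % 256,
      x / 1099511627776, ?_⟩
    norm_num only at hx
    omega
  refine ⟨pcn 8 b0, pcn 8 b1, pcn 8 b2, pcn 8 b3, pcn 8 b4, pcn 8 b5, (byte_ok _ h0).2, (byte_ok _ h1).2,
    (byte_ok _ h2).2, (byte_ok _ h3).2, (byte_ok _ h4).2, (byte_ok _ h5).2, ?_, ?_⟩
  · have p : ∀ n b A : ℕ, b < 256 → pcn (8 + n) (b + 256 * A) = pcn 8 b + pcn n A := by
      intro n b A hb; exact pcn_add 8 n b A hb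
    rw [pc_eq, e, show 48 = 8 + 40 from rfl, p 40 _ _ h0, show 40 = 8 + 32 from rfl, p 32 _ _ h1,
      show 32 = 8 + 24 from rfl, p 24 _ _ h2, show 24 = 8 + 16 from rfl, p 16 _ _ h3,
      show 16 = 8 + 8 from rfl, p 8 _ _ h4, show pcn 8 (b5 + 256 * 0) = pcn 8 b5 by simp]
    omega
  · have c1 : 0x555555555555 = 85 + 256 * (85 + 256 * (85 + 256 * (85 + 256 * (85 + 256 * (85 + 256 * 0))))) := by norm_num
    have c2 : 0x333333333333 = 51 + 256 * (51 + 256 * (51 + 256 * (51 + 256 * (51 + 256 * (51 + 256 * 0))))) := by norm_num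
    have c4 : 0x0f0f0f0f0f0f = 15 + 256 * (15 + 256 * (15 + 256 * (15 + 256 * (15 + 256 * (15 + 256 * 0))))) := by norm_num
    rw [c1, c2, c4, e, st _ _ _ _ _ h0, st _ _ _ _ _ h1, st _ _ _ _ _ h2, st _ _ _ _ _ h3, st _ _ _ _ _ h4,
      st _ _ _ _ _ h5]
    have : Y3 0 0 0 0 = 0 := by rfl
    rw [this, mul_zero, add_zero]

/-! packed lists -/
def pk : List ℕ → ℕ
  | [] => 0
  | x :: t => x + 2 ^ 48 * pk t

def Bd (L : List ℕ) : Prop := ∀ x ∈ L, x < 2 ^ 48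

theorem pk_lt {L : List ℕ} (h : Bd L) : pk L < 2 ^ (48 * L.length) := by
  induction L with
  | nil => simp [pk]
  | cons x t ih =>
    have h1 : x < 2 ^ 48 := h x (by simp)
    have h2 := ih fun y hy => h y (by simp [hy])
    rw [List.length_cons, Nat.mul_add, pow_add, pk, mul_comm (2 ^ (48 * t.length))]
    have : 2 ^ 48 * (pk t + 1) ≤ 2 ^ 48 * 2 ^ (48 * t.length) := Nat.mul_le_mul_left _ h2
    rw [mul_one]
    omega

theorem pk_append (L M : List ℕ) : pk (L ++ M) = pk L + 2 ^ (48 * L.length) * pk M := by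
  induction L with
  | nil => simp [pk]
  | cons x t ih =>
    rw [List.cons_append, pk, ih, pk, List.length_cons, Nat.mul_add 48, pow_add]; ring

noncomputable def rep (n : ℕ) : ℕ := Nat.div (Nat.sub (Nat.shiftLeft 1 (Nat.mul 48 n)) 1) 281474976710655

theorem rep_eq (n : ℕ) : rep n = (2 ^ (48 * n) - 1) / 281474976710655 := by
  have : rep n = (1 <<< (48 * n) - 1) / 281474976710655 := rfl
  rw [this, Nat.one_shiftLeft]
theorem rep_zero : rep 0 = 0 := by rw [rep_eq]; rfl
theorem rep_succ (n : ℕ) : rep (n + 1) = 1 + 2 ^ 48 * rep n := by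
  rw [rep_eq, rep_eq]
  have h : 281474976710655 ∣ 2 ^ (48 * n) - 1 := by
    have := Nat.sub_dvd_pow_sub_pow (2 ^ 48) 1 n
    rw [one_pow, ← pow_mul] at this
    exact this
  obtain ⟨k, hk⟩ := h
  have h1 : 2 ^ (48 * n) = 281474976710655 * k + 1 := by
    have : 1 ≤ 2 ^ (48 * n) := Nat.one_le_two_pow
    omega
  rw [hk, Nat.mul_div_cancel_left _ (by norm_num), Nat.mul_add, pow_add, h1]
  have : (281474976710655 * k + 1) * 2 ^ (48 * 1) - 1 = 281474976710655 * (1 + 2 ^ 48 * k) := by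
    norm_num only
    omega
  rw [this, Nat.mul_div_cancel_left _ (by norm_num)]

theorem mul_rep (m n : ℕ) : m * rep (n + 1) = m + 2 ^ 48 * (m * rep n) := by
  rw [rep_succ]; ring

theorem bd_tail {x : ℕ} {t : List ℕ} (h : Bd (x :: t)) : x < 2 ^ 48 ∧ Bd t :=
  ⟨h x (by simp), fun y hy => h y (by simp [hy])⟩

theorem pk_xrow {row : ℕ} (hr : row < 2 ^ 48) {L : List ℕ} (h : Bd L) :
    pk L ^^^ (row * rep L.length) = pk (L.map (· ^^^ row)) := by
  induction L with
  | nil => simp [pk, rep_zero]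
  | cons x t ih =>
    rw [List.length_cons, mul_rep, pk, xor_cons _ _ (bd_tail h).1 hr, ih (bd_tail h).2]; rfl

theorem bd_xrow {row : ℕ} (hr : row < 2 ^ 48) {L : List ℕ} (h : Bd L) : Bd (L.map (· ^^^ row)) := by
  intro y hy
  obtain ⟨x, hx, rfl⟩ := List.mem_map.1 hy
  exact Nat.xor_lt_two_pow (h x hx) hr

/-! masked population counts -/
noncomputable def topm (m1 m2 m4 R c mu x : ℕ) : ℕ :=
  Nat.land (Nat.add (Nat.mul (Y3 m1 m2 m4 x) 0x010101010101) (Nat.mul (Nat.mul 0x010101010101 c) R))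
    (Nat.mul (Nat.mul mu 0x10000000000) R)

attribute [irreducible] rep Y3

theorem topm_aux (N c mu : ℕ) (hc : c ≤ 127) (hmu : mu < 256) (L : List ℕ) (h : Bd L) (hN : L.length ≤ N)
    (h0 h1 h2 h3 h4 : ℕ) (b0 : h0 ≤ 48) (b1 : h1 ≤ 48) (b2 : h2 ≤ 48) (b3 : h3 ≤ 48) (b4 : h4 ≤ 48) :
    (h0 + 256 * (h1 + 256 * (h2 + 256 * (h3 + 256 * h4))) +
      Y3 (0x555555555555 * rep N) (0x333333333333 * rep N) (0x0f0f0f0f0f0f * rep N) (pk L) * 0x010101010101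
      + 0x010101010101 * c * rep L.length) &&& (mu * 0x10000000000 * rep L.length)
     = pk (L.map fun x => ((pc x + c) &&& mu) * 0x10000000000) := by
  induction L generalizing N h0 h1 h2 h3 h4 with
  | nil => simp [rep_zero, pk]
  | cons x t ih =>
    obtain ⟨N, rfl⟩ : ∃ n, N = n + 1 := ⟨N - 1, by simp at hN; omega⟩
    obtain ⟨hx, ht⟩ := bd_tail h
    obtain ⟨y0, y1, y2, y3, y4, y5, g0, g1, g2, g3, g4, g5, hp, hy⟩ := field_ok x hx
    rw [List.length_cons, mul_rep, mul_rep, mul_rep, mul_rep, mul_rep, pk,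
      Y3_cons _ _ _ _ (by norm_num) hx (by norm_num) (by norm_num) (by norm_num), hy]
    have := ih N ht (by simpa using hN) (y1 + y2 + y3 + y4 + y5) (y2 + y3 + y4 + y5) (y3 + y4 + y5)
      (y4 + y5) y5 (by omega) (by omega) (by omega) (by omega) (by omega)
    generalize Y3 (0x555555555555 * rep N) (0x333333333333 * rep N) (0x0f0f0f0f0f0f * rep N) (pk t) = YY at this ⊢
    generalize 0x010101010101 * c * rep t.length = RR at this ⊢
    have e : h0 + 256 * (h1 + 256 * (h2 + 256 * (h3 + 256 * h4))) +
      (y0 + 256 * (y1 + 256 * (y2 + 256 * (y3 + 256 * (y4 + 256 * y5)))) + 2 ^ 48 * YY) * 0x010101010101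
       + (0x010101010101 * c + 2 ^ 48 * RR) =
      ((h0 + y0 + c + 256 * (h1 + y0 + y1 + c + 256 * (h2 + y0 + y1 + y2 + c +
        256 * (h3 + y0 + y1 + y2 + y3 + c + 256 * (h4 + y0 + y1 + y2 + y3 + y4 + c))))) + 2 ^ 40 * (pc x + c)) +
      2 ^ 48 * ((y1 + y2 + y3 + y4 + y5) + 256 * ((y2 + y3 + y4 + y5) + 256 * ((y3 + y4 + y5) +
        256 * ((y4 + y5) + 256 * y5))) + YY * 0x010101010101 + RR) := by
      rw [hp]; ring
    have hrest : h0 + y0 + c + 256 * (h1 + y0 + y1 + c + 256 * (h2 + y0 + y1 + y2 + c +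
        256 * (h3 + y0 + y1 + y2 + y3 + c + 256 * (h4 + y0 + y1 + y2 + y3 + y4 + c)))) < 2 ^ 40 := by
      norm_num only; omega
    have hfield := land_cons (W := 40) (m := 0) (pc x + c) mu hrest (by norm_num)
    have hlt : ((h0 + y0 + c + 256 * (h1 + y0 + y1 + c + 256 * (h2 + y0 + y1 + y2 + c +
        256 * (h3 + y0 + y1 + y2 + y3 + c + 256 * (h4 + y0 + y1 + y2 + y3 + y4 + c))))) + 2 ^ 40 * (pc x + c))
        < 2 ^ 48 := by
      have : pc x + c < 256 := by omega
      norm_num only at hrest ⊢; omega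
    have hm : mu * 0x10000000000 < 2 ^ 48 := by norm_num only; omega
    rw [e, land_cons _ _ hlt hm, this]
    have p40 : (2 : ℕ) ^ 40 = 1099511627776 := by norm_num
    have e2 : mu * 0x10000000000 = 0 + 2 ^ 40 * mu := by rw [zero_add, mul_comm, p40]
    rw [e2, hfield, Nat.and_zero, zero_add, List.map_cons, pk, mul_comm (2 ^ 40), p40]

theorem topm_spec (N c mu : ℕ) (hc : c ≤ 127) (hmu : mu < 256) (L : List ℕ) (h : Bd L) (hN : L.length ≤ N) :
    topm (0x555555555555 * rep N) (0x333333333333 * rep N) (0x0f0f0f0f0f0f * rep N) (rep L.length) c mu (pk L)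
     = pk (L.map fun x => ((pc x + c) &&& mu) * 0x10000000000) := by
  have := topm_aux N c mu hc hmu L h hN 0 0 0 0 0 (by norm_num) (by norm_num) (by norm_num) (by norm_num)
    (by norm_num)
  simp only [Nat.mul_zero, Nat.zero_add, Nat.add_zero] at this
  exact this

noncomputable def flag (m1 m2 m4 R thr x : ℕ) : ℕ :=
  Nat.xor (topm m1 m2 m4 R (Nat.sub 127 thr) 128 x) (Nat.mul 140737488355328 R)

theorem pc_le (x : ℕ) : pc x ≤ 48 := sb_card x
theorem and128 (v : ℕ) (hv : v < 256) : v &&& 128 = if 128 ≤ v then 128 else 0 := by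
  revert v; decide +kernel

theorem flag_eq (m1 m2 m4 R thr x : ℕ) : flag m1 m2 m4 R thr x = topm m1 m2 m4 R (127 - thr) 128 x ^^^ (140737488355328 * R) := rfl
theorem flag_key (thr x : ℕ) (ht : thr ≤ 127) : ((pc x + (127 - thr)) &&& 128) * 0x10000000000 =
      if pc x ≤ thr then 0 else 140737488355328 := by
    have := pc_le x
    rw [and128 _ (by omega)]
    by_cases h : pc x ≤ thr
    · rw [if_pos h, if_neg (by omega), zero_mul]
    · rw [if_neg h, if_pos (by omega)]
theorem flag_bd (p : Prop) [Decidable p] : (if p then 0 else 140737488355328 : ℕ) < 2 ^ 48 := by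
  split <;> norm_num
theorem flag_x (p : Prop) [Decidable p] : (if p then 0 else 140737488355328 : ℕ) ^^^ 140737488355328 = if p then 140737488355328 else 0 := by
  split 
  · rw [Nat.zero_xor]
  · rw [Nat.xor_self]

theorem flag_spec (N thr : ℕ) (ht : thr ≤ 127) (L : List ℕ) (h : Bd L) (hN : L.length ≤ N) :
    flag (0x555555555555 * rep N) (0x333333333333 * rep N) (0x0f0f0f0f0f0f * rep N) (rep L.length) thr (pk L)
     = pk (L.map fun x => if pc x ≤ thr then 140737488355328 else 0) := by
  rw [flag_eq, topm_spec N _ _ (by omega) (by norm_num) L h hN]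
  simp only [flag_key _ _ ht]
  have hb : Bd (L.map fun x => if pc x ≤ thr then 0 else 140737488355328) := by
    intro y hy
    obtain ⟨x, hx, rfl⟩ := List.mem_map.1 hy
    exact flag_bd _
  have := pk_xrow (row := 140737488355328) (by norm_num) hb
  rw [List.length_map, List.map_map] at this
  rw [this]
  congr 1
  refine List.map_congr_left fun x _ => ?_
  exact flag_x _

/-! decoding -/
noncomputable def dec {α : Type} (d : ℕ) : ℕ → ℕ → List ℕ → (List ℕ → α) → α :=
  Nat.rec (fun J X acc K => Bool.rec (K (X :: acc)) (K acc) (Nat.beq J 0)) (fun d ih J X acc K =>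
    Bool.rec (force (Nat.mul 48 (Nat.shiftLeft 1 d)) fun h => lazy (Nat.shiftRight J h) fun Jh =>
       lazy (Nat.shiftRight X h) fun Xh =>
       lazy (Nat.xor J (Nat.shiftLeft Jh h)) fun Jl => lazy (Nat.xor X (Nat.shiftLeft Xh h)) fun Xl =>
       ih Jl Xl acc fun acc' => ih Jh Xh acc' K) (K acc) (Nat.beq J 0)) d

theorem brec {α : Type} (J : ℕ) (a b : α) : (Bool.rec a b (Nat.beq J 0) : α) = if J = 0 then b else a := by
  by_cases h : J = 0
  · subst h; rfl
  · have hb : Nat.beq J 0 = false := by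
      cases J with
      | zero => exact absurd rfl h
      | succ n => rfl
    rw [if_neg h, hb]

theorem pk_split (L : List ℕ) (h : Bd L) (n : ℕ) : pk L >>> (48 * n) = pk (L.drop n) ∧
    pk L ^^^ (pk (L.drop n) <<< (48 * n)) = pk (L.take n) := by
  have e : pk L = pk (L.take n) + 2 ^ (48 * n) * pk (L.drop n) := by
    by_cases hn : n ≤ L.length
    · conv_lhs => rw [← List.take_append_drop n L, pk_append, List.length_take, min_eq_left hn]
    · rw [List.drop_eq_nil_of_le (by omega), List.take_of_length_le (by omega)]; simp [pk]
  have hlt : pk (L.take n) < 2 ^ (48 * n) := by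
    refine (pk_lt fun x hx => h x (List.mem_of_mem_take hx)).trans_le ?_
    refine Nat.pow_le_pow_right (by norm_num) ?_
    rw [List.length_take]; omega
  constructor
  · rw [Nat.shiftRight_eq_div_pow, e, Nat.add_mul_div_left _ _ (by positivity), Nat.div_eq_of_lt hlt, zero_add]
  · have := xor_cons (W := 48 * n) (m := 0) (pk (L.drop n)) (pk (L.drop n)) hlt (by positivity)
    rw [e, Nat.shiftLeft_eq, mul_comm (pk (L.drop n)), ← e, ]
    rw [← e, zero_add, Nat.xor_self, mul_zero, Nat.xor_zero, add_zero] at this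
    exact this

theorem pk_zero {L : List ℕ} (h : pk L = 0) : ∀ x ∈ L, x = 0 := by
  induction L with
  | nil => simp
  | cons x t ih =>
    rw [pk] at h
    have h1 : x = 0 := by omega
    have h2 : pk t = 0 := by
      have : 2 ^ 48 * pk t = 0 := by omega
      simpa using this
    intro y hy
    rcases List.mem_cons.1 hy with rfl | hy
    · exact h1
    · exact ih h2 y hy

theorem dec_spec {α : Type} (j : ℕ → ℕ) (d : ℕ) (L : List ℕ) (hL : Bd L) (hj : Bd (L.map j))
    (hd : L.length ≤ 2 ^ d) (acc : List ℕ) (K : List ℕ → α) :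
    dec d (pk (L.map j)) (pk L) acc K = K ((L.filter fun x => j x ≠ 0).reverse ++ acc) := by
  have hz : ∀ L : List ℕ, pk (L.map j) = 0 → (L.filter fun x => j x ≠ 0) = [] := by
    intro L h
    refine List.filter_eq_nil_iff.2 fun x hx => ?_
    have := pk_zero h (j x) (List.mem_map_of_mem hx)
    simp [this]
  induction d generalizing L acc K with
  | zero =>
    have e : dec 0 (pk (L.map j)) (pk L) acc K = Bool.rec (K (pk L :: acc)) (K acc) (Nat.beq (pk (L.map j)) 0) := rfl
    rw [e, brec]
    split
    · next h => rw [hz L h]; rfl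
    · next h =>
      match L, hd with
      | [], _ => exact absurd rfl h
      | [x], _ =>
        have : j x ≠ 0 := by intro h0; apply h; simp [pk, h0]
        simp [pk, this]
      | x :: y :: t, hd => simp at hd
  | succ d ih =>
    have e : dec (d + 1) (pk (L.map j)) (pk L) acc K = Bool.rec (force (Nat.mul 48 (Nat.shiftLeft 1 d)) fun h =>
       lazy (Nat.shiftRight (pk (L.map j)) h) fun Jh => lazy (Nat.shiftRight (pk L) h) fun Xh =>
       lazy (Nat.xor (pk (L.map j)) (Nat.shiftLeft Jh h)) fun Jl => lazy (Nat.xor (pk L) (Nat.shiftLeft Xh h)) fun Xl =>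
       dec d Jl Xl acc fun acc' => dec d Jh Xh acc' K) (K acc) (Nat.beq (pk (L.map j)) 0) := rfl
    rw [e, brec]
    split
    · next h => rw [hz L h]; rfl
    · simp only [force_eq, lazy_eq]
      have hs : Nat.mul 48 (Nat.shiftLeft 1 d) = 48 * 2 ^ d := by
        have : Nat.mul 48 (Nat.shiftLeft 1 d) = 48 * (1 <<< d) := rfl
        rw [this, Nat.one_shiftLeft]
      rw [hs]
      have s1 : Nat.shiftRight (pk (L.map j)) (48 * 2 ^ d) = pk ((L.drop (2 ^ d)).map j) := by
        rw [List.map_drop]; exact (pk_split _ hj _).1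
      have s2 : Nat.shiftRight (pk L) (48 * 2 ^ d) = pk (L.drop (2 ^ d)) := (pk_split _ hL _).1
      rw [s1, s2]
      have s3 : Nat.xor (pk (L.map j)) (Nat.shiftLeft (pk ((L.drop (2 ^ d)).map j)) (48 * 2 ^ d)) =
          pk ((L.take (2 ^ d)).map j) := by
        rw [List.map_drop, List.map_take]; exact (pk_split _ hj _).2
      have s4 : Nat.xor (pk L) (Nat.shiftLeft (pk (L.drop (2 ^ d))) (48 * 2 ^ d)) =
          pk (L.take (2 ^ d)) := (pk_split _ hL _).2
      rw [s3, s4]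
      rw [pow_succ] at hd
      have bt : ∀ M : List ℕ, Bd M → Bd (M.take (2 ^ d)) := fun M h x hx => h x (List.mem_of_mem_take hx)
      have bd : ∀ M : List ℕ, Bd M → Bd (M.drop (2 ^ d)) := fun M h x hx => h x (List.mem_of_mem_drop hx)
      rw [ih _ (bt _ hL) (by rw [List.map_take]; exact bt _ hj) (by rw [List.length_take]; omega),
        ih _ (bd _ hL) (by rw [List.map_drop]; exact bd _ hj) (by rw [List.length_drop]; omega)]
      congr 1
      conv_rhs => rw [← List.take_append_drop (2 ^ d) L, List.filter_append, List.reverse_append]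
      rw [List.append_assoc]

/-! packed rotation -/
noncomputable def rotp (R p x : ℕ) : ℕ :=
  Nat.add (Nat.shiftLeft (Nat.land x (Nat.mul (Nat.sub (Nat.shiftLeft 1 (Nat.sub 48 p)) 1) R)) p)
    (Nat.land (Nat.shiftRight x (Nat.sub 48 p)) (Nat.mul (Nat.sub (Nat.shiftLeft 1 p) 1) R))

theorem rotp_spec (p : ℕ) (hp : p ≤ 48) (L : List ℕ) (h : Bd L) :
    rotp (rep L.length) p (pk L) = pk (L.map (rot p)) := by
  have e : ∀ R x, rotp R p x = ((x &&& ((1 <<< (48 - p) - 1) * R)) <<< p) +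
    (x >>> (48 - p) &&& ((1 <<< p - 1) * R)) := fun _ _ => rfl
  induction L with
  | nil => simp [e, pk]
  | cons x t ih =>
    obtain ⟨hx, ht⟩ := bd_tail h
    have h1 : 2 ^ (48 - p) - 1 < 2 ^ 48 := by
      have := Nat.pow_le_pow_right (n := 2) (by norm_num) (show 48 - p ≤ 48 by omega)
      have : 0 < 2 ^ (48 - p) := by positivity
      omega
    have h2 : 2 ^ p - 1 < 2 ^ (48 - (48 - p)) := by
      have : 48 - (48 - p) = p := by omega
      rw [this]
      have : 0 < 2 ^ p := by positivity
      omega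
    rw [e] at ih ⊢
    rw [Nat.one_shiftLeft, Nat.one_shiftLeft] at ih ⊢
    rw [List.length_cons, mul_rep, mul_rep, pk, land_cons _ _ hx h1, shr_cons _ _ (by omega) hx h2,
      List.map_cons, pk, ← ih ht, rot, Nat.and_two_pow_sub_one_eq_mod, Nat.and_two_pow_sub_one_eq_mod,
      Nat.shiftLeft_eq, Nat.shiftLeft_eq, Nat.shiftRight_eq_div_pow, Nat.mod_eq_of_lt (a := x / 2 ^ (48 - p))]
    · ring
    · rw [Nat.div_lt_iff_lt_mul (by positivity), ← pow_add]
      have : p + (48 - p) = 48 := by omega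
      rw [this]; exact hx
end DC

namespace DC

noncomputable def rowN (m r : ℕ) : ℕ := rotq (Nat.shiftLeft 1 m) r
noncomputable def decS (val : ℕ → ℕ) (X : ℕ) (fuel : ℕ) : ℕ → ℕ → ℕ :=
  Nat.rec (fun _ acc => acc) (fun _ ih J acc => Bool.rec
    (lazy (Nat.land J (Nat.sub J 1)) fun J' => lazy (Nat.sub J J') fun q => lazy (Nat.shiftRight q 47) fun p =>
      force (Nat.div (Nat.land X (Nat.sub (Nat.shiftLeft q 1) p)) p) fun e =>
      force (Nat.add acc (val e)) fun acc' => ih J' acc') acc (Nat.beq J 0)) fuel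
noncomputable def inner (val : ℕ → ℕ) (thr r M n m1 m2 m4 R Y : ℕ) (fuel : ℕ) : ℕ → ℕ :=
  Nat.rec (fun acc => acc) (fun f ih acc =>
    force (rowN (Nat.sub (Nat.sub M 1) f) r) fun row => lazy (Nat.xor Y (Nat.mul row R)) fun X =>
      lazy (flag m1 m2 m4 R thr X) fun J => force (decS val X n J acc) fun acc' => ih acc') fuel
noncomputable def stepA {α : Type} (c m row : ℕ) (L : List (ℕ × ℕ)) : ℕ → ℕ → ℕ → (List (ℕ × ℕ) → α) → α :=
  List.rec (fun _ _ _ K => K []) (fun h _ ih pX pn k K =>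
    Bool.rec (ih h.1 h.2 (Nat.succ k) (fun T => K (h :: T)))
      (lazy (Nat.add h.1 (Nat.shiftLeft (Nat.xor pX (Nat.mul row (rep pn))) (Nat.mul 48 h.2))) fun x =>
       force (Nat.add h.2 pn) fun n => ih h.1 h.2 (Nat.succ k) (fun T => K ((x, n) :: T)))
      (Nat.ble (Nat.mul c m) (Nat.mul 48 k))) L
noncomputable def step {α : Type} (c m row : ℕ) (L : List (ℕ × ℕ)) (K : List (ℕ × ℕ) → α) : α :=
  List.rec (K []) (fun h t _ => stepA c m row t h.1 h.2 0 (fun T => K (h :: T))) L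
noncomputable def lastD (L : List (ℕ × ℕ)) : ℕ × ℕ := List.rec (fun d => d) (fun h _ ih _ => ih h) L (0, 0)
noncomputable def chunk (val : ℕ → ℕ) (thr r M m row : ℕ) (c : ℕ × ℕ) (acc : ℕ) : ℕ :=
  Bool.rec (lazy (rep c.2) fun R => lazy (Nat.xor c.1 (Nat.mul row R)) fun Y =>
    lazy (Nat.mul 0x555555555555 R) fun m1 => lazy (Nat.mul 0x333333333333 R) fun m2 =>
    lazy (Nat.mul 0x0f0f0f0f0f0f R) fun m4 =>
    inner val thr r M c.2 m1 m2 m4 R Y (Nat.sub (Nat.sub M 1) m) acc) acc (Nat.beq c.2 0)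
noncomputable def run (val : ℕ → ℕ) (l r M M' : ℕ) (fuel : ℕ) : List (ℕ × ℕ) → ℕ → ℕ :=
  Nat.rec (fun _ acc => acc) (fun f ih L acc =>
    force (Nat.sub (Nat.sub M' 1) f) fun m => force (rowN m r) fun row =>
    force (chunk val (Nat.sub 16 l) r M m row (lastD L) acc) fun acc' =>
    step l m row L fun L' => ih L' acc') fuel
noncomputable def iniL (n : ℕ) : List (ℕ × ℕ) := (0, 1) :: Nat.rec [] (fun _ ih => (0, 0) :: ih) n
noncomputable def enc (x : ℕ) : ℕ := bf (fun q acc => Nat.add acc (Nat.pow q 80)) 48 x 0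
noncomputable def encr (x : ℕ) : ℕ := bf (fun q acc => Nat.add acc (Nat.pow (Nat.div 281474976710656 q) 80)) 48 x 0
noncomputable def pcK (x : ℕ) : ℕ := bf (fun _ acc => Nat.succ acc) 48 x 0
noncomputable def bcnt (l a : ℕ) : ℕ := Nat.rec 0 (fun k ih => force (Nat.mul k (Nat.div 48 l)) fun y =>
  Bool.rec (Bool.rec ih (Nat.succ ih) (Nat.beq (pcK (Nat.mod a (Nat.shiftLeft 1 y))) k)) ih
    (Nat.beq (Nat.mod (Nat.shiftRight a y) 2) 0)) l
noncomputable def val (l w rs b : ℕ) : ℕ :=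
  force (mulN b rs) fun a => force (bcnt l a) fun B => force (Nat.div w B) fun c =>
  force (enc a) fun ea => force (enc b) fun eb => force (encr a) fun ra => force (encr b) fun rb =>
   Nat.mul c (Nat.add (Nat.mul ra eb) (Nat.shiftLeft (Nat.add (Nat.mul ra ea) (Nat.mul rb eb)) 8000))
noncomputable def total (r rs : ℕ) : ℕ :=
  force (run (val 8 840 rs) 8 r 43 37 37 (iniL 6) 0) fun t =>
  force (run (val 6 1680 rs) 6 r 41 33 33 (iniL 4) t) fun t =>
  force (run (val 4 1680 rs) 4 r 37 25 25 (iniL 2) t) fun t =>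
  run (val 2 1680 rs) 2 r 25 1 1 (iniL 0) t
noncomputable def dg (t e : ℕ) : ℕ := Nat.mod (Nat.shiftRight t (Nat.mul 80 e)) 1208925819614629174706176
noncomputable def dN (t j : ℕ) : ℕ := Nat.add (dg t j) (dg t (Nat.add j 48))
noncomputable def chkJ (t j : ℕ) : Bool := force (dN t j) fun v => force (Nat.mul 2 v) fun v2 =>
  Nat.rec true (fun i ih => Bool.rec (Bool.rec ih false
    (Bool.rec (Nat.beq (dN t (Nat.add 100 i)) v2) false (Nat.beq i 0))) false
    (Bool.rec (Nat.beq (dN t i) v) false (Nat.beq i j))) 48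
noncomputable def chkC (r j j' : ℕ) : Bool := force (total r (mulm 47 r)) fun t =>
  Bool.rec false (chkJ t j') (chkJ t j)
end DC

namespace DC

theorem pkc (x : ℕ) (t : List ℕ) : pk (x :: t) = x + 2 ^ 48 * pk t := rfl
theorem lbl (e K : ℕ) : (2 ^ e * (1 + 2 * K)) &&& (2 ^ e * (1 + 2 * K) - 1) = 2 ^ (e + 1) * K := by
  have h0 : 0 < 2 ^ e := by positivity
  have h1 : 2 ^ e * (1 + 2 * K) - 1 = (2 ^ e - 1) + 2 ^ e * (2 * K) := by
    rw [Nat.mul_add, mul_one]; omega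
  have h2 := land_cons (W := e) (x := 0) (m := 2 ^ e - 1) (1 + 2 * K) (2 * K) h0 (by omega)
  have h3 := land_cons (W := 1) (x := 1) (m := 0) K K (by norm_num) (by norm_num)
  rw [zero_add, ← h1, Nat.zero_and, zero_add] at h2
  rw [zero_add, Nat.and_self, Nat.and_zero, zero_add, pow_one] at h3
  rw [h2, h3, pow_succ]; ring

abbrev fl (thr x : ℕ) : ℕ := if pc x ≤ thr then 140737488355328 else 0
abbrev vl (thr : ℕ) (val : ℕ → ℕ) (x : ℕ) : ℕ := if pc x ≤ thr then val x else 0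

theorem decS_zero (val : ℕ → ℕ) (X J acc : ℕ) : decS val X 0 J acc = acc := rfl
theorem decS_succ (val : ℕ → ℕ) (X n J acc : ℕ) : decS val X (n + 1) J acc = if J = 0 then acc else
    decS val X n (J &&& (J - 1)) (acc + val ((X &&& ((J - (J &&& (J - 1))) <<< 1 - (J - (J &&& (J - 1))) >>> 47)) /
      ((J - (J &&& (J - 1))) >>> 47))) := by
  have : decS val X (n + 1) J acc = Bool.rec
    (lazy (Nat.land J (Nat.sub J 1)) fun J' => lazy (Nat.sub J J') fun q => lazy (Nat.shiftRight q 47) fun p =>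
      force (Nat.div (Nat.land X (Nat.sub (Nat.shiftLeft q 1) p)) p) fun e =>
      force (Nat.add acc (val e)) fun acc' => decS val X n J' acc') acc (Nat.beq J 0) := rfl
  rw [this, brec, lazy_eq, lazy_eq, lazy_eq, force_eq, force_eq]; rfl

theorem decS_spec (val : ℕ → ℕ) (thr : ℕ) (L : List ℕ) (hL : Bd L) (s x0 fuel acc : ℕ) (hx0 : x0 < 2 ^ (48 * s))
    (hf : L.length ≤ fuel) :
    decS val (x0 + 2 ^ (48 * s) * pk L) fuel (2 ^ (48 * s) * pk (L.map (fl thr))) acc =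
      acc + (L.map (vl thr val)).sum := by
  induction L generalizing s x0 fuel acc with
  | nil =>
    simp only [List.map_nil, pk, mul_zero, List.sum_nil, add_zero]
    cases fuel with
    | zero => rfl
    | succ n => rw [decS_succ, if_pos rfl]
  | cons x t ih =>
    obtain ⟨hx, ht⟩ := bd_tail hL
    rw [List.length_cons] at hf
    have eX : x0 + 2 ^ (48 * s) * pk (x :: t) = (x0 + 2 ^ (48 * s) * x) + 2 ^ (48 * (s + 1)) * pk t := by
      rw [pk, Nat.mul_add 48, pow_add]; ring
    have hx0' : x0 + 2 ^ (48 * s) * x < 2 ^ (48 * (s + 1)) := by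
      rw [Nat.mul_add 48, pow_add]
      have : 2 ^ (48 * s) * (x + 1) ≤ 2 ^ (48 * s) * 2 ^ (48 * 1) := Nat.mul_le_mul_left _ hx
      rw [Nat.mul_add, mul_one] at this
      exact lt_of_lt_of_le (by omega) this
    have ec : decS val (x0 + 2 ^ (48 * s) * pk (x :: t)) = decS val ((x0 + 2 ^ (48 * s) * x) + 2 ^ (48 * (s + 1)) * pk t) := by
      rw [eX]
    rw [List.map_cons, List.map_cons, List.sum_cons, pkc (fl thr x)]
    by_cases hp : pc x ≤ thr
    · obtain ⟨n, rfl⟩ : ∃ n, fuel = n + 1 := ⟨fuel - 1, by omega⟩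
      simp only [fl, vl, if_pos hp]
      generalize hK : pk (t.map (fl thr)) = K at *
      have p47 : (140737488355328 : ℕ) = 2 ^ 47 := by norm_num
      have eJ : 2 ^ (48 * s) * (140737488355328 + 2 ^ 48 * K) = 2 ^ (48 * s + 47) * (1 + 2 * K) := by
        rw [p47, pow_add, pow_succ 2 47]; ring
      have eK : 2 ^ (48 * s + 47 + 1) * K = 2 ^ (48 * (s + 1)) * K := by
        rw [show 48 * s + 47 + 1 = 48 * (s + 1) by ring]
      have eq : 2 ^ (48 * s + 47) * (1 + 2 * K) - 2 ^ (48 * s + 47 + 1) * K = 2 ^ (48 * s + 47) := by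
        have : 2 ^ (48 * s + 47) * (1 + 2 * K) = 2 ^ (48 * s + 47) + 2 ^ (48 * s + 47 + 1) * K := by
          rw [pow_succ 2 (48 * s + 47)]; ring
        rw [this, Nat.add_sub_cancel]
      have ep : 2 ^ (48 * s + 47) >>> 47 = 2 ^ (48 * s) := by
        rw [Nat.shiftRight_eq_div_pow, pow_add, Nat.mul_div_cancel _ (by positivity)]
      have em : 2 ^ (48 * s + 47) <<< 1 - 2 ^ (48 * s) = 0 + 2 ^ (48 * s) * (2 ^ 48 - 1) := by
        rw [Nat.shiftLeft_eq, pow_add, Nat.mul_sub, zero_add, mul_one, mul_assoc, ← pow_add]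
      have eL : (x0 + 2 ^ (48 * s) * pk (x :: t)) &&& (0 + 2 ^ (48 * s) * (2 ^ 48 - 1)) = 2 ^ (48 * s) * x := by
        rw [land_cons _ _ hx0 (by positivity), Nat.and_zero, zero_add, Nat.and_two_pow_sub_one_eq_mod, pk,
          Nat.add_mul_mod_self_left, Nat.mod_eq_of_lt hx]
      have hps : 0 < 2 ^ (48 * s) := by positivity
      have hne : 2 ^ (48 * s + 47) * (1 + 2 * K) ≠ 0 := Nat.mul_ne_zero (pow_ne_zero _ two_ne_zero) (by omega)
      rw [eJ, decS_succ, if_neg hne, lbl, eq, ep, em, eL,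
        Nat.mul_div_cancel_left _ hps, eK, ec, ih ht (s + 1) _ n _ hx0' (by omega)]
      rw [add_assoc]
    · simp only [fl, vl, if_neg hp, zero_add]
      have eJ : 2 ^ (48 * s) * (2 ^ 48 * pk (t.map (fl thr))) = 2 ^ (48 * (s + 1)) * pk (t.map (fl thr)) := by
        rw [Nat.mul_add 48, pow_add]; ring
      rw [eJ, ec, ih ht (s + 1) _ fuel _ hx0' (by omega)]

theorem rowN_eq {m : ℕ} (hm : m ≤ 48) (r : ℕ) : rowN m r = rot m r := by
  have : rowN m r = rotq (1 <<< m) r := rfl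
  rw [this, Nat.one_shiftLeft, rotq_eq hm]
theorem rowN_lt {m r : ℕ} (hm : m ≤ 48) (hr : r < 2 ^ 48) : rowN m r < 2 ^ 48 := by
  rw [rowN_eq hm]; exact rot_lt hm hr

/-- sum of `g` over a list -/
abbrev ls (g : ℕ → ℕ) (L : List ℕ) : ℕ := (L.map g).sum

theorem inner_spec (val : ℕ → ℕ) (thr r M : ℕ) (ht : thr ≤ 127) (hM : M ≤ 48) (hr : r < 2 ^ 48) (L : List ℕ) (hL : Bd L)
    (fuel acc : ℕ) :
    inner val thr r M L.length (0x555555555555 * rep L.length) (0x333333333333 * rep L.length)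
      (0x0f0f0f0f0f0f * rep L.length) (rep L.length) (pk L) fuel acc =
    acc + ∑ f ∈ Finset.range fuel, ls (fun x => vl thr val (x ^^^ rowN (M - 1 - f) r)) L := by
  induction fuel generalizing acc with
  | zero => simp [inner]
  | succ f ih =>
    have h1 : inner val thr r M L.length (0x555555555555 * rep L.length) (0x333333333333 * rep L.length)
      (0x0f0f0f0f0f0f * rep L.length) (rep L.length) (pk L) (f + 1) acc =
      force (rowN (M - 1 - f) r) fun row => lazy (pk L ^^^ (row * rep L.length)) fun X =>
      lazy (flag (0x555555555555 * rep L.length) (0x333333333333 * rep L.length)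
      (0x0f0f0f0f0f0f * rep L.length) (rep L.length) thr X) fun J => force (decS val X L.length J acc) fun acc' =>
      inner val thr r M L.length (0x555555555555 * rep L.length) (0x333333333333 * rep L.length)
      (0x0f0f0f0f0f0f * rep L.length) (rep L.length) (pk L) f acc' := rfl
    have hrow : rowN (M - 1 - f) r < 2 ^ 48 := rowN_lt (by omega) hr
    rw [h1, force_eq, lazy_eq, lazy_eq, force_eq, ih, pk_xrow hrow hL]
    have hL' := bd_xrow hrow hL
    have h2 := flag_spec L.length thr ht _ hL' (by rw [List.length_map])
    have h3 := decS_spec val thr _ hL' 0 0 L.length acc (by norm_num) (by rw [List.length_map])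
    rw [List.length_map] at h2
    rw [Nat.mul_zero, pow_zero, one_mul, one_mul, zero_add] at h3
    rw [h2, h3, Finset.sum_range_succ, List.map_map]
    simp only [ls]
    rw [add_assoc, add_comm (List.sum _)]
    rfl

theorem chunk_spec (val : ℕ → ℕ) (thr r M m : ℕ) (ht : thr ≤ 127) (hM : M ≤ 48) (hm : m ≤ 48) (hr : r < 2 ^ 48) (L : List ℕ) (hL : Bd L)
    (acc : ℕ) : chunk val thr r M m (rowN m r) (pk L, L.length) acc =
    acc + ∑ f ∈ Finset.range (M - 1 - m), ls (fun x => vl thr val ((x ^^^ rowN m r) ^^^ rowN (M - 1 - f) r)) L := by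
  have h1 : chunk val thr r M m (rowN m r) (pk L, L.length) acc = Bool.rec (
    inner val thr r M L.length (0x555555555555 * rep L.length) (0x333333333333 * rep L.length)
      (0x0f0f0f0f0f0f * rep L.length) (rep L.length) (pk L ^^^ (rowN m r * rep L.length)) (M - 1 - m) acc) acc (Nat.beq L.length 0) := rfl
  rw [h1, brec]
  split
  · next h0 =>
    rw [List.length_eq_zero_iff.1 h0]; simp [ls]
  · have hrow := rowN_lt hm hr
    have h2 := inner_spec val thr r M ht hM hr _ (bd_xrow hrow hL) (M - 1 - m) acc
    rw [List.length_map] at h2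
    rw [pk_xrow hrow hL, h2]
    simp only [ls, List.map_map]
    rfl

/-! the enumeration lists -/
noncomputable def S (l r : ℕ) : ℕ → ℕ → List ℕ
  | 0, 0 => [0]
  | 0, _ + 1 => []
  | _ + 1, 0 => [0]
  | m + 1, k + 1 => S l r m (k + 1) ++ if l * m ≤ 48 * k then (S l r m k).map (· ^^^ rowN m r) else []

theorem S_bd {l r m k : ℕ} (hr : r < 2 ^ 48) (hm : m ≤ 48) : Bd (S l r m k) := by
  induction m generalizing k with
  | zero => cases k <;> simp [S, Bd]
  | succ m ih =>
    cases k with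
    | zero => simp [S, Bd]
    | succ k =>
      intro x hx
      rw [S, List.mem_append] at hx
      rcases hx with hx | hx
      · exact ih (by omega) x hx
      · split at hx
        · exact bd_xrow (rowN_lt (by omega) hr) (ih (by omega)) x hx
        · simp at hx

noncomputable def E (l r m k : ℕ) : ℕ × ℕ := (pk (S l r m k), (S l r m k).length)

theorem E_succ {l r m k : ℕ} (hr : r < 2 ^ 48) (hm : m < 48) : E l r (m + 1) (k + 1) =
   if l * m ≤ 48 * k then (pk (S l r m (k + 1)) + (pk (S l r m k) ^^^ (rowN m r * rep (S l r m k).length)) <<< (48 * (S l r m (k + 1)).length),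
     (S l r m (k + 1)).length + (S l r m k).length) else E l r m (k + 1) := by
  rw [E, S]
  split
  · rw [pk_append, pk_xrow (rowN_lt hm.le hr) (S_bd hr hm.le), List.length_append, List.length_map, Nat.shiftLeft_eq, mul_comm (pk _)]
  · rw [List.append_nil]; rfl

theorem stepA_spec {α : Type} (l r m : ℕ) (hr : r < 2 ^ 48) (hm : m < 48) (n k : ℕ) (K : List (ℕ × ℕ) → α) :
    stepA l m (rowN m r) ((List.range' (k + 1) n).map (E l r m)) (E l r m k).1 (E l r m k).2 k K =
      K ((List.range' (k + 1) n).map (E l r (m + 1))) := by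
  induction n generalizing k K with
  | zero => rfl
  | succ n ih =>
    rw [List.range'_succ, List.map_cons, List.map_cons]
    have h1 : ∀ (h : ℕ × ℕ) (t : List (ℕ × ℕ)) (pX pn : ℕ), stepA l m (rowN m r) (h :: t) pX pn k K =
      Bool.rec (stepA l m (rowN m r) t h.1 h.2 (k + 1) (fun T => K (h :: T)))
      (lazy (h.1 + (pX ^^^ (rowN m r * (rep pn))) <<< (48 * h.2)) fun x =>
       force (h.2 + pn) fun n => stepA l m (rowN m r) t h.1 h.2 (k + 1) (fun T => K ((x, n) :: T)))
      (Nat.ble (l * m) (48 * k)) := fun _ _ _ _ => rfl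
    rw [h1, lazy_eq, force_eq, ih, ih, E_succ hr hm]
    by_cases hc : l * m ≤ 48 * k
    · rw [Nat.ble_eq_true_of_le hc, if_pos hc]; rfl
    · have : Nat.ble (l * m) (48 * k) = false := by
        rw [Bool.eq_false_iff]; exact fun h => hc (Nat.le_of_ble_eq_true h)
      rw [this, if_neg hc]

theorem E_zero (l r m : ℕ) : E l r (m + 1) 0 = E l r m 0 := by
  cases m <;> rfl

theorem step_spec {α : Type} (l r m : ℕ) (hr : r < 2 ^ 48) (hm : m < 48) (n : ℕ) (K : List (ℕ × ℕ) → α) :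
    step l m (rowN m r) ((List.range' 0 (n + 1)).map (E l r m)) K = K ((List.range' 0 (n + 1)).map (E l r (m + 1))) := by
  rw [List.range'_succ, List.map_cons, List.map_cons, E_zero]
  exact stepA_spec l r m hr hm n 0 _

theorem lastD_spec (g : ℕ → ℕ × ℕ) (n k : ℕ) : lastD ((List.range' k (n + 1)).map g) = g (k + n) := by
  have : ∀ n k d, (List.rec (fun d => d) (fun h _ ih _ => ih h) ((List.range' k (n + 1)).map g) : ℕ × ℕ → ℕ × ℕ) d = g (k + n) := by
    intro n
    induction n with
    | zero => intro k d; rfl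
    | succ n ih =>
      intro k d
      rw [List.range'_succ, List.map_cons]
      show (List.rec (fun d => d) (fun h _ ih _ => ih h) ((List.range' (k + 1) (n + 1)).map g) : ℕ × ℕ → ℕ × ℕ) (g k) = _
      rw [ih]; congr 1; omega
  exact this n k (0, 0)

theorem iniL_spec (l r n : ℕ) : iniL n = (List.range' 0 (n + 1)).map (E l r 0) := by
  have h : ∀ n k, (Nat.rec [] (fun _ ih => (0, 0) :: ih) n : List (ℕ × ℕ)) = (List.range' (k + 1) n).map (E l r 0) := by
    intro n
    induction n with
    | zero => intro k; rfl
    | succ n ih => intro k; rw [List.range'_succ, List.map_cons, ← ih]; rfl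
  rw [List.range'_succ, List.map_cons, ← h]; rfl

theorem run_spec (val : ℕ → ℕ) (l r M M' n : ℕ) (hl : l = n + 2) (hM : M ≤ 48) (hM' : M' ≤ M) (hr : r < 2 ^ 48) (fuel : ℕ)
    (hf : fuel ≤ M') (acc : ℕ) :
    run val l r M M' fuel ((List.range' 0 (n + 1)).map (E l r (M' - fuel))) acc =
      acc + ∑ m ∈ Finset.Ico (M' - fuel) M', ∑ f ∈ Finset.range (M - 1 - m),
        ls (fun x => vl (16 - l) val ((x ^^^ rowN m r) ^^^ rowN (M - 1 - f) r)) (S l r m n) := by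
  induction fuel generalizing acc with
  | zero => simp [run]
  | succ f ih =>
    have h1 : ∀ L, run val l r M M' (f + 1) L acc = force (M' - 1 - f) fun m => force (rowN m r) fun row =>
      force (chunk val (16 - l) r M m row (lastD L) acc) fun acc' =>
      step l m row L fun L' => run val l r M M' f L' acc' := fun _ => rfl
    have e : M' - (f + 1) = M' - 1 - f := by omega
    have e2 : M' - 1 - f + 1 = M' - f := by omega
    rw [h1, force_eq, force_eq, force_eq, e, step_spec l r _ hr (by omega), e2, ih (by omega), lastD_spec, zero_add, E,
      chunk_spec val _ r M _ (by omega) hM (by omega) hr _ (S_bd hr (by omega)),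
      Finset.sum_eq_sum_Ico_succ_bot (show M' - 1 - f < M' by omega), e2, add_assoc]

theorem S_sum (l r k n : ℕ) (g : ℕ → ℕ) : ls g (S l r n (k + 1)) =
    ∑ m ∈ Finset.range n, if l * m ≤ 48 * k then ls (fun x => g (x ^^^ rowN m r)) (S l r m k) else 0 := by
  induction n with
  | zero => simp [S, ls]
  | succ n ih =>
    rw [Finset.sum_range_succ, ← ih, S]
    simp only [ls]
    rw [List.map_append, List.sum_append]
    split
    · rw [List.map_map]; rfl
    · simp

theorem run_eq (val : ℕ → ℕ) (l r M M' n : ℕ) (hl : l = n + 2) (hM : M ≤ 48) (hM' : M' ≤ M) (hr : r < 2 ^ 48)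
    (h1 : ∀ m < 48, l * m ≤ 48 * (n + 1) ↔ m < M) (h2 : ∀ m < 48, l * m ≤ 48 * n ↔ m < M') (acc : ℕ) :
    run val l r M M' M' (iniL n) acc = acc + ls (vl (16 - l) val) (S l r 48 l) := by
  have h := run_spec val l r M M' n hl hM hM' hr M' le_rfl acc
  rw [Nat.sub_self, ← iniL_spec] at h
  have eS : ls (vl (16 - l) val) (S l r 48 l) = ls (vl (16 - l) val) (S l r 48 (n + 1 + 1)) := by rw [hl]
  rw [h, eS, S_sum]
  refine congrArg (acc + ·) ?_
  simp only [S_sum l r n]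
  have e1 : ∀ m8 ∈ Finset.range 48, (if l * m8 ≤ 48 * (n + 1) then ∑ m ∈ Finset.range m8, if l * m ≤ 48 * n then
       ls (fun x => vl (16 - l) val (x ^^^ rowN m r ^^^ rowN m8 r)) (S l r m n) else 0 else 0) =
      ∑ m ∈ Finset.range 48, if m < M' ∧ m < m8 ∧ m8 < M then ls (fun x => vl (16 - l) val (x ^^^ rowN m r ^^^ rowN m8 r)) (S l r m n) else 0 := by
    intro m8 hm8
    rw [Finset.mem_range] at hm8
    simp only [h1 m8 hm8]
    split
    · next hlt =>
      rw [← Finset.sum_filter, ← Finset.sum_filter]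
      refine Finset.sum_congr ?_ fun _ _ => rfl
      ext m
      simp only [Finset.mem_filter, Finset.mem_range]
      constructor
      · rintro ⟨ha, hb⟩; exact ⟨by omega, (h2 m (by omega)).1 hb, ha, hlt⟩
      · rintro ⟨ha, hb, hc, -⟩; exact ⟨hc, (h2 m ha).2 hb⟩
    · next hlt =>
      symm; refine Finset.sum_eq_zero fun m _ => if_neg fun h => hlt h.2.2
  rw [Finset.sum_congr rfl e1, Finset.sum_comm]
  have e2 : Finset.Ico 0 M' = (Finset.range 48).filter (· < M') := by
    ext m; simp only [Finset.mem_Ico, Finset.mem_filter, Finset.mem_range]; omega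
  rw [e2, Finset.sum_filter]
  refine Finset.sum_congr rfl fun m hm => ?_
  rw [Finset.mem_range] at hm
  split
  · next hmM =>
    simp only [hmM, true_and]
    rw [← Finset.sum_filter]
    refine Finset.sum_bij (fun f _ => M - 1 - f) ?_ ?_ ?_ ?_
    · intro f hf; simp only [Finset.mem_filter, Finset.mem_range] at hf ⊢; omega
    · intro f hf g hg h; simp only [Finset.mem_range] at hf hg; omega
    · intro b hb; simp only [Finset.mem_filter, Finset.mem_range] at hb
      exact ⟨M - 1 - b, by simp only [Finset.mem_range]; omega, by omega⟩
    · intro f hf; rfl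
  · next hmM => symm; exact Finset.sum_eq_zero fun m _ => if_neg fun h => hmM h.1
end DC

namespace DC

@[irreducible] noncomputable def cvFin : Fintype Cv := Fintype.ofEquiv (Fin 48 → ZMod 2) ⟨fun c => ⟨c⟩, Cv.c, fun _ => rfl, fun _ => rfl⟩
noncomputable instance : Fintype Cv := cvFin
noncomputable instance : DecidableEq Cv := Classical.decEq _

def shE (i : Fin 48) : Cv ≃ Cv := ⟨shf i, shf (-i), fun a => by rw [shf_shf, neg_add_cancel, shf_zero],
  fun a => by rw [shf_shf, add_neg_cancel, shf_zero]⟩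

/-- position -/
def ps (x : ℕ) : Fin 48 := Fin.ofNat 48 x
theorem ps_add (x y : ℕ) : ps (x + y) = ps x + ps y := by
  apply Fin.ext; simp [ps, Fin.val_add]
theorem ps_48 (x : ℕ) : ps (x + 48) = ps x := by
  apply Fin.ext; simp [ps]
theorem ps_val (y : Fin 48) : ps y.val = y := by
  apply Fin.ext; simp [ps]

noncomputable def cnt (a : Cv) (x : ℕ) : ℕ := ∑ p ∈ Finset.range x, if a (ps p) ≠ 0 then 1 else 0
def good (l : ℕ) (a : Cv) : Prop := ∀ x : ℕ, l * x ≤ 48 * cnt a x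

theorem cnt_succ (a : Cv) (x : ℕ) : cnt a (x + 1) = cnt a x + if a (ps x) ≠ 0 then 1 else 0 :=
  Finset.sum_range_succ _ _
theorem cnt_add (a : Cv) (x : ℕ) (y : Fin 48) : cnt a (y.val + x) = cnt a y.val + cnt (shf (-y) a) x := by
  rw [cnt, Finset.sum_range_add]
  congr 1
  refine Finset.sum_congr rfl fun p _ => ?_
  rw [shf_ap, ps_add, ps_val, sub_neg_eq_add, add_comm]
theorem cnt_48 (a : Cv) : cnt a 48 = wt a := by
  rw [cnt, Finset.sum_range, wt_def, Finset.card_eq_sum_ones, Finset.sum_filter]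
  refine Finset.sum_congr rfl fun p _ => ?_
  rw [ps_val]
theorem cnt_p (a : Cv) (x : ℕ) : cnt a (x + 48) = cnt a x + wt a := by
  induction x with
  | zero => rw [zero_add, cnt_48]; simp [cnt]
  | succ x ih => rw [show x + 1 + 48 = x + 48 + 1 by ring, cnt_succ, ih, cnt_succ, ps_48]; ring

theorem good_of {l : ℕ} {a : Cv} (hw : wt a = l)
    (h : ∀ q < 48, a (ps q) ≠ 0 → l * q ≤ 48 * cnt a q) : good l a := by
  have h1 : ∀ d ≤ 48, l * (48 - d) ≤ 48 * cnt a (48 - d) := by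
    intro d
    induction d with
    | zero => intro _; rw [Nat.sub_zero, cnt_48, hw, mul_comm]
    | succ d ih =>
      intro hd
      by_cases hc : a (ps (48 - (d + 1))) ≠ 0
      · exact h _ (by omega) hc
      · have h2 := ih (by omega)
        have e : 48 - d = 48 - (d + 1) + 1 := by omega
        rw [e, cnt_succ, if_neg hc, add_zero] at h2
        exact le_trans (Nat.mul_le_mul_left _ (by omega)) h2
  have h2 : ∀ x ≤ 48, l * x ≤ 48 * cnt a x := by
    intro x hx
    have := h1 (48 - x) (by omega)
    rwa [show 48 - (48 - x) = x by omega] at this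
  intro x
  induction x using Nat.strong_induction_on with
  | _ x ih =>
    by_cases hx : x ≤ 48
    · exact h2 x hx
    · obtain ⟨y, rfl⟩ : ∃ y, x = y + 48 := ⟨x - 48, by omega⟩
      have := ih y (by omega)
      rw [cnt_p, hw]; linarith

theorem good_shf {l : ℕ} {a : Cv} (hw : wt a = l) (hg : good l a) (y : Fin 48) :
    good l (shf (-y) a) ↔ l * y.val = 48 * cnt a y.val := by
  constructor
  · intro h
    have h1 := h (48 - y.val)
    have h2 := cnt_add a (48 - y.val) y
    have h3 := hg y.val
    have hy := y.isLt
    rw [show y.val + (48 - y.val) = 48 by omega, cnt_48, hw] at h2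
    have h4 : l * 48 = l * y.val + l * (48 - y.val) := by rw [← Nat.mul_add]; congr 1; omega
    omega
  · intro h x
    have h2 := cnt_add a x y
    have h3 := hg (y.val + x)
    rw [Nat.mul_add, h2] at h3
    omega

theorem good_ex {l : ℕ} {a : Cv} (hw : wt a = l) : ∃ y : Fin 48, good l (shf (-y) a) := by
  obtain ⟨y, -, hy⟩ := Finset.exists_max_image (Finset.univ : Finset (Fin 48))
    (fun y => (l * y.val : ℤ) - 48 * cnt a y.val) ⟨0, Finset.mem_univ _⟩
  have h : ∀ x : ℕ, (l * x : ℤ) - 48 * cnt a x ≤ l * y.val - 48 * cnt a y.val := by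
    intro x
    induction x using Nat.strong_induction_on with
    | _ x ih =>
      by_cases hx : x < 48
      · exact hy ⟨x, hx⟩ (Finset.mem_univ _)
      · obtain ⟨z, rfl⟩ : ∃ y, x = y + 48 := ⟨x - 48, by omega⟩
        have := ih z (by omega)
        rw [cnt_p, hw]; push_cast; linarith
  refine ⟨y, fun x => ?_⟩
  have h1 := h (y.val + x)
  have h2 := cnt_add a x y
  rw [h2] at h1
  push_cast at h1
  zify
  linarith

open Classical in
noncomputable def Bc (l : ℕ) (a : Cv) : ℕ := (Finset.univ.filter fun y : Fin 48 => good l (shf (-y) a)).card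

theorem Bc_shf (l : ℕ) (a : Cv) (i : Fin 48) : Bc l (shf i a) = Bc l a := by
  classical
  unfold Bc
  refine Finset.card_equiv (Equiv.subRight i) ?_
  intro k
  rw [Finset.mem_filter_univ, Finset.mem_filter_univ, shf_shf, Equiv.subRight_apply]
  rw [show -k + i = -(k - i) by abel]

open Classical in
theorem Bc_eq {l : ℕ} {a : Cv} (hl : 0 < l) (hd : l ∣ 48) (hw : wt a = l) (hg : good l a) : Bc l a =
    ((Finset.range l).filter fun k => a (ps (k * (48 / l))) ≠ 0 ∧ cnt a (k * (48 / l)) = k).card := by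
  obtain ⟨d, hd⟩ := hd
  have hd' : 48 / l = d := by rw [hd, Nat.mul_div_cancel_left _ hl]
  have hd0 : 0 < d := by rcases Nat.eq_zero_or_pos d with h | h; · subst h; omega
                         · exact h
  unfold Bc
  simp only [good_shf hw hg, hd']
  symm
  refine Finset.card_bij (fun k _ => ps (k * d)) ?_ ?_ ?_
  · intro k hk
    rw [Finset.mem_filter, Finset.mem_range] at hk
    have hlt : k * d < 48 := by rw [hd]; exact Nat.mul_lt_mul_of_pos_right hk.1 hd0
    have e : (ps (k * d)).val = k * d := by simp [ps, Nat.mod_eq_of_lt hlt]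
    rw [Finset.mem_filter_univ, e, hk.2.2]
    calc l * (k * d) = (l * d) * k := by ring
      _ = 48 * k := by rw [← hd]
  · intro k hk k' hk' h
    rw [Finset.mem_filter, Finset.mem_range] at hk hk'
    have hlt : k * d < 48 := by rw [hd]; exact Nat.mul_lt_mul_of_pos_right hk.1 hd0
    have hlt' : k' * d < 48 := by rw [hd]; exact Nat.mul_lt_mul_of_pos_right hk'.1 hd0
    have := congrArg Fin.val h
    simp only [ps, Fin.val_ofNat, Nat.mod_eq_of_lt hlt, Nat.mod_eq_of_lt hlt'] at this
    exact Nat.eq_of_mul_eq_mul_right hd0 this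
  · intro y hy
    rw [Finset.mem_filter_univ] at hy
    have hy48 := y.isLt
    have e1 : y.val = cnt a y.val * d := by
      have : l * y.val = l * (cnt a y.val * d) := by
        rw [hy]
        generalize cnt a y.val = k
        rw [hd]; ring
      exact Nat.eq_of_mul_eq_mul_left hl this
    refine ⟨cnt a y.val, ?_, ?_⟩
    · rw [Finset.mem_filter, Finset.mem_range, ← e1]
      refine ⟨?_, ?_, rfl⟩
      · have : cnt a y.val * d < l * d := by rw [← e1, ← hd]; exact hy48
        exact Nat.lt_of_mul_lt_mul_right this
      · intro h0
        have h1 := hg (y.val + 1)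
        rw [cnt_succ, if_neg (by rw [h0]; simp), add_zero, Nat.mul_add] at h1
        omega
    · rw [← e1, ps_val]

theorem Bc_dvd {l : ℕ} {a : Cv} (hl : 0 < l) (hl8 : l ≤ 8) (hd : l ∣ 48) (hw : wt a = l) : Bc l a ∣ 840 := by
  classical
  obtain ⟨y, hy⟩ := good_ex hw
  have h1 : 0 < Bc l a := Finset.card_pos.2 ⟨y, by rw [Finset.mem_filter_univ]; exact hy⟩
  have h2 : Bc l a ≤ 8 := by
    rw [← Bc_shf l a (-y), Bc_eq hl hd (by rw [wt_shf, hw]) hy]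
    refine le_trans (Finset.card_filter_le _ _) ?_
    rw [Finset.card_range]; exact hl8
  generalize Bc l a = B at *
  interval_cases B <;> decide

open Classical in
theorem avg {l : ℕ} (hl : 0 < l) (hl8 : l ≤ 8) (hd : l ∣ 48) (Q : Cv → Prop) (hQ : ∀ i a, Q (shf i a) ↔ Q a)
    (hQw : ∀ a, Q a → wt a = l) (F : Cv → ℕ) (hF : ∀ i a, F (shf i a) = F a) (c : ℕ) :
    c * 840 * ∑ a, (if Q a then F a else 0) = 48 * ∑ a, if Q a ∧ good l a then (c * 840 / Bc l a) * F a else 0 := by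
  have e1 : ∀ a, c * 840 * (if Q a then F a else 0) = ∑ y : Fin 48, if Q (shf (-y) a) ∧ good l (shf (-y) a) then
      (c * 840 / Bc l (shf (-y) a)) * F (shf (-y) a) else 0 := by
    intro a
    simp only [hQ, hF, Bc_shf]
    by_cases h : Q a
    · simp only [h, if_true, true_and]
      rw [← Finset.sum_filter, Finset.sum_const, smul_eq_mul, ← mul_assoc]
      change _ = Bc l a * _ * _
      rw [Nat.mul_div_cancel' (Dvd.dvd.mul_left (Bc_dvd hl hl8 hd (hQw a h)) c)]
    · simp [h]
  rw [Finset.mul_sum, Finset.sum_congr rfl fun a _ => e1 a, Finset.sum_comm]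
  have e2 : ∀ y : Fin 48, (∑ a, if Q (shf (-y) a) ∧ good l (shf (-y) a) then
      (c * 840 / Bc l (shf (-y) a)) * F (shf (-y) a) else 0) = ∑ a, if Q a ∧ good l a then (c * 840 / Bc l a) * F a else 0 := by
    intro y
    exact Fintype.sum_equiv (shE (-y)) _ _ fun a => rfl
  rw [Finset.sum_congr rfl fun y _ => e2 y, Finset.sum_const, Finset.card_univ, Fintype.card_fin, smul_eq_mul]
end DC

namespace DC
set_option linter.constructorNameAsVariable false

noncomputable def cor (a b : Cv) (j : Fin 48) : ℕ := ∑ i : Fin 48, if a i ≠ 0 ∧ b (i + j) ≠ 0 then 1 else 0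

theorem cor_shf (a b : Cv) (j i) : cor (shf i a) (shf i b) j = cor a b j := by
  unfold cor
  refine Fintype.sum_equiv (Equiv.subRight i) _ _ fun k => ?_
  rw [shf_ap, shf_ap, Equiv.subRight_apply, show k + j - i = k - i + j by abel]
theorem cor_star (a b : Cv) (j) : cor (star a) (star b) j = cor b a j := by
  unfold cor
  refine Fintype.sum_equiv ((Equiv.addRight j).trans (Equiv.neg _)) _ _ fun k => ?_
  rw [star_ap, star_ap, Equiv.trans_apply, Equiv.coe_addRight, Equiv.neg_apply, show -(k + j) + j = -k by abel]
  simp only [and_comm]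

theorem wd_inj {f a b : Cv} (h : wd f a = wd f b) : a = b :=
  cv_ext fun i => congrFun h (Sum.inl i)

theorem lam_eq (f : Cv) (p q : Pt) : lam f p q = ∑ a : Cv, if wt a + wt (a * f) = 16 then
    (if wd f a p ≠ 0 ∧ wd f a q ≠ 0 then 1 else 0) else 0 := by
  classical
  have e : ∀ a : Cv, (if wt a + wt (a * f) = 16 then
    (if wd f a p ≠ 0 ∧ wd f a q ≠ 0 then 1 else 0) else 0) = if wt a + wt (a * f) = 16 ∧ (wd f a p ≠ 0 ∧ wd f a q ≠ 0) then 1 else 0 := by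
    intro a
    by_cases h : wt a + wt (a * f) = 16
    · rw [if_pos h]; exact if_congr ⟨fun k => ⟨h, k⟩, fun k => k.2⟩ rfl rfl
    · rw [if_neg h, if_neg fun k => h k.1]
  rw [Finset.sum_congr rfl fun a _ => e a, ← Finset.sum_filter, ← Finset.card_eq_sum_ones, lam]
  symm
  refine Finset.card_bij (fun a _ => wd f a) ?_ ?_ ?_
  · intro a ha
    rw [Finset.mem_filter_univ] at ha
    rw [Finset.mem_filter_univ, hn_wd]
    exact ⟨⟨wd_mem _ _, ha.1⟩, ha.2⟩
  · intro a _ b _ h; exact wd_inj h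
  · intro x hx
    rw [Finset.mem_filter_univ] at hx
    obtain ⟨a, rfl⟩ := (mem_code f x).1 hx.1.1
    rw [hn_wd] at hx
    exact ⟨a, by rw [Finset.mem_filter_univ]; exact ⟨hx.1.2, hx.2⟩, rfl⟩

theorem lam_orbit (f : Cv) (p q : Pt) : 48 * lam f p q = ∑ a : Cv, if wt a + wt (a * f) = 16 then
    ∑ i : Fin 48, (if wd f a (sft i p) ≠ 0 ∧ wd f a (sft i q) ≠ 0 then 1 else 0) else 0 := by
  have h1 : 48 * lam f p q = ∑ i : Fin 48, lam f (sft i p) (sft i q) := by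
    rw [Finset.sum_congr rfl fun i _ => lam_aut (aut_sft f i) p q, Finset.sum_const, Finset.card_univ,
      Fintype.card_fin, smul_eq_mul]
  rw [h1, Finset.sum_congr rfl fun i _ => lam_eq f _ _, Finset.sum_comm]
  refine Finset.sum_congr rfl fun a _ => ?_
  split
  · rfl
  · simp

theorem lam_symm (f : Cv) (p q : Pt) : lam f p q = lam f q p := by
  rw [lam_eq, lam_eq]
  refine Finset.sum_congr rfl fun a _ => ?_
  exact if_congr Iff.rfl (if_congr and_comm rfl rfl) rfl

theorem lamN (f : Cv) (j) : 48 * lam f (Sum.inl 0) (Sum.inr j) = ∑ a : Cv, if wt a + wt (a * f) = 16 then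
    cor a (a * f) j else 0 := by
  rw [lam_orbit]
  refine Finset.sum_congr rfl fun a _ => if_congr Iff.rfl ?_ rfl
  refine Finset.sum_congr rfl fun i _ => ?_
  rw [sft_inl, sft_inr, zero_add, add_comm j i]; rfl

theorem lamA {f : Cv} (U : f * star f = 1) (j) : 48 * (2 * lam f (Sum.inl 0) (Sum.inl j)) = ∑ a : Cv, if wt a + wt (a * f) = 16 then
    cor a a j + cor (a * f) (a * f) j else 0 := by
  have h0 : lam f (Sum.inl 0) (Sum.inl j) = lam f (Sum.inr 0) (Sum.inr j) := by
    have h1 := lam_aut (aut_tau U) (Sum.inl j) (Sum.inl 0)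
    rw [tau_inl, tau_inl] at h1
    have h2 := lam_aut (aut_sft f j) (Sum.inr (-j)) (Sum.inr (-0))
    rw [sft_inr, sft_inr, neg_add_cancel, neg_zero, zero_add] at h2
    rw [h2, lam_symm, ← h1, neg_zero]
  have e1 : 48 * (2 * lam f (Sum.inl 0) (Sum.inl j)) = 48 * lam f (Sum.inl 0) (Sum.inl j) + 48 * lam f (Sum.inr 0) (Sum.inr j) := by
    rw [← h0]; ring
  rw [e1, lam_orbit, lam_orbit, ← Finset.sum_add_distrib]
  refine Finset.sum_congr rfl fun a _ => ?_
  have hA : (∑ i : Fin 48, (if wd f a (sft i (Sum.inl 0)) ≠ 0 ∧ wd f a (sft i (Sum.inl j)) ≠ 0 then 1 else 0)) = cor a a j := by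
    refine Finset.sum_congr rfl fun i _ => ?_
    rw [sft_inl, sft_inl, zero_add, add_comm j i]; rfl
  have hB : (∑ i : Fin 48, (if wd f a (sft i (Sum.inr 0)) ≠ 0 ∧ wd f a (sft i (Sum.inr j)) ≠ 0 then 1 else 0)) = cor (a * f) (a * f) j := by
    refine Finset.sum_congr rfl fun i _ => ?_
    rw [sft_inr, sft_inr, zero_add, add_comm j i]; rfl
  rw [hA, hB]
  by_cases h : wt a + wt (a * f) = 16
  · rw [if_pos h, if_pos h, if_pos h]
  · rw [if_neg h, if_neg h, if_neg h]

def Wl (f : Cv) (l : ℕ) (a : Cv) : Prop := wt a = l ∧ wt (a * f) = 16 - l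

theorem Wl_shf (f : Cv) (l i a) : Wl f l (shf i a) ↔ Wl f l a := by
  unfold Wl; rw [wt_shf, shf_mul, wt_shf]

def tauE (f : Cv) (U : f * star f = 1) : Cv ≃ Cv :=
  have h : ∀ a, star (star (a * f) * f) = a := fun a => by
    rw [star_mul, star_star, mul_assoc, U, mul_one]
  ⟨fun a => star (a * f), fun a => star (a * f), h, h⟩

open Classical in
theorem Wl_sum {f : Cv} (U : f * star f = 1) (l : ℕ) (hl : l ≤ 16) (F : Cv → ℕ) (hF : ∀ a, F (star (a * f)) = F a) :
    (∑ a, if Wl f (16 - l) a then F a else 0) = ∑ a, if Wl f l a then F a else 0 := by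
  refine Fintype.sum_equiv (tauE f U) _ _ fun a => ?_
  have e : tauE f U a = star (a * f) := rfl
  have e2 : star (a * f) * f = star a := by
    rw [star_mul, mul_assoc, mul_comm (star f), U, mul_one]
  have e3 : Wl f l (star (a * f)) ↔ Wl f (16 - l) a := by
    unfold Wl
    rw [e2, wt_star, wt_star, show 16 - (16 - l) = l by omega, and_comm]
  rw [e, hF]
  by_cases h : Wl f (16 - l) a
  · rw [if_pos h, if_pos (e3.2 h)]
  · rw [if_neg h, if_neg (fun k => h (e3.1 k))]

open Classical in
theorem W_split {f : Cv} (h : P f) (F : Cv → ℕ) (hF : ∀ a, F (star (a * f)) = F a) :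
    (∑ a, if wt a + wt (a * f) = 16 then F a else 0) = (∑ a, if Wl f 8 a then F a else 0) +
      2 * (∑ a, if Wl f 6 a then F a else 0) + 2 * (∑ a, if Wl f 4 a then F a else 0) + 2 * (∑ a, if Wl f 2 a then F a else 0) := by
  have e : ∀ a, (if wt a + wt (a * f) = 16 then F a else 0) = (if Wl f 8 a then F a else 0) +
     ((if Wl f (16 - 6) a then F a else 0) + (if Wl f 6 a then F a else 0)) +
     ((if Wl f (16 - 4) a then F a else 0) + (if Wl f 4 a then F a else 0)) +
     ((if Wl f (16 - 2) a then F a else 0) + (if Wl f 2 a then F a else 0)) := by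
    intro a
    unfold Wl
    by_cases hw : wt a + wt (a * f) = 16
    · have h2 := h.even hw
      have h0 : wt a ≠ 0 := by
        intro h0
        have : a = 0 := by
          have := hammingNorm_eq_zero.1 h0
          exact cv_ext fun i => congrFun this i
        rw [this, zero_mul, wt_zero] at hw; omega
      have h16 : wt (a * f) ≠ 0 := by
        intro h0
        have h1 : a * f = 0 := by
          have := hammingNorm_eq_zero.1 h0
          exact cv_ext fun i => congrFun this i
        have : a = 0 := by rw [← mul_one a, ← h.U, ← mul_assoc, h1, zero_mul]
        rw [this, zero_mul, wt_zero] at hw; omega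
      rw [if_pos hw]
      have hc : wt a = 2 ∨ wt a = 4 ∨ wt a = 6 ∨ wt a = 8 ∨ wt a = 10 ∨ wt a = 12 ∨ wt a = 14 := by omega
      rcases hc with h | h | h | h | h | h | h <;>
      · have hb : wt (a * f) = 16 - wt a := by omega
        rw [hb, h]
        norm_num
    · rw [if_neg hw]
      have : ∀ l ≤ 16, ¬ (wt a = l ∧ wt (a * f) = 16 - l) := by intro l hl; omega
      rw [if_neg (this 8 (by norm_num)), if_neg (this 6 (by norm_num)), if_neg (this 4 (by norm_num)), if_neg (this 2 (by norm_num)),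
        if_neg (this (16 - 6) (by norm_num)), if_neg (this (16 - 4) (by norm_num)), if_neg (this (16 - 2) (by norm_num))]
  rw [Finset.sum_congr rfl fun a _ => e a]
  simp only [Finset.sum_add_distrib]
  rw [Wl_sum h.U 6 (by norm_num) F hF, Wl_sum h.U 4 (by norm_num) F hF, Wl_sum h.U 2 (by norm_num) F hF]
  ring

open Classical in
noncomputable def GS (f : Cv) (l w : ℕ) (F : Cv → ℕ) : ℕ := ∑ a, if Wl f l a ∧ good l a then (w / Bc l a) * F a else 0

noncomputable def tot (f : Cv) (F : Cv → ℕ) : ℕ := GS f 8 840 F + GS f 6 1680 F + GS f 4 1680 F + GS f 2 1680 F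

theorem key {f : Cv} (h : P f) (F : Cv → ℕ) (hs : ∀ i a, F (shf i a) = F a) (hF : ∀ a, F (star (a * f)) = F a) :
    840 * (∑ a, if wt a + wt (a * f) = 16 then F a else 0) = 48 * tot f F := by
  classical
  have A := fun l (h1 : 0 < l) (h2 : l ≤ 8) (h3 : l ∣ 48) c =>
    avg h1 h2 h3 (Wl f l) (Wl_shf f l) (fun a ha => ha.1) F hs c
  have a8 := A 8 (by norm_num) (by norm_num) (by norm_num) 1
  have a6 := A 6 (by norm_num) (by norm_num) (by norm_num) 2
  have a4 := A 4 (by norm_num) (by norm_num) (by norm_num) 2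
  have a2 := A 2 (by norm_num) (by norm_num) (by norm_num) 2
  simp only [show 1 * 840 = 840 by norm_num, show 2 * 840 = 1680 by norm_num] at a8 a6 a4 a2
  rw [W_split h F hF, tot]
  unfold GS
  linarith

theorem keyN {f : Cv} (h : P f) (j) : 840 * lam f (Sum.inl 0) (Sum.inr j) = tot f (fun a => cor a (a * f) j) := by
  have := key h (fun a => cor a (a * f) j) (fun i a => by simp only [shf_mul, cor_shf]) (fun a => by
    have e2 : star (a * f) * f = star a := by
      rw [star_mul, mul_assoc, mul_comm (star f), h.U, mul_one]
    simp only [e2, cor_star])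
  rw [← lamN] at this; omega
theorem keyA {f : Cv} (h : P f) (j) : 1680 * lam f (Sum.inl 0) (Sum.inl j) = tot f (fun a => cor a a j + cor (a * f) (a * f) j) := by
  have := key h (fun a => cor a a j + cor (a * f) (a * f) j) (fun i a => by simp only [shf_mul, cor_shf]) (fun a => by
    have e2 : star (a * f) * f = star a := by
      rw [star_mul, mul_assoc, mul_comm (star f), h.U, mul_one]
    simp only [e2, cor_star]; rw [add_comm])
  rw [← lamA h.U] at this; omega
end DC

namespace DC
set_option linter.constructorNameAsVariable false

def cond (l m k a : ℕ) : Prop := pc a = k ∧ ∀ q < m, a.testBit q = true → l * q ≤ 48 * pc (a % 2 ^ q)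

theorem mulN_step {m a r : ℕ} (hm : m < 48) (ha : a < 2 ^ m) (hr : r < 2 ^ 48) :
    mulN (2 ^ m + a) r = mulN a r ^^^ rowN m r := by
  have h48 : 2 ^ m + a < 2 ^ 48 := by
    have : 2 ^ (m + 1) ≤ 2 ^ 48 := Nat.pow_le_pow_right (by norm_num) hm
    rw [pow_succ] at this; omega
  have ha' : a < 2 ^ 48 := by omega
  have e : 2 ^ m + a = 2 ^ m ^^^ a := by
    refine Nat.eq_of_testBit_eq fun i => ?_
    rw [Nat.testBit_xor, Nat.testBit_two_pow]
    rcases lt_trichotomy i m with h | h | h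
    · rw [Nat.testBit_two_pow_add_gt h]; simp [h.ne']
    · subst h; rw [Nat.testBit_two_pow_add_eq, Nat.testBit_lt_two_pow ha]; simp
    · rw [Nat.testBit_lt_two_pow (lt_of_lt_of_le ha (Nat.pow_le_pow_right (by norm_num) h.le)),
        Nat.testBit_lt_two_pow (x := 2 ^ m + a) (i := i)]
      · simp [h.ne]
      · have : 2 ^ (m + 1) ≤ 2 ^ i := Nat.pow_le_pow_right (by norm_num) h
        rw [pow_succ] at this; omega
  obtain ⟨h1, h2⟩ := mulN_spec h48 hr
  obtain ⟨h3, h4⟩ := mulN_spec ha' hr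
  have h5 := rowN_lt hm.le hr
  refine bv_inj h1 (Nat.xor_lt_two_pow h3 h5) ?_
  have h6 := bv_rot ⟨m, hm⟩ hr
  simp only at h6
  rw [h2, e, bv_xor, bv_xor, h4, rowN_eq hm.le, h6, ← X_mul]
  have h7 := bv_two_pow ⟨m, hm⟩
  simp only at h7
  rw [h7]; ring

theorem tb_add {m a q : ℕ} (hq : q < m) : (2 ^ m + a).testBit q = a.testBit q :=
  Nat.testBit_two_pow_add_gt hq a

theorem pc_add {m a : ℕ} (hm : m < 48) (ha : a < 2 ^ m) : pc (2 ^ m + a) = pc a + 1 := by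
  have : sb (2 ^ m + a) = insert m (sb a) := by
    ext i
    rw [Finset.mem_insert, mem_sb, mem_sb]
    rcases lt_trichotomy i m with h | h | h
    · rw [tb_add h]; constructor
      · intro k; exact Or.inr k
      · rintro (k | k); · omega
        · exact k
    · subst h; rw [Nat.testBit_two_pow_add_eq, Nat.testBit_lt_two_pow ha]; simp [hm]
    · rw [Nat.testBit_lt_two_pow (lt_of_lt_of_le ha (Nat.pow_le_pow_right (by norm_num) h.le)),
        Nat.testBit_lt_two_pow (x := 2 ^ m + a) (i := i)]
      · simp; omega
      · have : 2 ^ (m + 1) ≤ 2 ^ i := Nat.pow_le_pow_right (by norm_num) h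
        rw [pow_succ] at this; omega
  rw [pc, this, Finset.card_insert_of_notMem]
  rw [mem_sb, Nat.testBit_lt_two_pow ha]; simp

theorem cond_lo {l m k a : ℕ} (ha : a < 2 ^ m) : cond l (m + 1) k a ↔ cond l m k a := by
  unfold cond
  refine and_congr_right fun _ => ?_
  constructor
  · intro h q hq; exact h q (by omega)
  · intro h q hq hb
    rcases Nat.lt_succ_iff_lt_or_eq.1 hq with h' | h'
    · exact h q h' hb
    · rw [h', Nat.testBit_lt_two_pow ha] at hb; simp at hb

theorem cond_hi {l m k a : ℕ} (hm : m < 48) (ha : a < 2 ^ m) : cond l (m + 1) (k + 1) (2 ^ m + a) ↔ (l * m ≤ 48 * k ∧ cond l m k a) := by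
  unfold cond
  rw [pc_add hm ha, Nat.add_right_cancel_iff]
  have e : ∀ q ≤ m, (2 ^ m + a) % 2 ^ q = a % 2 ^ q := by
    intro q hq
    obtain ⟨d, rfl⟩ := Nat.exists_eq_add_of_le hq
    rw [pow_add, Nat.mul_add_mod]
  constructor
  · rintro ⟨h1, h2⟩
    refine ⟨?_, h1, ?_⟩
    · have := h2 m (Nat.lt_succ_self m) (by rw [Nat.testBit_two_pow_add_eq, Nat.testBit_lt_two_pow ha]; rfl)
      rw [e m le_rfl, Nat.mod_eq_of_lt ha, h1] at this; exact this
    · intro q hq hb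
      have := h2 q (by omega) (by rw [tb_add hq]; exact hb)
      rwa [e q hq.le] at this
  · rintro ⟨h0, h1, h2⟩
    refine ⟨h1, fun q hq hb => ?_⟩
    rcases Nat.lt_succ_iff_lt_or_eq.1 hq with h' | h'
    · rw [e q h'.le]; exact h2 q h' (by rw [← tb_add h']; exact hb)
    · rw [h', e m le_rfl, Nat.mod_eq_of_lt ha, h1]; exact h0

theorem pc_zero : pc 0 = 0 := by
  have : sb 0 = ∅ := by ext i; simp [mem_sb]
  rw [pc, this]; rfl
theorem pc_eq_zero {a : ℕ} (ha : a < 2 ^ 48) (h : pc a = 0) : a = 0 := by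
  have h1 : sb a = ∅ := Finset.card_eq_zero.1 h
  refine Nat.eq_of_testBit_eq fun i => ?_
  rw [Nat.zero_testBit]
  by_contra hc
  have : i ∈ sb a := by
    rw [mem_sb]
    refine ⟨?_, by simpa using hc⟩
    by_contra hi
    rw [Nat.testBit_lt_two_pow (lt_of_lt_of_le ha (Nat.pow_le_pow_right (by norm_num) (by omega)))] at hc
    simp at hc
  rw [h1] at this; simp at this

open Classical in
theorem S_masks (l r m k : ℕ) (hr : r < 2 ^ 48) (hm : m ≤ 48) (g : ℕ → ℕ) : ls g (S l r m k) =
    ∑ a ∈ Finset.range (2 ^ m), if cond l m k a then g (mulN a r) else 0 := by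
  have m0 : mulN 0 r = 0 := rfl
  induction m generalizing k g with
  | zero =>
    rw [pow_zero, Finset.sum_range_one, m0]
    cases k with
    | zero => rw [if_pos ⟨pc_zero, fun q hq => absurd hq (by omega)⟩]; simp [S, ls]
    | succ k => rw [if_neg (fun h => by have := h.1; rw [pc_zero] at this; omega)]; simp [S, ls]
  | succ m ih =>
    have hle : 2 ^ m ≤ 2 ^ 48 := Nat.pow_le_pow_right (by norm_num) (by omega)
    cases k with
    | zero =>
      rw [Finset.sum_eq_single 0]
      · rw [if_pos ⟨pc_zero, fun q hq => by simp⟩, m0]; simp [S, ls]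
      · intro a ha h0
        rw [Finset.mem_range] at ha
        have hle' : 2 ^ (m + 1) ≤ 2 ^ 48 := Nat.pow_le_pow_right (by norm_num) (by omega)
        exact if_neg fun h => h0 (pc_eq_zero (lt_of_lt_of_le ha hle') h.1)
      · intro h; exact absurd (Finset.mem_range.2 (by positivity)) h
    | succ k =>
      have h1 : ls g (S l r (m + 1) (k + 1)) = ls g (S l r m (k + 1)) +
          if l * m ≤ 48 * k then ls (fun x => g (x ^^^ rowN m r)) (S l r m k) else 0 := by
        rw [S]
        simp only [ls]
        rw [List.map_append, List.sum_append]
        split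
        · rw [List.map_map]; rfl
        · simp
      rw [h1, ih (k + 1) (by omega), ih k (by omega), pow_succ, mul_two, Finset.sum_range_add]
      congr 1
      · refine Finset.sum_congr rfl fun a ha => ?_
        rw [Finset.mem_range] at ha
        by_cases hc : cond l m (k + 1) a
        · rw [if_pos hc, if_pos ((cond_lo ha).2 hc)]
        · rw [if_neg hc, if_neg fun h => hc ((cond_lo ha).1 h)]
      · by_cases hlm : l * m ≤ 48 * k
        · rw [if_pos hlm]
          refine Finset.sum_congr rfl fun a ha => ?_
          rw [Finset.mem_range] at ha
          rw [mulN_step (by omega) ha hr]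
          by_cases hc : cond l m k a
          · rw [if_pos hc, if_pos ((cond_hi (by omega) ha).2 ⟨hlm, hc⟩)]
          · rw [if_neg hc, if_neg fun h => hc ((cond_hi (by omega) ha).1 h).2]
        · rw [if_neg hlm]
          symm
          refine Finset.sum_eq_zero fun a ha => ?_
          rw [Finset.mem_range] at ha
          exact if_neg fun h => hlm ((cond_hi (by omega) ha).1 h).1

noncomputable def msk (a : Cv) : ℕ := (bv_surj a).choose
theorem msk_lt (a : Cv) : msk a < 2 ^ 48 := (bv_surj a).choose_spec.1
theorem bv_msk (a : Cv) : bv (msk a) = a := (bv_surj a).choose_spec.2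
theorem msk_bv {x : ℕ} (hx : x < 2 ^ 48) : msk (bv x) = x := bv_inj (msk_lt _) hx (bv_msk _)

theorem sum_masks' (g : ℕ → ℕ) (N : ℕ) (h1 : ∀ a, msk a < N) (h2 : ∀ x < N, msk (bv x) = x) :
    ∑ x ∈ Finset.range N, g x = ∑ a : Cv, g (msk a) := by
  symm
  refine Finset.sum_bij (fun a _ => msk a) ?_ ?_ ?_ ?_
  · intro a _; exact Finset.mem_range.2 (h1 a)
  · intro a _ b _ h; rw [← bv_msk a, h, bv_msk]
  · intro x hx; exact ⟨bv x, Finset.mem_univ (bv x), h2 x (Finset.mem_range.1 hx)⟩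
  · intro a _; rfl
theorem sum_masks (g : ℕ → ℕ) : ∑ x ∈ Finset.range (2 ^ 48), g x = ∑ a : Cv, g (msk a) :=
  sum_masks' g _ msk_lt fun _ h => msk_bv h

theorem mulN_msk (a b : Cv) : mulN (msk a) (msk b) = msk (a * b) := by
  obtain ⟨h1, h2⟩ := mulN_spec (msk_lt a) (msk_lt b)
  rw [bv_msk, bv_msk] at h2
  rw [← h2, msk_bv h1]

theorem pc_msk (a : Cv) : pc (msk a) = wt a := by
  rw [pc, ← wt_bv, bv_msk]

theorem tb_msk (a : Cv) (i : Fin 48) : (msk a).testBit i.val = true ↔ a i ≠ 0 := by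
  rw [← bv_ne, bv_msk]

theorem pc_mod (a : Cv) {q : ℕ} (hq : q ≤ 48) : pc (msk a % 2 ^ q) = cnt a q := by
  rw [pc, Finset.card_eq_sum_ones, cnt, sb, Finset.sum_filter]
  have : Finset.range q = (Finset.range 48).filter (· < q) := by
    ext i; simp only [Finset.mem_filter, Finset.mem_range]; omega
  rw [this, Finset.sum_filter]
  refine Finset.sum_congr rfl fun i hi => ?_
  rw [Finset.mem_range] at hi
  have hb : (msk a).testBit i = true ↔ a (ps i) ≠ 0 := by
    have := tb_msk a (ps i)
    rwa [show (ps i).val = i by simp [ps, Nat.mod_eq_of_lt hi]] at this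
  rw [Nat.testBit_mod_two_pow]
  by_cases h1 : i < q <;> by_cases h2 : a (ps i) ≠ 0
  · rw [hb.2 h2]; simp [h1, h2]
  · have : (msk a).testBit i = false := by rw [← Bool.not_eq_true]; exact fun h => h2 (hb.1 h)
    rw [this]; simp [h2]
  · simp [h1]
  · simp [h1]

theorem cond_good (l : ℕ) (a : Cv) : cond l 48 l (msk a) ↔ (wt a = l ∧ good l a) := by
  unfold cond
  rw [pc_msk]
  refine and_congr_right fun hw => ?_
  have hp : ∀ q < 48, (ps q).val = q := fun q hq => by simp [ps, Nat.mod_eq_of_lt hq]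
  constructor
  · intro h
    refine good_of hw fun q hq hb => ?_
    have h1 := (tb_msk a (ps q)).2 hb
    rw [hp q hq] at h1
    have := h q hq h1
    rwa [pc_mod a hq.le] at this
  · intro h q hq _
    rw [pc_mod a hq.le]; exact h q

open Classical in
theorem S_good {f : Cv} (hP : P f) (l : ℕ) (hl : 0 < l) (g : ℕ → ℕ) (hl16 : l ≤ 16) : ls (vl (16 - l) g) (S l (msk f) 48 l) =
    ∑ a : Cv, if Wl f l a ∧ good l a then g (msk (a * f)) else 0 := by
  rw [S_masks l _ 48 l (msk_lt f) le_rfl]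
  rw [sum_masks (fun a => if cond l 48 l a then vl (16 - l) g (mulN a (msk f)) else 0)]
  refine Finset.sum_congr rfl fun a _ => ?_
  simp only [mulN_msk, vl, pc_msk]
  by_cases h : Wl f l a ∧ good l a
  · rw [if_pos h, if_pos ((cond_good l a).2 ⟨h.1.1, h.2⟩), if_pos h.1.2.le]
  · rw [if_neg h]
    by_cases hc : cond l 48 l (msk a)
    · rw [if_pos hc]
      obtain ⟨h1, h2⟩ := (cond_good l a).1 hc
      refine if_neg fun h3 => h ⟨⟨h1, ?_⟩, h2⟩
      have h0 : a ≠ 0 := by rintro rfl; rw [wt_zero] at h1; omega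
      have := hP.M a h0
      omega
    · rw [if_neg hc]
end DC

namespace DC
set_option linter.constructorNameAsVariable false

theorem brec2 {α : Type} (J k : ℕ) (a b : α) : (Bool.rec a b (Nat.beq J k) : α) = if J = k then b else a := by
  by_cases h : J = k
  · subst h; rw [Nat.beq_refl, if_pos rfl]
  · have hb : Nat.beq J k = false := by
      rw [Bool.eq_false_iff]; exact fun e => h (Nat.eq_of_beq_eq_true e)
    rw [hb, if_neg h]

theorem enc_eq {x : ℕ} (hx : x < 2 ^ 48) : enc x = ∑ p ∈ sb x, 2 ^ (80 * p) := by
  have := (bf_spec (fun q acc => Nat.add acc (Nat.pow q 80)) (fun _ => True) id (fun p => 2 ^ (80 * p))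
    (fun p hp acc _ => ⟨trivial, by
      show acc + (2 ^ p) ^ 80 = _
      rw [← pow_mul, mul_comm p, add_comm]; rfl⟩) 48 x 0 hx (sb_card x) trivial).2
  exact this
theorem encr_eq {x : ℕ} (hx : x < 2 ^ 48) : encr x = ∑ p ∈ sb x, 2 ^ (80 * (48 - p)) := by
  have := (bf_spec (fun q acc => Nat.add acc (Nat.pow (Nat.div 281474976710656 q) 80)) (fun _ => True) id (fun p => 2 ^ (80 * (48 - p)))
    (fun p hp acc _ => ⟨trivial, by
      show acc + (281474976710656 / 2 ^ p) ^ 80 = _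
      have : 281474976710656 = 2 ^ p * 2 ^ (48 - p) := by
        rw [← pow_add, Nat.add_sub_cancel' hp.le]; norm_num
      rw [this, Nat.mul_div_cancel_left _ (by positivity), ← pow_mul, mul_comm (48 - p), add_comm]; rfl⟩) 48 x 0 hx (sb_card x) trivial).2
  exact this
theorem pcK_eq {x : ℕ} (hx : x < 2 ^ 48) : pcK x = pc x := by
  have := (bf_spec (fun _ acc => Nat.succ acc) (fun _ => True) id (fun _ => 1)
    (fun p hp acc _ => ⟨trivial, by
      show acc + 1 = 1 + acc
      rw [add_comm]⟩) 48 x 0 hx (sb_card x) trivial).2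
  rw [pc, Finset.card_eq_sum_ones]
  exact this

open Classical in
theorem bcnt_eq {l : ℕ} (hl : 0 < l) (hd : l ∣ 48) (a : Cv) (hw : wt a = l) (hg : good l a) :
    bcnt l (msk a) = Bc l a := by
  rw [Bc_eq hl hd hw hg]
  obtain ⟨d, hd⟩ := hd
  have hd' : 48 / l = d := by rw [hd, Nat.mul_div_cancel_left _ hl]
  have H : ∀ n ≤ l, (Nat.rec 0 (fun k ih => force (Nat.mul k (Nat.div 48 l)) fun y =>
      Bool.rec (Bool.rec ih (Nat.succ ih) (Nat.beq (pcK (Nat.mod (msk a) (Nat.shiftLeft 1 y))) k)) ih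
    (Nat.beq (Nat.mod (Nat.shiftRight (msk a) y) 2) 0)) n : ℕ) =
     ((Finset.range n).filter fun k => a (ps (k * (48 / l))) ≠ 0 ∧ cnt a (k * (48 / l)) = k).card := by
    intro n
    induction n with
    | zero => intro _; rfl
    | succ k ih =>
      intro hk
      have ih := ih (by omega)
      rw [Finset.range_add_one, Finset.filter_insert]
      generalize hR : (Nat.rec 0 (fun k ih => force (Nat.mul k (Nat.div 48 l)) fun y =>
        Bool.rec (Bool.rec ih (Nat.succ ih) (Nat.beq (pcK (Nat.mod (msk a) (Nat.shiftLeft 1 y))) k)) ih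
        (Nat.beq (Nat.mod (Nat.shiftRight (msk a) y) 2) 0)) k : ℕ) = R at ih
      have e : (Nat.rec 0 (fun k ih => force (Nat.mul k (Nat.div 48 l)) fun y =>
        Bool.rec (Bool.rec ih (Nat.succ ih) (Nat.beq (pcK (Nat.mod (msk a) (Nat.shiftLeft 1 y))) k)) ih
        (Nat.beq (Nat.mod (Nat.shiftRight (msk a) y) 2) 0)) (k + 1) : ℕ) = force (k * (48 / l)) fun y =>
        Bool.rec (Bool.rec R (R + 1) (Nat.beq (pcK ((msk a) % (1 <<< y))) k)) R
        (Nat.beq (((msk a) >>> y) % 2) 0) := by rw [← hR]; rfl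
      have hlt : k * d < 48 := by
        rw [hd]; exact Nat.mul_lt_mul_of_pos_right (by omega) (by
          rcases Nat.eq_zero_or_pos d with h | h; · subst h; omega
          · exact h)
      have ht := tb_msk a (ps (k * d))
      rw [show (ps (k * d)).val = k * d by simp [ps, Nat.mod_eq_of_lt hlt]] at ht
      have hmod : msk a % 2 ^ (k * d) < 2 ^ 48 := lt_of_le_of_lt (Nat.mod_le _ _) (msk_lt a)
      rw [e, force_eq, brec, brec2, hd', Nat.one_shiftLeft, pcK_eq hmod, pc_mod a hlt.le]
      have ht' : (msk a >>> (k * d)) % 2 = 0 ↔ ¬ a (ps (k * d)) ≠ 0 := by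
        rw [← ht, Nat.testBit_eq_decide_div_mod_eq, Nat.shiftRight_eq_div_pow]
        simp
      rw [hd'] at ih
      by_cases h1 : a (ps (k * d)) ≠ 0
      · rw [if_neg (fun h => ht'.1 h h1)]
        by_cases h2 : cnt a (k * d) = k
        · rw [if_pos h2, if_pos ⟨h1, h2⟩, Finset.card_insert_of_notMem (by simp), ih]
        · rw [if_neg h2, if_neg (fun h => h2 h.2), ih]
      · rw [if_pos (ht'.2 h1), if_neg (fun h => h1 h.1), ih]
  exact H l le_rfl

noncomputable def Cc (a b : Cv) (e : ℕ) : ℕ := ∑ p : Fin 48, ∑ q : Fin 48, if (a p ≠ 0 ∧ b q ≠ 0) ∧ 48 - p.val + q.val = e then 1 else 0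

theorem enc_mul (a b : Cv) : encr (msk a) * enc (msk b) = ∑ e ∈ Finset.range 100, Cc a b e * 2 ^ (80 * e) := by
  rw [enc_eq (msk_lt b), encr_eq (msk_lt a), sum_sb, sum_sb, Finset.sum_mul_sum]
  have h1 : ∀ e, Cc a b e * 2 ^ (80 * e) = ∑ p : Fin 48, ∑ q : Fin 48, (if (a p ≠ 0 ∧ b q ≠ 0) ∧ 48 - p.val + q.val = e then 1 else 0) * 2 ^ (80 * e) := by
    intro e
    generalize 2 ^ (80 * e) = y
    simp only [Cc, Finset.sum_mul]
  rw [Finset.sum_congr rfl fun e _ => h1 e, Finset.sum_comm (s := Finset.range 100)]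
  refine Finset.sum_congr rfl fun p _ => ?_
  rw [Finset.sum_comm (s := Finset.range 100)]
  refine Finset.sum_congr rfl fun q _ => ?_
  have hp := p.isLt
  have hq := q.isLt
  rw [Finset.sum_eq_single (48 - p.val + q.val)]
  · by_cases h1 : a p ≠ 0
    · by_cases h2 : b q ≠ 0
      · rw [if_pos ((tb_msk a p).2 h1), if_pos ((tb_msk b q).2 h2), if_pos ⟨⟨h1, h2⟩, rfl⟩, ← pow_add, one_mul, Nat.mul_add]
      · rw [if_neg (c := (msk b).testBit q.val = true) (fun h => h2 ((tb_msk b q).1 h)), if_neg (c := (a p ≠ 0 ∧ b q ≠ 0) ∧ 48 - p.val + q.val = 48 - p.val + q.val) (fun h => h2 h.1.2), mul_zero, zero_mul]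
    · rw [if_neg (c := (msk a).testBit p.val = true) (fun h => h1 ((tb_msk a p).1 h)), if_neg (c := (a p ≠ 0 ∧ b q ≠ 0) ∧ 48 - p.val + q.val = 48 - p.val + q.val) (fun h => h1 h.1.1), zero_mul, zero_mul]
  · intro e _ he
    rw [if_neg (fun h => he h.2.symm), zero_mul]
  · intro h; exact absurd (Finset.mem_range.2 (by omega)) h

noncomputable def ve (f : Cv) (e : ℕ) (a : Cv) : ℕ := if e < 100 then Cc a (a * f) e else
  Cc a a (e - 100) + Cc (a * f) (a * f) (e - 100)

theorem val_eq {f : Cv} (U : f * star f = 1) {l w : ℕ} (hl : 0 < l) (hd : l ∣ 48) {a : Cv} (hw : wt a = l) (hg : good l a) :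
    val l w (msk (star f)) (msk (a * f)) = ∑ e ∈ Finset.range 200, (w / Bc l a * ve f e a) * 2 ^ (80 * e) := by
  have e0 : val l w (msk (star f)) (msk (a * f)) = force (mulN (msk (a * f)) (msk (star f))) fun a' => force (bcnt l a') fun B => force (w / B) fun c =>
    force (enc a') fun ea => force (enc (msk (a * f))) fun eb => force (encr a') fun ra => force (encr (msk (a * f))) fun rb =>
    c * (ra * eb + (ra * ea + rb * eb) <<< 8000) := rfl
  rw [e0, mulN_msk, mul_assoc, U, mul_one]
  simp only [force_eq]
  rw [bcnt_eq hl hd a hw hg, enc_mul, enc_mul, enc_mul, Nat.shiftLeft_eq, show 200 = 100 + 100 by norm_num, Finset.sum_range_add,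
    ← Finset.sum_add_distrib, Finset.sum_mul, ← Finset.sum_add_distrib, Finset.mul_sum, ← Finset.sum_add_distrib]
  refine Finset.sum_congr rfl fun e he => ?_
  rw [Finset.mem_range] at he
  rw [ve, ve, if_pos he, if_neg (by omega), Nat.add_sub_cancel_left, Nat.mul_add 80, pow_add]
  generalize w / Bc l a = c
  generalize 2 ^ (80 * e) = x
  rw [show 80 * 100 = 8000 by norm_num]
  generalize 2 ^ 8000 = y
  ring
end DC

namespace DC
set_option linter.constructorNameAsVariable false

theorem digit (B : ℕ) (hB : 0 < B) (k : ℕ) : ∀ (N : ℕ) (c : ℕ → ℕ), k < N → (∀ e < N, c e < B) →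
    (∑ e ∈ Finset.range N, c e * B ^ e) / B ^ k % B = c k := by
  have dec : ∀ (N : ℕ) (c : ℕ → ℕ), ∑ e ∈ Finset.range (N + 1), c e * B ^ e = c 0 + B * ∑ e ∈ Finset.range N, c (e + 1) * B ^ e := by
    intro N c
    rw [Finset.sum_range_succ', Finset.mul_sum, pow_zero, mul_one, add_comm]
    congr 1
    refine Finset.sum_congr rfl fun e _ => ?_
    ring
  induction k with
  | zero =>
    intro N c hN hc
    obtain ⟨N, rfl⟩ : ∃ n, N = n + 1 := ⟨N - 1, by omega⟩
    rw [dec, pow_zero, Nat.div_one, Nat.add_mul_mod_self_left, Nat.mod_eq_of_lt (hc 0 hN)]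
  | succ k ih =>
    intro N c hN hc
    obtain ⟨N, rfl⟩ : ∃ n, N = n + 1 := ⟨N - 1, by omega⟩
    rw [dec, pow_succ', ← Nat.div_div_eq_div_mul, Nat.add_mul_div_left _ _ hB, Nat.div_eq_of_lt (hc 0 (by omega)), zero_add]
    exact ih N (fun e => c (e + 1)) (by omega) (fun e he => hc _ (by omega))

theorem GS_add (f : Cv) (l w : ℕ) (F G : Cv → ℕ) : GS f l w (fun a => F a + G a) = GS f l w F + GS f l w G := by
  classical
  unfold GS
  rw [← Finset.sum_add_distrib]
  refine Finset.sum_congr rfl fun a _ => ?_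
  by_cases h : Wl f l a ∧ good l a
  · rw [if_pos h, if_pos h, if_pos h, mul_add]
  · rw [if_neg h, if_neg h, if_neg h]
theorem tot_add (f : Cv) (F G : Cv → ℕ) : tot f (fun a => F a + G a) = tot f F + tot f G := by
  unfold tot
  rw [GS_add, GS_add, GS_add, GS_add]; ring

theorem card_Cv : Fintype.card Cv = 2 ^ 48 := by
  rw [Fintype.card_congr (show Cv ≃ (Fin 48 → ZMod 2) from ⟨Cv.c, fun c => ⟨c⟩, fun _ => rfl, fun _ => rfl⟩)]
  rw [Fintype.card_fun, ZMod.card, Fintype.card_fin]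

theorem GS_le (f : Cv) (l w m : ℕ) (F : Cv → ℕ) (hF : ∀ a, F a ≤ m) : GS f l w F ≤ 2 ^ 48 * (w * m) := by
  classical
  unfold GS
  rw [← card_Cv, ← Finset.card_univ, ← smul_eq_mul]
  refine Finset.sum_le_card_nsmul _ _ _ fun a _ => ?_
  by_cases h : Wl f l a ∧ good l a
  · rw [if_pos h]; exact Nat.mul_le_mul (Nat.div_le_self _ _) (hF a)
  · rw [if_neg h]; exact Nat.zero_le _

theorem Cc_le (a b : Cv) (e : ℕ) : Cc a b e ≤ 2304 := by
  unfold Cc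
  have : ∀ p : Fin 48, (∑ q : Fin 48, if (a p ≠ 0 ∧ b q ≠ 0) ∧ 48 - p.val + q.val = e then 1 else 0) ≤ 48 := by
    intro p
    refine (Finset.sum_le_card_nsmul _ _ 1 fun q _ => ?_).trans (by simp)
    split_ifs <;> norm_num
  refine (Finset.sum_le_card_nsmul _ _ 48 fun p _ => this p).trans (by simp)

theorem ve_le (f : Cv) (e : ℕ) (a : Cv) : ve f e a ≤ 4608 := by
  unfold ve
  have h1 := Cc_le a (a * f) e
  have h2 := Cc_le a a (e - 100)
  have h3 := Cc_le (a * f) (a * f) (e - 100)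
  split_ifs <;> omega

theorem tot_lt (f : Cv) (e : ℕ) : tot f (ve f e) < 2 ^ 80 := by
  have h1 := GS_le f 8 840 4608 (ve f e) (ve_le f e)
  have h2 := GS_le f 6 1680 4608 (ve f e) (ve_le f e)
  have h3 := GS_le f 4 1680 4608 (ve f e) (ve_le f e)
  have h4 := GS_le f 2 1680 4608 (ve f e) (ve_le f e)
  unfold tot
  norm_num at *
  omega

theorem Cc_cor (a b : Cv) (j : Fin 48) : Cc a b j.val + Cc a b (j.val + 48) = cor a b j := by
  unfold Cc cor
  rw [← Finset.sum_add_distrib]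
  refine Finset.sum_congr rfl fun p _ => ?_
  rw [← Finset.sum_add_distrib]
  have hp := p.isLt
  have hj := j.isLt
  have hv : (p + j).val = if p.val + j.val < 48 then p.val + j.val else p.val + j.val - 48 := by
    rw [Fin.val_add]; split_ifs <;> omega
  rw [Finset.sum_eq_single (p + j)]
  · by_cases h : a p ≠ 0 ∧ b (p + j) ≠ 0
    · rw [if_pos h]
      by_cases h3 : p.val + j.val < 48
      · rw [if_pos h3] at hv
        rw [if_neg (fun k => absurd k.2 (by omega)), if_pos ⟨h, by omega⟩]
      · rw [if_neg h3] at hv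
        rw [if_pos ⟨h, by omega⟩, if_neg (fun k => absurd k.2 (by omega))]
    · rw [if_neg (fun k => h k.1), if_neg (fun k => h k.1), if_neg h]
  · intro q _ hq
    have : q.val ≠ (p + j).val := fun h => hq (Fin.ext h)
    have hq' := q.isLt
    have k1 : ∀ A : Prop, ¬ (A ∧ 48 - p.val + q.val = j.val) := by
      rintro A ⟨_, h⟩; split_ifs at hv <;> omega
    have k2 : ∀ A : Prop, ¬ (A ∧ 48 - p.val + q.val = j.val + 48) := by
      rintro A ⟨_, h⟩; split_ifs at hv <;> omega
    rw [if_neg (k1 _), if_neg (k2 _), add_zero]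
  · intro h; exact absurd (Finset.mem_univ _) h

theorem run_GS {f : Cv} (h : P f) (l w M M' n : ℕ) (hl : l = n + 2) (hd : l ∣ 48) (hl16 : l ≤ 16) (hM : M ≤ 48) (hM' : M' ≤ M)
    (h1 : ∀ m < 48, l * m ≤ 48 * (n + 1) ↔ m < M) (h2 : ∀ m < 48, l * m ≤ 48 * n ↔ m < M') (acc : ℕ) :
    run (val l w (msk (star f))) l (msk f) M M' M' (iniL n) acc = acc + ∑ e ∈ Finset.range 200, GS f l w (ve f e) * 2 ^ (80 * e) := by
  classical
  have hl0 : 0 < l := by omega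
  rw [run_eq _ l _ M M' n hl hM hM' (msk_lt f) h1 h2, S_good h l hl0 _ hl16]
  refine congrArg (acc + ·) ?_
  simp only [GS, Finset.sum_mul]
  rw [Finset.sum_comm (s := Finset.range 200)]
  refine Finset.sum_congr rfl fun a _ => ?_
  by_cases hc : Wl f l a ∧ good l a
  · rw [if_pos hc, val_eq h.U hl0 hd hc.1.1 hc.2]
    refine Finset.sum_congr rfl fun e _ => ?_
    rw [if_pos hc]
  · rw [if_neg hc]
    refine (Finset.sum_eq_zero fun e _ => ?_).symm
    rw [if_neg hc, zero_mul]

theorem total_eq {f : Cv} (h : P f) : total (msk f) (msk (star f)) = ∑ e ∈ Finset.range 200, tot f (ve f e) * (2 ^ 80) ^ e := by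
  unfold total
  simp only [force_eq]
  rw [run_GS h 8 840 43 37 6 rfl (by norm_num) (by norm_num) (by norm_num) (by norm_num) (by omega) (by omega),
    run_GS h 6 1680 41 33 4 rfl (by norm_num) (by norm_num) (by norm_num) (by norm_num) (by omega) (by omega),
    run_GS h 4 1680 37 25 2 rfl (by norm_num) (by norm_num) (by norm_num) (by norm_num) (by omega) (by omega),
    run_GS h 2 1680 25 1 0 rfl (by norm_num) (by norm_num) (by norm_num) (by norm_num) (by omega) (by omega),
    zero_add, ← Finset.sum_add_distrib, ← Finset.sum_add_distrib, ← Finset.sum_add_distrib]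
  refine Finset.sum_congr rfl fun e _ => ?_
  rw [← pow_mul, ← add_mul, ← add_mul, ← add_mul]; rfl

theorem dg_eq {f : Cv} (h : P f) {e : ℕ} (he : e < 200) : dg (total (msk f) (msk (star f))) e = tot f (ve f e) := by
  have e0 : ∀ t, dg t e = t >>> (80 * e) % 2 ^ 80 := fun t => by
    rw [show (2:ℕ) ^ 80 = 1208925819614629174706176 by norm_num]; rfl
  rw [e0, total_eq h, Nat.shiftRight_eq_div_pow, pow_mul]
  exact digit (2 ^ 80) (by positivity) e 200 (fun e => tot f (ve f e)) he (fun e _ => tot_lt f e)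

theorem dN_N {f : Cv} (h : P f) (j : Fin 48) : dN (total (msk f) (msk (star f))) j.val = 840 * lam f (Sum.inl 0) (Sum.inr j) := by
  have hj := j.isLt
  rw [keyN h, show ∀ t, dN t j.val = dg t j.val + dg t (j.val + 48) from fun _ => rfl, dg_eq h (by omega), dg_eq h (by omega), ← tot_add]
  refine congrArg (tot f) (funext fun a => ?_)
  rw [ve, ve, if_pos (by omega), if_pos (by omega), Cc_cor]
theorem dN_A {f : Cv} (h : P f) (j : Fin 48) : dN (total (msk f) (msk (star f))) (100 + j.val) = 1680 * lam f (Sum.inl 0) (Sum.inl j) := by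
  have hj := j.isLt
  rw [keyA h, show ∀ t, dN t (100 + j.val) = dg t (100 + j.val) + dg t (100 + j.val + 48) from fun _ => rfl, dg_eq h (by omega), dg_eq h (by omega), ← tot_add]
  refine congrArg (tot f) (funext fun a => ?_)
  rw [ve, ve, if_neg (by omega), if_neg (by omega), ← Cc_cor, ← Cc_cor, show 100 + j.val - 100 = j.val by omega,
    show 100 + j.val + 48 - 100 = j.val + 48 by omega]
  ring

theorem chkJ_gen (D : ℕ → ℕ) (v w j n : ℕ) : (Nat.rec true (fun i ih => Bool.rec (Bool.rec ih false
    (Bool.rec (Nat.beq (D (Nat.add 100 i)) w) false (Nat.beq i 0))) false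
    (Bool.rec (Nat.beq (D i) v) false (Nat.beq i j))) n : Bool) = true →
     ∀ i < n, (i ≠ j → D i ≠ v) ∧ (i ≠ 0 → D (Nat.add 100 i) ≠ w) := by
    induction n with
    | zero => intro _ i hi; omega
    | succ n ih =>
      intro hn
      generalize hR : (Nat.rec true (fun i ih => Bool.rec (Bool.rec ih false
        (Bool.rec (Nat.beq (D (Nat.add 100 i)) w) false (Nat.beq i 0))) false
        (Bool.rec (Nat.beq (D i) v) false (Nat.beq i j))) n : Bool) = R at ih
      have hn' : (Bool.rec (Bool.rec R false
        (Bool.rec (Nat.beq (D (Nat.add 100 n)) w) false (Nat.beq n 0))) false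
        (Bool.rec (Nat.beq (D n) v) false (Nat.beq n j)) : Bool) = true := by
        rw [← hR]; exact hn
      have e1 : ∀ a b : ℕ, Nat.beq a b = true ↔ a = b := fun a b => Nat.beq_eq ▸ Iff.rfl
      cases hA : (Bool.rec (Nat.beq (D n) v) false (Nat.beq n j) : Bool) with
      | true => rw [hA] at hn'; exact absurd hn' (by simp)
      | false =>
        rw [hA] at hn'
        cases hB : (Bool.rec (Nat.beq (D (Nat.add 100 n)) w) false (Nat.beq n 0) : Bool) with
        | true => rw [hB] at hn'; exact absurd hn' (by simp)
        | false =>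
          rw [hB] at hn'
          intro i hi
          rcases Nat.lt_succ_iff_lt_or_eq.1 hi with hi | rfl
          · exact ih hn' i hi
          · refine ⟨fun hij he => ?_, fun hi0 he => ?_⟩
            · rw [brec2, if_neg hij, (e1 _ _).2 he] at hA; exact absurd hA (by simp)
            · rw [brec2, if_neg hi0, (e1 _ _).2 he] at hB; exact absurd hB (by simp)
theorem chkJ_spec {t j : ℕ} (h : chkJ t j = true) : ∀ i < 48, (i ≠ j → dN t i ≠ dN t j) ∧ (i ≠ 0 → dN t (100 + i) ≠ 2 * dN t j) := by
  unfold chkJ at h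
  rw [force_eq, force_eq] at h
  generalize dN t = D at h ⊢
  exact chkJ_gen D (D j) (Nat.mul 2 (D j)) j 48 h

theorem Sep_half {f : Cv} (h : P f) (j : Fin 48) (hc : chkJ (total (msk f) (msk (star f))) j.val = true) :
    ∀ q : Pt, q ≠ Sum.inl 0 → q ≠ Sum.inr j → lam f (Sum.inl 0) q ≠ lam f (Sum.inl 0) (Sum.inr j) := by
  have := chkJ_spec hc
  rintro (i | i) h1 h2 he
  · refine (this i.val i.isLt).2 (fun h0 => h1 ?_) ?_
    · rw [show i = 0 from Fin.ext h0]
    · rw [dN_A h, dN_N h, he]; ring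
  · refine (this i.val i.isLt).1 (fun h0 => h2 ?_) ?_
    · rw [Fin.ext h0]
    · rw [dN_N h, dN_N h, he]

theorem mulm47 {x : ℕ} (hx : x < 2 ^ 48) : mulm 47 x < 2 ^ 48 ∧ bv (mulm 47 x) = star (bv x) := by
  have h := mulm_spec 47 47 (by decide) hx
  refine ⟨h.1, h.2.trans ?_⟩
  rw [star_eq]
  refine cv_ext fun k => ?_
  rw [mu_ap, mu_ap]
  refine congrArg _ ?_
  show 47 * k = -k
  rw [show (47 : Fin 48) = -1 by decide, neg_one_mul]

theorem chk_concl (r : ℕ) (j j' g : Fin 48) (hr : Nat.blt r 281474976710656 = true) (hg : g * (j - j') = 1) (hc : chkC r j.val j'.val = true)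
    (h : P (bv r)) : Concl (bv r) := by
  have hr' : r < 2 ^ 48 := by
    have : r < 281474976710656 := by simpa [Nat.blt] using hr
    norm_num; exact this
  have hm : msk (star (bv r)) = mulm 47 r := by rw [← (mulm47 hr').2, msk_bv (mulm47 hr').1]
  have e : chkC r j.val j'.val = Bool.rec false (chkJ (total (msk (bv r)) (msk (star (bv r)))) j'.val) (chkJ (total (msk (bv r)) (msk (star (bv r)))) j.val) := by
    rw [hm, msk_bv hr']; unfold chkC; rw [force_eq]
  rw [e] at hc
  cases hA : chkJ (total (msk (bv r)) (msk (star (bv r)))) j.val with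
  | false => rw [hA] at hc; exact absurd hc (by simp)
  | true =>
    rw [hA] at hc
    exact aut96 h.U ⟨Sep_half h j hA, Sep_half h j' hc, fun i => ⟨i * g, by rw [mul_assoc, hg, mul_one]⟩⟩
end DC

namespace DC
set_option linter.constructorNameAsVariable false

theorem expand {T : Cv} {n : ℕ} (E : ℕ → ℕ) (rep : Fin 48 → Fin 48)
    (hE : ∀ i < n, ∀ k : Fin 48, (E i).testBit k.val = decide ((rep k).val = i)) (hr : ∀ k, (rep k).val < n)
    (hT : ∀ k, T (rep k) = T k) : T = ∑ i ∈ Finset.range n, if T (Fin.ofNat 48 i) ≠ 0 then bv (E i) else 0 := by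
  refine cv_ext fun k => ?_
  rw [cvsum_ap, Finset.sum_eq_single (rep k).val]
  · have h1 : Fin.ofNat 48 (rep k).val = rep k := Fin.ext (Nat.mod_eq_of_lt (rep k).isLt)
    rw [h1, hT k]
    by_cases h : T k ≠ 0
    · rw [if_pos h, bv_ap, hE _ (hr k) k, if_pos (by simp)]
      rcases z2 (T k) with h0 | h0
      · exact absurd h0 h
      · exact h0
    · rw [if_neg h, zero_ap]; exact not_not.1 h
  · intro i hi hne
    by_cases h : T (Fin.ofNat 48 i) ≠ 0
    · rw [if_pos h, bv_ap, hE i (Finset.mem_range.1 hi) k, if_neg]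
      simpa using fun e => hne e.symm
    · rw [if_neg h, zero_ap]
  · intro h; exact absurd (Finset.mem_range.2 (hr k)) h

theorem ofNat_sm (j : ℕ) (m : Fin 48) : Fin.ofNat 48 (j + 1) * m = Fin.ofNat 48 j * m + m := by
  refine Fin.ext ?_
  simp only [Fin.val_mul, Fin.val_add, Fin.ofNat]
  rw [Nat.mod_mul_mod, Nat.mod_mul_mod, Nat.mod_add_mod, Nat.add_one_mul]

theorem per_iter {T : Cv} {m : Fin 48} (h : shf m T = T) (k : Fin 48) (j : ℕ) : T (k - Fin.ofNat 48 j * m) = T k := by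
  induction j with
  | zero =>
    refine congrArg _ ?_
    rw [show Fin.ofNat 48 0 = 0 from rfl, Fin.zero_mul, sub_zero]
  | succ j ih =>
    rw [← ih]
    conv_rhs => rw [← h, shf_ap]
    refine congrArg _ ?_
    rw [ofNat_sm, sub_add_eq_sub_sub]

theorem ofNat_val (j : Fin 48) : Fin.ofNat 48 j.val = j := Fin.ext (Nat.mod_eq_of_lt j.isLt)

/-- level data -/
structure Lev (S S' : ℕ) (m : Fin 48) (n : ℕ) (E : ℕ → ℕ) (rep rep1 : Fin 48 → Fin 48) : Prop where
  hS : S < 2 ^ 48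
  hS' : S' < 2 ^ 48
  hE : ∀ i < n, ∀ k : Fin 48, (E i).testBit k.val = decide ((rep k).val = i)
  hr : ∀ k, (rep k).val < n
  hEl : ∀ i < n, E i < 2 ^ 48
  hp : ∀ k, ∃ j : Fin 48, rep k = k - j * m ∨ rep k = -k - j * m
  h1 : ∀ i < m.val, ∀ k : Fin 48, (rot i S).testBit k.val = decide ((rep1 k).val = i)
  h1r : ∀ k, (rep1 k).val < m.val
  h1p : ∀ k, ∃ j : Fin 48, rep1 k = k - j * m
  dec : bv S = bv S' * (1 + X m)
  sS : star (bv S) = bv S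
  sS' : star (bv S') = bv S'

theorem per_dvd {S S' m n E rep rep1} (h : Lev S S' m n E rep rep1) {T : Cv} (hT : shf m T = T) : ∃ V, T = V * bv S := by
  have h0 := expand (T := T) (fun i => rot i S) rep1 h.h1 h.h1r (fun k => by
    obtain ⟨j, hj⟩ := h.h1p k
    rw [hj]
    have := per_iter hT k j.val
    rwa [ofNat_val] at this)
  refine ⟨∑ i ∈ Finset.range m.val, if T (Fin.ofNat 48 i) ≠ 0 then X (Fin.ofNat 48 i) else 0, ?_⟩
  conv_lhs => rw [h0]
  rw [Finset.sum_mul]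
  refine Finset.sum_congr rfl fun i hi => ?_
  have hi := Finset.mem_range.1 hi
  have hi48 : i < 48 := lt_trans hi m.isLt
  have e : i = (Fin.ofNat 48 i).val := (Nat.mod_eq_of_lt hi48).symm
  by_cases hc : T (Fin.ofNat 48 i) ≠ 0
  · rw [if_pos hc, if_pos hc, X_mul]
    conv_lhs => rw [e]
    rw [bv_rot _ h.hS]
  · rw [if_neg hc, if_neg hc, zero_mul]

theorem lev_T {S S' m n E rep rep1} (h : Lev S S' m n E rep rep1) {f b : Cv} (uf : f * star f = 1) (ub : b * star b = 1)
    (hf : bv S * f = bv S * b) : ∃ e : ℕ → Prop, ∃ _ : DecidablePred e,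
     bv S' * f = bv S' * b + ∑ i ∈ Finset.range n, if e i then bv (E i) * b else 0 := by
  set w := f * star b + 1 with hw
  set T := bv S' * w with hT
  have hSw : bv S * w = 0 := by
    rw [hw, mul_add, mul_one, ← mul_assoc, hf, mul_assoc, ub, mul_one, cv_add_self]
  have hper : shf m T = T := by
    have : T * (1 + X m) = 0 := by rw [hT, mul_right_comm, ← h.dec, hSw]
    rw [mul_add, mul_one, mul_comm T, X_mul] at this
    exact (cv_eq_of_add this).symm
  have hww : w + star w + w * star w = 0 := by
    have e1 : star w = star f * b + 1 := by rw [hw, star_add, star_mul, star_star, star_one]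
    have e2 : w * star w = (f * star f) * (b * star b) + f * star b + star f * b + 1 := by rw [e1, hw]; ring
    rw [e2, e1, uf, ub, hw, show f * star b + 1 + (star f * b + 1) + (1 * 1 + f * star b + star f * b + 1) =
      (f * star b + f * star b) + (star f * b + star f * b) + ((1 + 1) + (1 + 1)) by ring]
    simp only [cv_add_self, add_zero]
  have hsym : star T = T := by
    obtain ⟨V, hV⟩ := per_dvd h hper
    have e1 : bv S' * (w * star w) = 0 := by
      rw [← mul_assoc, ← hT, hV, mul_assoc]
      have : bv S * star w = 0 := by
        rw [← h.sS, ← star_mul, hSw]; rfl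
      rw [this, mul_zero]
    have e2 : bv S' * (w + star w + w * star w) = 0 := by rw [hww, mul_zero]
    rw [mul_add, e1, add_zero, mul_add] at e2
    have e3 := cv_eq_of_add e2
    rw [hT, star_mul, h.sS', ← e3]
  have hexp := expand (T := T) E rep h.hE h.hr (fun k => by
    obtain ⟨j, hj⟩ := h.hp k
    rcases hj with hj | hj
    · rw [hj]
      have := per_iter hper k j.val
      rwa [ofNat_val] at this
    · rw [hj]
      have := per_iter hper (-k) j.val
      rw [ofNat_val] at this
      rw [this, ← star_ap, hsym])
  refine ⟨fun i => T (Fin.ofNat 48 i) ≠ 0, fun i => inferInstance, ?_⟩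
  have e4 : T * b = bv S' * f + bv S' * b := by
    rw [hT, hw, show bv S' * (f * star b + 1) * b = bv S' * f * (b * star b) + bv S' * b by ring, ub, mul_one]
  have e5 : bv S' * f = bv S' * b + T * b := by
    rw [e4, add_comm (bv S' * f), ← add_assoc, cv_add_self, zero_add]
  rw [e5]
  refine congrArg _ ?_
  conv_lhs => rw [hexp]
  rw [Finset.sum_mul]
  refine Finset.sum_congr rfl fun i _ => ?_
  by_cases hc : T (Fin.ofNat 48 i) ≠ 0
  · rw [if_pos hc, if_pos hc]
  · rw [if_neg hc, if_neg hc, zero_mul]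

def St (S b : ℕ) : Prop := ∀ f, P f → bv S * f = bv S * bv b → Concl f
def Gd (S : ℕ) (v : Cv) : Prop := ∀ f, P f → bv S * f = v → Concl f

/-- all combinations -/
noncomputable def All (Q : Cv → Prop) (Ks : List ℕ) : Cv → Prop :=
  List.rec (fun c => Q c) (fun K _ ih c => ih c ∧ ih (c + bv K)) Ks

theorem All_sum {Q : Cv → Prop} (Ks : List ℕ) : ∀ (c : Cv), All Q Ks c → ∀ (e : ℕ → Prop) [DecidablePred e],
    Q (c + ∑ i ∈ Finset.range Ks.length, if e i then bv (Ks.getD i 0) else 0) := by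
  induction Ks with
  | nil => intro c h e _; simpa using (show Q c from h)
  | cons K Ks ih =>
    intro c h e _
    have h : All Q Ks c ∧ All Q Ks (c + bv K) := h
    rw [List.length_cons, Finset.sum_range_succ']
    simp only [List.getD_cons_succ, List.getD_cons_zero]
    by_cases he : e 0
    · rw [if_pos he]
      have := ih (c + bv K) h.2 (fun i => e (i + 1))
      rwa [show c + ((∑ i ∈ Finset.range Ks.length, if e (i + 1) then bv (Ks.getD i 0) else 0) + bv K) =
       c + bv K + ∑ i ∈ Finset.range Ks.length, if e (i + 1) then bv (Ks.getD i 0) else 0 by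
        rw [add_comm _ (bv K), add_assoc]]
    · rw [if_neg he, add_zero]
      exact ih c h.1 (fun i => e (i + 1))

theorem St_of_All {S S' m n E rep rep1} (h : Lev S S' m n E rep rep1) {b : ℕ} (hb : b < 2 ^ 48) (ub : bv b * star (bv b) = 1)
    (hA : All (Gd S') ((List.range n).map fun i => mulN (E i) b) (bv S' * bv b)) : St S b := by
  intro f hf he
  obtain ⟨e, de, h1⟩ := lev_T h hf.U ub he
  have := All_sum _ _ hA e
  refine this f hf ?_
  rw [h1]
  refine congrArg _ ?_
  rw [List.length_map, List.length_range]
  refine Finset.sum_congr rfl fun i hi => ?_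
  have hi := Finset.mem_range.1 hi
  by_cases hc : e i
  · rw [if_pos hc, if_pos hc, List.getD_eq_getElem _ _ (by simpa using hi), List.getElem_map, List.getElem_range, (mulN_spec (h.hEl i hi) hb).2]
  · rw [if_neg hc, if_neg hc]
end DC

namespace DC
set_option linter.constructorNameAsVariable false

noncomputable def band (a b : Bool) : Bool := Bool.rec false b a
theorem band_eq {a b : Bool} : band a b = true ↔ a = true ∧ b = true := by
  cases a <;> cases b <;> decide
theorem beq_eq {a b : ℕ} : Nat.beq a b = true ↔ a = b := ⟨Nat.eq_of_beq_eq_true, fun h => h ▸ Nat.beq_refl a⟩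
theorem blt_eq {a : ℕ} : Nat.blt a 281474976710656 = true ↔ a < 2 ^ 48 := by
  rw [Nat.blt, Nat.ble_eq]; norm_num
theorem brt {a b c : Bool} (h : (Bool.rec a b c : Bool) = true) : (c = true ∧ b = true) ∨ (c = false ∧ a = true) := by
  cases c
  · exact Or.inr ⟨rfl, h⟩
  · exact Or.inl ⟨rfl, h⟩

noncomputable def nthK (L : List ℕ) : ℕ → (ℕ → Bool) → Bool :=
  List.rec (fun _ _ => false) (fun a _ ih i K => Nat.rec (K a) (fun j _ => ih j K) i) L
theorem nthK_spec {L : List ℕ} {K : ℕ → Bool} : ∀ {i : ℕ}, nthK L i K = true → ∃ r ∈ L, K r = true := by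
  induction L with
  | nil => intro i h; exact absurd h Bool.false_ne_true
  | cons a t ih =>
    intro i h
    cases i with
    | zero => exact ⟨a, List.mem_cons_self, h⟩
    | succ j =>
      obtain ⟨r, h1, h2⟩ := ih (i := j) h
      exact ⟨r, List.mem_cons_of_mem _ h1, h2⟩

/-- hint check -/
noncomputable def chkH (S' c k i r : ℕ) : Bool := band (Nat.blt c 281474976710656) (band (Nat.blt r 281474976710656) (
  band (Nat.beq (Nat.mod (Nat.mul k (Nat.mod (Nat.pow k 3) 48)) 48) 1)
  (band (Nat.beq (mulm k S') S') (Nat.beq (rotq (Nat.pow 2 i) (mulm k c)) (mulN S' r)))))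

theorem chkH_spec {S' c k i r : ℕ} (hS : S' < 2 ^ 48) (hk : k < 48) (hi : i < 48) (h : chkH S' c k i r = true) (hr : St S' r) :
    Gd S' (bv c) := by
  obtain ⟨h1, h⟩ := band_eq.1 h
  obtain ⟨h2, h⟩ := band_eq.1 h
  obtain ⟨h3, h⟩ := band_eq.1 h
  obtain ⟨h4, h5⟩ := band_eq.1 h
  have h1 := blt_eq.1 h1
  have h2 := blt_eq.1 h2
  have h3 := beq_eq.1 h3
  have h4 := beq_eq.1 h4
  have h5 := beq_eq.1 h5
  have hkk : (⟨k, hk⟩ : Fin 48) * ⟨k ^ 3 % 48, Nat.mod_lt _ (by norm_num)⟩ = 1 := Fin.ext h3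
  have m1 := mulm_spec ⟨k, hk⟩ _ hkk hS
  have m2 := mulm_spec ⟨k, hk⟩ _ hkk h1
  set φ := mulEq ⟨k, hk⟩ _ hkk
  have m1' : mu φ (bv S') = bv S' := m1.2.symm.trans (congrArg bv h4)
  have e5 : rotq (2 ^ i) (mulm k c) = mulN S' r := h5
  rw [rotq_eq hi.le] at e5
  have m3 : bv (rot i (mulm k c)) = shf ⟨i, hi⟩ (mu φ (bv c)) := by
    rw [← m2.2]; exact bv_rot ⟨i, hi⟩ m2.1
  intro f hf he
  have key := hr (shf ⟨i, hi⟩ (mu φ f)) (P_shf _ (P_mu _ hf)) (by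
    rw [mul_shf, ← (mulN_spec hS h2).2, ← e5, m3, ← he, mu_mul, m1'])
  exact (Concl_mu φ f).1 ((Concl_shf _ _).1 key)

/-- read a hint off the stream -/
noncomputable def hintK (S' : ℕ) (reps : List ℕ) (c h : ℕ) (K : ℕ → Bool) : Bool :=
  force (Nat.mod h 112896) fun q => band (nthK reps (Nat.div q 2304) fun r => force (Nat.mod q 48) fun k =>
    force (Nat.mod (Nat.div q 48) 48) fun i => chkH S' c k i r) (force (Nat.div h 112896) K)
theorem hintK_spec {S' : ℕ} {reps : List ℕ} {c h : ℕ} {K : ℕ → Bool} (hS : S' < 2 ^ 48) (hr : ∀ r ∈ reps, St S' r)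
    (hh : hintK S' reps c h K = true) : Gd S' (bv c) ∧ ∃ h', K h' = true := by
  unfold hintK at hh
  simp only [force_eq] at hh
  obtain ⟨h1, h2⟩ := band_eq.1 hh
  obtain ⟨r, hm, h3⟩ := nthK_spec h1
  exact ⟨chkH_spec hS (Nat.mod_lt _ (by norm_num)) (Nat.mod_lt _ (by norm_num)) h3 (hr r hm), _, h2⟩

/-- kill test -/
noncomputable def kill1 (S' c a : ℕ) : Bool :=
  force (mulN a S') fun A => force (mulN a c) fun w => (band (Nat.blt a 281474976710656) (Bool.rec (Bool.rec (Nat.ble (Nat.add (pcK A) (pcK w)) 15) true (Nat.beq w 0)) false (Nat.beq A 0)))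
noncomputable def killA (S' c : ℕ) (AL : List ℕ) : Bool := List.rec false (fun a _ ih => Bool.rec ih true (kill1 S' c a)) AL

theorem killA_spec {S' c : ℕ} (hS : S' < 2 ^ 48) (hc : c < 2 ^ 48) {AL : List ℕ} (h : killA S' c AL = true) : Gd S' (bv c) := by
  induction AL with
  | nil => exact absurd h Bool.false_ne_true
  | cons a t ih =>
    rcases brt h with ⟨h1, -⟩ | ⟨-, h1⟩
    · unfold kill1 at h1
      rw [force_eq, force_eq] at h1
      obtain ⟨h2, h1⟩ := band_eq.1 h1
      have h2 := blt_eq.1 h2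
      rcases brt h1 with ⟨-, h3⟩ | ⟨h3, h4⟩
      · exact absurd h3 Bool.false_ne_true
      have m1 := mulN_spec h2 hS
      have m2 := mulN_spec h2 hc
      have hA : bv (mulN a S') ≠ 0 := fun h0 => by
        rw [bv_inj m1.1 (by norm_num) (h0.trans bv_zero.symm)] at h3
        exact absurd h3 (by decide)
      intro f hf he
      exfalso
      have hw : bv (mulN a S') * f = bv (mulN a c) := by rw [m1.2, m2.2, mul_assoc, he]
      have hM := hf.M _ hA
      rw [hw] at hM
      rcases brt h4 with ⟨h5, -⟩ | ⟨-, h5⟩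
      · have h5 := beq_eq.1 h5
        rw [h5, bv_zero] at hw
        apply hA
        have := congrArg (· * star f) hw
        simpa [mul_assoc, hf.U] using this
      · have h5 := Nat.le_of_ble_eq_true h5
        rw [wt_bv, wt_bv] at hM
        rw [pcK_eq m1.1, pcK_eq m2.1] at h5
        have h5 : pc (mulN a S') + pc (mulN a c) ≤ 15 := h5
        have hM : 16 ≤ pc (mulN a S') + pc (mulN a c) := hM
        omega
    · exact ih h1

noncomputable def nl (d c : ℕ) : Bool := Nat.beq (Nat.mod (pcK (Nat.land (Nat.land c (Nat.shiftRight c d)) (Nat.sub (Nat.pow 2 d) 1))) 2) 1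

noncomputable def leaf (d S' : ℕ) (AL reps : List ℕ) (c h : ℕ) (K : ℕ → Bool) : Bool :=
  band (Nat.blt c 281474976710656) (Bool.rec (Bool.rec (hintK S' reps c h K) (K h) (killA S' c AL)) (K h) (nl d c))
noncomputable def go (lf : ℕ → ℕ → (ℕ → Bool) → Bool) (Ks : List ℕ) : ℕ → ℕ → (ℕ → Bool) → Bool :=
  List.rec lf (fun k _ ih c h K => ih c h fun h' => force (Nat.xor c k) fun c' => ih c' h' K) Ks

theorem leaf_spec {d S' : ℕ} {AL reps : List ℕ} {c h : ℕ} {K : ℕ → Bool} (hS : S' < 2 ^ 48) (hr : ∀ r ∈ reps, St S' r)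
    (hd : ∀ f, P f → ∀ c < 2 ^ 48, bv S' * f = bv c → nl d c = false)
    (hh : leaf d S' AL reps c h K = true) : Gd S' (bv c) ∧ ∃ h', K h' = true := by
  obtain ⟨h1, h2⟩ := band_eq.1 hh
  have hc := blt_eq.1 h1
  rcases brt h2 with ⟨h3, h4⟩ | ⟨-, h3⟩
  · refine ⟨fun f hf he => ?_, _, h4⟩
    rw [hd f hf c hc he] at h3
    exact absurd h3 Bool.false_ne_true
  · rcases brt h3 with ⟨h3, h4⟩ | ⟨-, h3⟩
    · exact ⟨killA_spec hS hc h3, _, h4⟩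
    · exact hintK_spec hS hr h3

theorem go_spec {Q : Cv → Prop} {lf : ℕ → ℕ → (ℕ → Bool) → Bool} (hl : ∀ c h K, lf c h K = true → Q (bv c) ∧ ∃ h', K h' = true)
    (Ks : List ℕ) : ∀ c h K, go lf Ks c h K = true → All Q Ks (bv c) ∧ ∃ h', K h' = true := by
  induction Ks with
  | nil => exact hl
  | cons k t ih =>
    intro c h K hh
    obtain ⟨h1, h', h2⟩ := ih c h _ hh
    rw [force_eq] at h2
    obtain ⟨h3, h4⟩ := ih _ _ _ h2
    refine ⟨⟨h1, ?_⟩, h4⟩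
    rw [← bv_xor]; exact h3

theorem nl_sum (d : ℕ) (hd : d + d ≤ 48) {c : ℕ} (hc : c < 2 ^ 48)
    (h : ∑ i ∈ Finset.range d, bv c (ps i) * bv c (ps (i + d)) = 0) : nl d c = false := by
  have hb : ∀ i, (c &&& (c >>> d) &&& (2 ^ d - 1)).testBit i = ((c.testBit i && c.testBit (d + i)) && decide (i < d)) := by
    intro i
    rw [Nat.testBit_and, Nat.testBit_and, Nat.testBit_shiftRight, Nat.testBit_two_pow_sub_one]
  have hlt : c &&& (c >>> d) &&& (2 ^ d - 1) < 2 ^ 48 := lt_of_le_of_lt Nat.and_le_left (lt_of_le_of_lt Nat.and_le_left hc)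
  have e : nl d c = Nat.beq (pc (c &&& (c >>> d) &&& (2 ^ d - 1)) % 2) 1 := by
    rw [← pcK_eq hlt]; rfl
  have hcast : ((pc (c &&& (c >>> d) &&& (2 ^ d - 1)) : ℕ) : ZMod 2) = 0 := by
    rw [← h, pc, sb, Finset.card_filter, Nat.cast_sum]
    rw [show 48 = d + (48 - d) by omega, Finset.sum_range_add]
    rw [Finset.sum_eq_zero (s := Finset.range (48 - d)), add_zero]
    · refine Finset.sum_congr rfl fun i hi => ?_
      have hi := Finset.mem_range.1 hi
      have p1 : (ps i).val = i := Nat.mod_eq_of_lt (by omega)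
      have p2 : (ps (i + d)).val = i + d := Nat.mod_eq_of_lt (by omega)
      rw [hb, bv_ap, bv_ap, p1, p2, add_comm d i]
      cases c.testBit i <;> cases c.testBit (i + d) <;> simp [hi]
    · intro i _
      rw [hb]; simp
  rw [e]
  have : pc (c &&& (c >>> d) &&& (2 ^ d - 1)) % 2 = 0 := by
    rw [ZMod.natCast_eq_zero_iff] at hcast; omega
  rw [this]; rfl

theorem ff_sum {f : Cv} (U : f * star f = 1) {t : ℕ} (ht : 0 < t) (ht' : t < 48) : ∑ i ∈ Finset.range 48, f (ps i) * f (ps (i + (48 - t))) = 0 := by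
  have h := congrArg (fun g : Cv => g (ps t)) U
  simp only [mul_ap, one_ap, star_ap] at h
  rw [if_neg (by intro h; have : t % 48 = 0 := congrArg Fin.val h; omega)] at h
  rw [← h, Finset.sum_range]
  refine Finset.sum_congr rfl fun i _ => ?_
  rw [ps_val, ps_add, ps_val, neg_sub, sub_eq_add_neg]
  have : ps (48 - t) = - ps t := by
    rw [eq_neg_iff_add_eq_zero, ← ps_add, Nat.sub_add_cancel ht'.le]; rfl
  rw [this]

theorem nl24 : ∀ f, P f → ∀ c < 2 ^ 48, bv 16777217 * f = bv c → nl 12 c = false := by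
  intro f hf c hc he
  refine nl_sum 12 (by norm_num) hc ?_
  have h0 := ff_sum hf.U (t := 36) (by norm_num) (by norm_num)
  have hS : bv 16777217 = 1 + X 24 := by
    rw [← bv_one, show X 24 = bv (2 ^ 24) from (bv_two_pow 24).symm, ← bv_xor]
    exact congrArg bv (by decide +kernel)
  have hv : ∀ i, bv c (ps i) = f (ps i) + f (ps (i + 24)) := by
    intro i
    rw [← he, hS, add_mul, one_mul, X_mul, add_ap, shf_ap, ps_add]
    refine congrArg₂ _ rfl (congrArg _ ?_)
    rw [sub_eq_add_neg]; rfl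
  rw [show (48 : ℕ) = 12 + (12 + (12 + 12)) by norm_num] at h0
  simp only [Finset.sum_range_add] at h0
  rw [← Finset.sum_add_distrib, ← Finset.sum_add_distrib, ← Finset.sum_add_distrib] at h0
  rw [← h0]
  refine Finset.sum_congr rfl fun i _ => ?_
  rw [hv, hv]
  simp only [Nat.reduceAdd, Nat.reduceSub, ← add_assoc, add_comm _ i]
  simp only [add_assoc, Nat.reduceAdd]
  rw [ps_48]
  ring

theorem nl12 : ∀ f, P f → ∀ c < 2 ^ 48, bv 68736258049 * f = bv c → nl 6 c = false := by
  intro f hf c hc he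
  refine nl_sum 6 (by norm_num) hc ?_
  have h0 := ff_sum hf.U (t := 42) (by norm_num) (by norm_num)
  have h1 := ff_sum hf.U (t := 30) (by norm_num) (by norm_num)
  have h0 : _ + _ = (0 : ZMod 2) + 0 := congrArg₂ (· + ·) h0 h1
  rw [← Finset.sum_add_distrib, add_zero] at h0
  have hS : bv 68736258049 = 1 + X 12 + X 24 + X 36 := by
    rw [← bv_one, show X 24 = bv (2 ^ 24) from (bv_two_pow 24).symm, show X 12 = bv (2 ^ 12) from (bv_two_pow 12).symm, show X 36 = bv (2 ^ 36) from (bv_two_pow 36).symm, ← bv_xor, ← bv_xor, ← bv_xor]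
    exact congrArg bv (by decide +kernel)
  have hv : ∀ i, bv c (ps i) = f (ps i) + f (ps (i + 36)) + f (ps (i + 24)) + f (ps (i + 12)) := by
    intro i
    rw [← he, hS, add_mul, add_mul, add_mul, one_mul, X_mul, X_mul, X_mul, add_ap, add_ap, add_ap, shf_ap, shf_ap, shf_ap, ps_add, ps_add, ps_add, sub_eq_add_neg, sub_eq_add_neg, sub_eq_add_neg]
    rfl
  rw [show (48 : ℕ) = 6 + (6 + (6 + (6 + (6 + (6 + (6 + 6)))))) by norm_num] at h0
  simp only [Finset.sum_range_add] at h0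
  simp only [← Finset.sum_add_distrib] at h0
  rw [← h0]
  refine Finset.sum_congr rfl fun i _ => ?_
  rw [hv, hv]
  simp only [Nat.reduceAdd, Nat.reduceSub, ← add_assoc, add_comm _ i]
  simp only [add_assoc, Nat.reduceAdd]
  rw [ps_48, show ps (i + 54) = ps (i + 6) from ps_48 (i + 6), show ps (i + 60) = ps (i + 12) from ps_48 (i + 12)]
  ring
end DC

namespace DC
set_option linter.constructorNameAsVariable false

def Em (m S i : ℕ) : ℕ := Nat.lor (rotq (Nat.pow 2 i) S) (rotq (Nat.pow 2 (Nat.sub m i)) S)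
def rp (m : ℕ) (k : Fin 48) : Fin 48 := Fin.ofNat 48 (min (k.val % m) (m - k.val % m))
def rp1 (m : ℕ) (k : Fin 48) : Fin 48 := Fin.ofNat 48 (k.val % m)
def LevC (S S' : ℕ) (m : Fin 48) (n : ℕ) : Prop :=
  (S < 2 ^ 48 ∧ S' < 2 ^ 48) ∧ (∀ i < n, ∀ k : Fin 48, (Em m.val S i).testBit k.val = decide ((rp m.val k).val = i)) ∧
  (∀ k, (rp m.val k).val < n) ∧ (∀ i < n, Em m.val S i < 2 ^ 48) ∧
  (∀ k, ∃ j : Fin 48, rp m.val k = k - j * m ∨ rp m.val k = -k - j * m) ∧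
  (∀ i < m.val, ∀ k : Fin 48, (rot i S).testBit k.val = decide ((rp1 m.val k).val = i)) ∧
  (∀ k, (rp1 m.val k).val < m.val) ∧ (∀ k, ∃ j : Fin 48, rp1 m.val k = k - j * m)
theorem Lev_of {S S' : ℕ} {m : Fin 48} {n : ℕ} (h : LevC S S' m n)
    (h2 : band (Nat.beq (Nat.xor S' (rotq (Nat.pow 2 m.val) S')) S) (band (Nat.beq (mulm 47 S) S) (Nat.beq (mulm 47 S') S')) = true) :
    Lev S S' m n (Em m.val S) (rp m.val) (rp1 m.val) := by
  obtain ⟨⟨a1, a2⟩, a3, a4, a5, a6, a7, a8, a9⟩ := h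
  obtain ⟨b1, b2⟩ := band_eq.1 h2
  obtain ⟨b2, b3⟩ := band_eq.1 b2
  refine ⟨a1, a2, a3, a4, a5, a6, a7, a8, a9, ?_, ?_, ?_⟩
  · have b1 := beq_eq.1 b1
    have e : bv S = bv (S' ^^^ rotq (2 ^ m.val) S') := congrArg bv b1.symm
    rw [e, bv_xor, rotq_eq m.isLt.le, bv_rot m a2, mul_add, mul_one, mul_comm _ (X m), X_mul]
  · rw [← (mulm47 a1).2]; exact congrArg bv (beq_eq.1 b2)
  · rw [← (mulm47 a2).2]; exact congrArg bv (beq_eq.1 b3)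

instance {S S' m n} : Decidable (LevC S S' m n) := by unfold LevC; infer_instance

set_option maxRecDepth 100000 in
theorem lev3 : Lev 40210710958665 4467856773185 3 2 (Em 3 40210710958665) (rp 3) (rp1 3) := Lev_of (by decide +kernel) (by decide +kernel)
set_option maxRecDepth 100000 in
theorem lev6 : Lev 4467856773185 68736258049 6 4 (Em 6 4467856773185) (rp 6) (rp1 6) := Lev_of (by decide +kernel) (by decide +kernel)
set_option maxRecDepth 100000 in
theorem lev12 : Lev 68736258049 16777217 12 7 (Em 12 68736258049) (rp 12) (rp1 12) := Lev_of (by decide +kernel) (by decide +kernel)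
set_option maxRecDepth 100000 in
theorem lev24 : Lev 16777217 1 24 13 (Em 24 16777217) (rp 24) (rp1 24) := Lev_of (by decide +kernel) (by decide +kernel)

noncomputable def genK (g : ℕ → ℕ) (n : ℕ) : List ℕ → (List ℕ → Bool) → Bool := Nat.rec (fun acc K => K acc)
  (fun i ih acc K => force (g i) fun x => ih (x :: acc) K) n
theorem genK_spec (g : ℕ → ℕ) (K : List ℕ → Bool) (n : ℕ) : ∀ acc, genK g n acc K = K ((List.range n).map g ++ acc) := by
  induction n with
  | zero => intro acc; rfl
  | succ i ih =>
    intro acc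
    have : genK g (i + 1) acc K = force (g i) fun x => genK g i (x :: acc) K := rfl
    rw [this, force_eq, ih, List.range_succ, List.map_append, List.append_assoc]; rfl

noncomputable def unit (b : ℕ) : Bool := band (Nat.blt b 281474976710656) (Nat.beq (mulN b (mulm 47 b)) 1)
theorem unit_spec {b : ℕ} (h : unit b = true) : b < 2 ^ 48 ∧ bv b * star (bv b) = 1 := by
  obtain ⟨h1, h2⟩ := band_eq.1 h
  have h1 := blt_eq.1 h1
  refine ⟨h1, ?_⟩
  rw [← (mulm47 h1).2, ← (mulN_spec h1 (mulm47 h1).1).2, beq_eq.1 h2, bv_one]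

noncomputable def stage (d S S' m n : ℕ) (AL reps : List ℕ) (b h : ℕ) : Bool := band (unit b)
  (genK (fun i => mulN (Em m S i) b) n [] fun Ks => force (mulN S' b) fun c => go (leaf d S' AL reps) Ks c h fun _ => true)

theorem stage_spec {d S S' n : ℕ} {m : Fin 48} (hL : Lev S S' m n (Em m.val S) (rp m.val) (rp1 m.val)) {AL reps : List ℕ} {b h : ℕ}
    (hd : ∀ f, P f → ∀ c < 2 ^ 48, bv S' * f = bv c → nl d c = false) (hr : ∀ r ∈ reps, St S' r)
    (hh : stage d S S' m.val n AL reps b h = true) : St S b := by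
  obtain ⟨h1, h2⟩ := band_eq.1 hh
  obtain ⟨u1, u2⟩ := unit_spec h1
  rw [genK_spec, force_eq, List.append_nil] at h2
  have := (go_spec (Q := Gd S') (fun c h K hh => leaf_spec hL.hS' hr hd hh) _ _ _ _ h2).1
  rw [(mulN_spec hL.hS' u1).2] at this
  exact St_of_All hL u1 u2 this

theorem nl0 (S' : ℕ) : ∀ f, P f → ∀ c < 2 ^ 48, bv S' * f = bv c → nl 0 c = false :=
  fun _ _ _ hc _ => nl_sum 0 (by norm_num) hc rfl

theorem start_spec {AL : List ℕ} {h : ℕ} (hs : St 40210710958665 1)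
    (hh : go (leaf 0 40210710958665 AL [1]) [40210710958665, rotq 2 40210710958665, rotq 4 40210710958665] 0 h (fun _ => true) = true) (f : Cv) (hf : P f) : Concl f := by
  have hA := (go_spec (Q := Gd 40210710958665) (fun c h K hh => leaf_spec lev3.hS (by simpa using hs) (nl0 _) hh) _ _ _ _ hh).1
  have hper : shf 3 (bv 40210710958665 * f) = bv 40210710958665 * f := by
    rw [← shf_mul, ← bv_rot 3 lev3.hS]
    refine congrArg (· * f) (congrArg bv ?_)
    show rot 3 40210710958665 = 40210710958665
    decide +kernel
  have hx := expand (T := bv 40210710958665 * f) (fun i => rot i 40210710958665) (rp1 3) lev3.h1 lev3.h1r (fun k => by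
    obtain ⟨j, hj⟩ := lev3.h1p k
    rw [hj]
    have := per_iter hper k j.val
    rwa [ofNat_val] at this)
  have := All_sum _ _ hA (fun i => (bv 40210710958665 * f) (Fin.ofNat 48 i) ≠ 0)
  refine this f hf ?_
  rw [bv_zero, zero_add]
  conv_lhs => rw [hx]
  refine Finset.sum_congr rfl fun i hi => ?_
  have hi : i < 3 := Finset.mem_range.1 hi
  refine congrArg (fun z => ite _ (bv z) 0) ?_
  interval_cases i <;> decide +kernel
end DC

namespace DC
set_option linter.constructorNameAsVariable false

/-- packed span of a base and generators -/
noncomputable def bld (b : ℕ) (Ks : List ℕ) : (ℕ → ℕ → Bool) → Bool := List.rec (fun K => K b 1) (fun k _ ih K => ih fun C n =>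
  lazy (Nat.add C (Nat.shiftLeft (Nat.xor C (Nat.mul k (rep n))) (Nat.mul 48 n))) fun C' => force (Nat.add n n) fun n' => K C' n') Ks

noncomputable def em (fg : ℕ → ℕ → ℕ) (d J : ℕ) (K : ℕ → Bool) (st : List (ℕ × ℕ × ℕ)) : Bool :=
  List.rec (K J) (fun e _ _ => Bool.rec (K J) (force (Nat.lor J (fg (Nat.sub 15 e.2.1) e.2.2)) K) (Nat.ble d e.1)) st
noncomputable def pop (d : ℕ) (K : ℕ → ℕ → List (ℕ × ℕ × ℕ) → Bool) (st : List (ℕ × ℕ × ℕ)) : Bool :=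
  List.rec false (fun e t ih => Bool.rec ih (K e.2.1 e.2.2 (e :: t)) (Nat.ble (Nat.succ e.1) d)) st
noncomputable def mach (fg : ℕ → ℕ → ℕ) (rt : ℕ → ℕ) (fuel : ℕ) : ℕ → List (ℕ × ℕ × ℕ) → ℕ → (ℕ → Bool) → Bool :=
  Nat.rec (fun _ _ J K => K J) (fun _ ih N st J K => Bool.rec
    (force (Nat.mod N 48) fun d => force (Nat.div N 48) fun N' => em fg d J (fun J' =>
      pop d (fun w Y rest => force (Nat.succ w) fun w' => lazy (Nat.xor Y (rt d)) fun Y' => ih N' ((d, w', Y') :: rest) J' K) st) st)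
    (K J) (Nat.beq N 0)) fuel

noncomputable def hintL (reps : List ℕ) (L : List ℕ) : ℕ → Bool :=
  List.rec (fun _ => true) (fun x _ ih h => hintK 1 reps x h ih) L

noncomputable def fin (reps : List ℕ) (C R h J : ℕ) : Bool :=
  lazy (Nat.xor J (Nat.mul 140737488355328 R)) fun J' => dec 12 J' C [] fun L => hintL reps L h

noncomputable def block (reps : List ℕ) (b N h : ℕ) : Bool := band (unit b)
  (genK (fun i => mulN (Em 24 16777217 (Nat.succ i)) b) 12 [] fun Ks => genK (fun i => mulm 25 (mulN (Em 24 16777217 (Nat.succ i)) b)) 12 [] fun Ks' =>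
   bld b Ks fun C n => force (mulm 25 b) fun b' => bld b' Ks' fun C' _ => lazy (rep n) fun R =>
   lazy (Nat.mul 0x555555555555 R) fun m1 => lazy (Nat.mul 0x333333333333 R) fun m2 => lazy (Nat.mul 0x0f0f0f0f0f0f R) fun m4 =>
   force (Nat.lor (Nat.mul (topm m1 m2 m4 R 0 2 C) 64) (flag m1 m2 m4 R 14 C)) fun J =>
   mach (flag m1 m2 m4 R) (fun d => rotp R d C) 2000 N [(0, 1, C)] J fun J =>
   mach (flag m1 m2 m4 R) (fun d => rotp R d C') 2000 N [(0, 1, C')] J fun J => fin reps C R h J)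
end DC

namespace DC
set_option linter.constructorNameAsVariable false

theorem pk_xor2 (g h : ℕ → ℕ) (L : List ℕ) (hg : ∀ x ∈ L, g x < 2 ^ 48) (hh : ∀ x ∈ L, h x < 2 ^ 48) :
    pk (L.map g) ^^^ pk (L.map h) = pk (L.map fun x => g x ^^^ h x) := by
  induction L with
  | nil => simp [pk]
  | cons a t ih =>
    rw [List.map_cons, List.map_cons, List.map_cons, pk, pk, pk, xor_cons _ _ (hg a List.mem_cons_self) (hh a List.mem_cons_self),
      ih (fun x hx => hg x (List.mem_cons_of_mem _ hx)) (fun x hx => hh x (List.mem_cons_of_mem _ hx))]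
theorem pk_lor2 (g h : ℕ → ℕ) (L : List ℕ) (hg : ∀ x ∈ L, g x < 2 ^ 48) (hh : ∀ x ∈ L, h x < 2 ^ 48) :
    pk (L.map g) ||| pk (L.map h) = pk (L.map fun x => g x ||| h x) := by
  induction L with
  | nil => simp [pk]
  | cons a t ih =>
    rw [List.map_cons, List.map_cons, List.map_cons, pk, pk, pk, lor_cons _ _ (hg a List.mem_cons_self) (hh a List.mem_cons_self),
      ih (fun x hx => hg x (List.mem_cons_of_mem _ hx)) (fun x hx => hh x (List.mem_cons_of_mem _ hx))]
theorem pk_mul (g : ℕ → ℕ) (c : ℕ) (L : List ℕ) : pk (L.map g) * c = pk (L.map fun x => g x * c) := by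
  induction L with
  | nil => simp [pk]
  | cons a t ih => rw [List.map_cons, List.map_cons, pk, pk, add_mul, mul_assoc, ih]
theorem pk_rep (m : ℕ) (L : List ℕ) : m * rep L.length = pk (L.map fun _ => m) := by
  induction L with
  | nil => simp [pk, rep_zero]
  | cons a t ih => rw [List.length_cons, mul_rep, List.map_cons, pk, ih]

/-- flag value -/
def fv (b : Bool) : ℕ := if b then 140737488355328 else 0
theorem fv_lt (b : Bool) : fv b < 2 ^ 48 := by cases b <;> decide
theorem fv_or (a b : Bool) : fv a ||| fv b = fv (a || b) := by cases a <;> cases b <;> decide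
theorem fv_not (a : Bool) : fv a ^^^ 140737488355328 = fv (!a) := by cases a <;> decide
theorem fv_ne (a : Bool) : fv a ≠ 0 ↔ a = true := by cases a <;> decide
theorem fv_two (n : ℕ) : ((n + 0) &&& 2) * 0x10000000000 * 64 = fv (decide (n &&& 2 ≠ 0)) := by
  have h : n &&& 2 = 0 ∨ n &&& 2 = 2 := by
    have h1 : (n &&& 2) = (n % 4) &&& 2 := by
      rw [show (4 : ℕ) = 2 ^ 2 by norm_num, ← Nat.and_two_pow_sub_one_eq_mod, Nat.and_assoc]
      rfl
    rw [h1]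
    have h2 : n % 4 < 4 := Nat.mod_lt _ (by norm_num)
    revert h2
    generalize n % 4 = m
    intro h2
    interval_cases m <;> decide
  rw [add_zero]
  rcases h with h | h <;> rw [h] <;> decide
theorem and_two (n : ℕ) (h : n % 4 = 1) : n &&& 2 = 0 := by
    have h1 : (n &&& 2) = (n % 4) &&& 2 := by
      rw [show (4 : ℕ) = 2 ^ 2 by norm_num, ← Nat.and_two_pow_sub_one_eq_mod, Nat.and_assoc]
      rfl
    rw [h1, h]; rfl

/-- sound kill flags -/
def JI (L : List ℕ) (J : ℕ) : Prop := ∃ q : ℕ → Bool, J = pk (L.map fun x => fv (q x)) ∧ ∀ x ∈ L, q x = true → ¬ P (bv x)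
theorem JI_or {L : List ℕ} {J J' : ℕ} (h : JI L J) (h' : JI L J') : JI L (J ||| J') := by
  obtain ⟨q, rfl, h1⟩ := h
  obtain ⟨q', rfl, h2⟩ := h'
  refine ⟨fun x => q x || q' x, ?_, fun x hx hq => ?_⟩
  · rw [pk_lor2 _ _ _ (fun x _ => fv_lt _) (fun x _ => fv_lt _)]; simp only [fv_or]
  · rcases Bool.or_eq_true_iff.1 hq with hq | hq
    · exact h1 x hx hq
    · exact h2 x hx hq

theorem wt_add1 (A : Cv) (d : Fin 48) : wt (A + X d) ≤ wt A + 1 := by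
  rw [wt_def, wt_def, ← Finset.card_singleton d]
  refine (Finset.card_le_card ?_).trans (Finset.card_union_le _ _)
  intro i hi
  rw [Finset.mem_filter] at hi
  by_cases h : i = d
  · exact Finset.mem_union_right _ (Finset.mem_singleton.2 h)
  · refine Finset.mem_union_left _ (Finset.mem_filter.2 ⟨Finset.mem_univ _, ?_⟩)
    have := hi.2
    rwa [add_ap, X_ap, if_neg h, add_zero] at this
theorem msk_add (a b : Cv) : msk a ^^^ msk b = msk (a + b) :=
  bv_inj (Nat.xor_lt_two_pow (msk_lt _) (msk_lt _)) (msk_lt _) (by rw [bv_xor, bv_msk, bv_msk, bv_msk])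
theorem wt_eq_zero {a : Cv} (h : wt a = 0) : a = 0 := cv_ext fun i => by
  rw [wt_def, Finset.card_eq_zero, Finset.filter_eq_empty_iff] at h
  exact not_not.1 (h (Finset.mem_univ i))

/-- stack invariant -/
def SI (L : List ℕ) (F : ℕ → Cv) (e : ℕ × ℕ × ℕ) : Prop := ∃ A : Cv, ∃ hp : e.1 < 48, A ⟨e.1, hp⟩ ≠ 0 ∧
  (∀ q : Fin 48, e.1 < q.val → A q = 0) ∧ wt A ≤ e.2.1 ∧ e.2.2 = pk (L.map fun x => msk (A * F x))

/-- assumptions on the environment -/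
structure Env (L : List ℕ) (F : ℕ → Cv) (fg : ℕ → ℕ → ℕ) (rt : ℕ → ℕ) : Prop where
  hF : ∀ x ∈ L, P (bv x) → P (F x)
  hg : ∀ thr ≤ 127, ∀ A : Cv, fg thr (pk (L.map fun x => msk (A * F x))) = pk (L.map fun x => fv (decide (wt (A * F x) ≤ thr)))
  hr : ∀ d : Fin 48, rt d.val = pk (L.map fun x => msk (X d * F x))

theorem kill_ok {f A : Cv} {w : ℕ} (hf : P f) (hA : A ≠ 0) (hw : wt A ≤ w) (h : wt (A * f) ≤ 15 - w) : False := by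
  by_cases h15 : w ≤ 15
  · have := hf.M A hA; omega
  · have h0 : wt (A * f) = 0 := by omega
    have h1 := wt_eq_zero h0
    apply hA
    rw [← mul_one A, ← hf.U, ← mul_assoc, h1, zero_mul]

variable {L : List ℕ} {F : ℕ → Cv} {fg : ℕ → ℕ → ℕ} {rt : ℕ → ℕ}

theorem em_spec (E : Env L F fg rt) {d J : ℕ} {K : ℕ → Bool} {st : List (ℕ × ℕ × ℕ)} (hJ : JI L J) (hs : ∀ e ∈ st, SI L F e)
    (h : em fg d J K st = true) : ∃ J', JI L J' ∧ K J' = true := by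
  cases st with
  | nil => exact ⟨J, hJ, h⟩
  | cons e t =>
    rcases brt h with ⟨_, h⟩ | ⟨_, h⟩
    · rw [force_eq] at h
      refine ⟨_, JI_or hJ ?_, h⟩
      obtain ⟨A, hp, h1, h2, h3, h4⟩ := hs e List.mem_cons_self
      refine ⟨fun x => decide (wt (A * F x) ≤ 15 - e.2.1), ?_, ?_⟩
      · have e1 : Nat.sub 15 e.2.1 = 15 - e.2.1 := rfl
        rw [e1, h4, E.hg _ (by omega)]
      · intro x hx hq hP
        exact kill_ok (E.hF x hx hP) (fun h0 => h1 (by rw [h0, zero_ap])) h3 (of_decide_eq_true hq)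
    · exact ⟨J, hJ, h⟩

theorem pop_spec {d : ℕ} {K : ℕ → ℕ → List (ℕ × ℕ × ℕ) → Bool} {st : List (ℕ × ℕ × ℕ)} (hs : ∀ e ∈ st, SI L F e)
    (h : pop d K st = true) : ∃ p w Y rest, SI L F (p, w, Y) ∧ p < d ∧ (∀ e ∈ rest, SI L F e) ∧ K w Y rest = true := by
  induction st with
  | nil => exact absurd h Bool.false_ne_true
  | cons e t ih =>
    rcases brt h with ⟨h1, h⟩ | ⟨_, h⟩
    · exact ⟨e.1, e.2.1, e.2.2, e :: t, hs e List.mem_cons_self, Nat.le_of_ble_eq_true h1, hs, h⟩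
    · exact ih (fun e he => hs e (List.mem_cons_of_mem _ he)) h

theorem mach_spec (E : Env L F fg rt) {K : ℕ → Bool} (fuel : ℕ) : ∀ {N J : ℕ} {st : List (ℕ × ℕ × ℕ)}, JI L J → (∀ e ∈ st, SI L F e) →
    mach fg rt fuel N st J K = true → ∃ J', JI L J' ∧ K J' = true := by
  induction fuel with
  | zero => intro N J st hJ _ h; exact ⟨J, hJ, h⟩
  | succ n ih =>
    intro N J st hJ hs h
    rcases brt h with ⟨_, h⟩ | ⟨_, h⟩
    · exact ⟨J, hJ, h⟩
    · rw [force_eq, force_eq] at h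
      obtain ⟨J', hJ', h⟩ := em_spec E hJ hs h
      obtain ⟨p, w, Y, rest, ⟨A, hp, h1, h2, h3, h4⟩, hd, hrest, h⟩ := pop_spec hs h
      rw [force_eq, lazy_eq] at h
      refine ih hJ' ?_ h
      have hd48 : N % 48 < 48 := Nat.mod_lt _ (by norm_num)
      intro e he
      rcases List.mem_cons.1 he with rfl | he
      · refine ⟨A + X ⟨N % 48, hd48⟩, hd48, ?_, ?_, ?_, ?_⟩
        · have e0 : A ⟨N % 48, hd48⟩ = 0 := h2 _ hd
          change (A + X ⟨N % 48, hd48⟩) ⟨N % 48, hd48⟩ ≠ 0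
          rw [add_ap, e0, X_ap, if_pos rfl, zero_add]; exact one_ne_zero
        · intro q hq
          have hq : N % 48 < q.val := hq
          have e0 : A q = 0 := h2 _ (lt_trans hd hq)
          rw [add_ap, e0, X_ap, if_neg (fun hh => by rw [hh] at hq; exact lt_irrefl _ hq), add_zero]
        · exact (wt_add1 _ _).trans (Nat.succ_le_succ h3)
        · have h4 : Y = pk (L.map fun x => msk (A * F x)) := h4
          change Nat.xor Y (rt (N % 48)) = _
          have e1 := E.hr ⟨N % 48, hd48⟩
          have e1 : rt (N % 48) = pk (L.map fun x => msk (X ⟨N % 48, hd48⟩ * F x)) := e1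
          rw [e1, h4]
          refine (pk_xor2 _ _ _ (fun x _ => msk_lt _) (fun x _ => msk_lt _)).trans ?_
          simp only [msk_add, add_mul]
      · exact hrest e he

theorem hintL_spec {reps : List ℕ} (hr : ∀ r ∈ reps, St 1 r) (M : List ℕ) : ∀ h, hintL reps M h = true → ∀ x ∈ M, Gd 1 (bv x) := by
  induction M with
  | nil => intro h _ x hx; exact absurd hx List.not_mem_nil
  | cons a t ih =>
    intro h hh
    have hh : hintK 1 reps a h (hintL reps t) = true := hh
    obtain ⟨h1, h', h2⟩ := hintK_spec (by norm_num) hr hh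
    intro x hx
    rcases List.mem_cons.1 hx with rfl | hx
    · exact h1
    · exact ih h' h2 x hx

theorem fin_spec {reps : List ℕ} (hr : ∀ r ∈ reps, St 1 r) (hL : Bd L) (hl : L.length ≤ 2 ^ 12) {h J : ℕ} (hJ : JI L J)
    (hh : fin reps (pk L) (rep L.length) h J = true) : ∀ x ∈ L, Gd 1 (bv x) := by
  obtain ⟨q, rfl, hq⟩ := hJ
  unfold fin at hh
  rw [lazy_eq] at hh
  have e : Nat.xor (pk (L.map fun x => fv (q x))) (Nat.mul 140737488355328 (rep L.length)) = pk (L.map fun x => fv (!q x)) := by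
    have e1 : Nat.mul 140737488355328 (rep L.length) = pk (L.map fun _ => 140737488355328) := pk_rep _ _
    rw [e1]
    exact (pk_xor2 (fun x => fv (q x)) (fun _ => 140737488355328) L (fun x _ => fv_lt _) (fun x _ => fv_lt true)).trans
      (congrArg pk (List.map_congr_left fun x _ => fv_not (q x)))
  rw [e, dec_spec (fun x => fv (!q x)) 12 L hL (by
    intro y hy
    obtain ⟨x, _, rfl⟩ := List.mem_map.1 hy
    exact fv_lt _) hl, List.append_nil] at hh
  have hs := hintL_spec hr _ _ hh
  intro x hx
  by_cases hk : q x = true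
  · intro f hf he
    rw [bv_one, one_mul] at he
    exact absurd (he ▸ hf) (hq x hx hk)
  · refine hs x (List.mem_reverse.2 (List.mem_filter.2 ⟨hx, ?_⟩))
    rw [Bool.not_eq_true] at hk
    rw [hk]; rfl

/-- the span as a list -/
def Lst (b : ℕ) : List ℕ → List ℕ
  | [] => [b]
  | k :: Ks => Lst b Ks ++ (Lst b Ks).map (· ^^^ k)
theorem Lst_bd {b : ℕ} (hb : b < 2 ^ 48) {Ks : List ℕ} (h : Bd Ks) : Bd (Lst b Ks) := by
  induction Ks with
  | nil => intro x hx; rw [Lst, List.mem_singleton] at hx; rwa [hx]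
  | cons k t ih =>
    intro x hx
    rw [Lst, List.mem_append] at hx
    rcases hx with hx | hx
    · exact ih (bd_tail h).2 x hx
    · exact bd_xrow (bd_tail h).1 (ih (bd_tail h).2) x hx
theorem Lst_len (b : ℕ) (Ks : List ℕ) : (Lst b Ks).length = 2 ^ Ks.length := by
  induction Ks with
  | nil => rfl
  | cons k t ih => rw [Lst, List.length_append, List.length_map, ih, List.length_cons, pow_succ, mul_two]
theorem bld_spec {b : ℕ} (hb : b < 2 ^ 48) (Ks : List ℕ) : ∀ (_ : Bd Ks) (K : ℕ → ℕ → Bool), bld b Ks K = K (pk (Lst b Ks)) (Lst b Ks).length := by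
  induction Ks with
  | nil =>
    intro _ K
    have e : pk (Lst b []) = b := by rw [Lst, pk, pk, mul_zero, add_zero]
    rw [e]; rfl
  | cons k t ih =>
    intro h K
    obtain ⟨hk, ht⟩ := bd_tail h
    refine (ih ht _).trans ?_
    rw [lazy_eq, force_eq]
    have hB := Lst_bd hb ht
    have e1 : Nat.xor (pk (Lst b t)) (Nat.mul k (rep (Lst b t).length)) = pk ((Lst b t).map (· ^^^ k)) := pk_xrow hk hB
    rw [e1, Lst, pk_append, List.length_append, List.length_map]
    have e2 : ∀ a c : ℕ, Nat.shiftLeft a c = 2 ^ c * a := fun a c => (Nat.shiftLeft_eq a c).trans (mul_comm _ _)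
    rw [e2]; rfl
theorem All_Lst {Q : Cv → Prop} {b : ℕ} (Ks : List ℕ) : ∀ c : Cv, (∀ x ∈ Lst b Ks, Q (c + bv x)) → All Q Ks (c + bv b) := by
  induction Ks with
  | nil => intro c h; exact h b (by rw [Lst]; exact List.mem_singleton_self b)
  | cons k t ih =>
    intro c h
    refine ⟨ih c fun x hx => h x (by rw [Lst]; exact List.mem_append_left _ hx), ?_⟩
    rw [show c + bv b + bv k = c + bv k + bv b by rw [add_assoc, add_comm (bv b), add_assoc]]
    refine ih _ fun x hx => ?_
    rw [show c + bv k + bv x = c + bv (x ^^^ k) by rw [bv_xor, add_assoc, add_comm (bv k)]]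
    exact h _ (by rw [Lst]; exact List.mem_append_right _ (List.mem_map_of_mem hx))
theorem Lst_map {g : ℕ → ℕ} {b : ℕ} (Ks : List ℕ) (hg : ∀ x y, x < 2 ^ 48 → y < 2 ^ 48 → g (x ^^^ y) = g x ^^^ g y) (hb : b < 2 ^ 48) (h : Bd Ks) :
    Lst (g b) (Ks.map g) = (Lst b Ks).map g := by
  induction Ks with
  | nil => rfl
  | cons k t ih =>
    obtain ⟨hk, ht⟩ := bd_tail h
    rw [List.map_cons, Lst, Lst, ih ht, List.map_append, List.map_map, List.map_map]
    congr 1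
    refine List.map_congr_left fun x hx => ?_
    exact (hg x k (Lst_bd hb ht x hx) hk).symm
end DC

namespace DC
set_option linter.constructorNameAsVariable false

theorem flag_env (L : List ℕ) (F : ℕ → Cv) (thr : ℕ) (ht : thr ≤ 127) (A : Cv) :
    flag (0x555555555555 * rep L.length) (0x333333333333 * rep L.length) (0x0f0f0f0f0f0f * rep L.length) (rep L.length) thr
      (pk (L.map fun x => msk (A * F x))) = pk (L.map fun x => fv (decide (wt (A * F x) ≤ thr))) := by
  have := flag_spec L.length thr ht (L.map fun x => msk (A * F x)) (by
    intro y hy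
    obtain ⟨x, _, rfl⟩ := List.mem_map.1 hy
    exact msk_lt _) (by rw [List.length_map])
  rw [List.length_map] at this
  rw [this, List.map_map]
  refine congrArg pk (List.map_congr_left fun x _ => ?_)
  simp only [Function.comp, pc_msk, fv, decide_eq_true_eq]

theorem rot_env (L : List ℕ) (F : ℕ → Cv) (d : Fin 48) :
    rotp (rep L.length) d.val (pk (L.map fun x => msk (F x))) = pk (L.map fun x => msk (X d * F x)) := by
  have := rotp_spec d.val d.isLt.le (L.map fun x => msk (F x)) (by
    intro y hy
    obtain ⟨x, _, rfl⟩ := List.mem_map.1 hy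
    exact msk_lt _)
  rw [List.length_map] at this
  rw [this, List.map_map]
  refine congrArg pk (List.map_congr_left fun x _ => ?_)
  refine bv_inj (rot_lt d.isLt.le (msk_lt _)) (msk_lt _) ?_
  rw [bv_msk, X_mul]
  exact (bv_rot d (msk_lt _)).trans (by rw [bv_msk])

theorem env_mk (L : List ℕ) (F : ℕ → Cv) (hF : ∀ x ∈ L, P (bv x) → P (F x)) {C : ℕ} (hC : C = pk (L.map fun x => msk (F x))) :
    Env L F (flag (0x555555555555 * rep L.length) (0x333333333333 * rep L.length) (0x0f0f0f0f0f0f * rep L.length) (rep L.length))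
      (fun d => rotp (rep L.length) d C) :=
  ⟨hF, fun thr ht A => flag_env L F thr ht A, fun d => by rw [hC]; exact rot_env L F d⟩

theorem si_mk (L : List ℕ) (F : ℕ → Cv) {C : ℕ} (hC : C = pk (L.map fun x => msk (F x))) : ∀ e ∈ [((0 : ℕ), (1 : ℕ), C)], SI L F e := by
  intro e he
  rw [List.mem_singleton] at he
  subst he
  refine ⟨X 0, by norm_num, ?_, ?_, (wt_X 0).le, ?_⟩
  · change X 0 0 ≠ 0
    rw [X_ap, if_pos rfl]; exact one_ne_zero
  · intro q hq
    rw [X_ap, if_neg (fun h => by rw [h] at hq; exact lt_irrefl _ hq)]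
  · change C = _
    rw [hC]
    refine congrArg pk (List.map_congr_left fun x _ => ?_)
    have : X 0 * F x = F x := by
      rw [X_mul]; exact cv_ext fun k => by rw [shf_ap, sub_zero]
    rw [this]

theorem ji_base (L : List ℕ) (hL : Bd L) : JI L (Nat.lor (Nat.mul (topm (0x555555555555 * rep L.length) (0x333333333333 * rep L.length) (0x0f0f0f0f0f0f * rep L.length) (rep L.length) 0 2 (pk L)) 64)
    (flag (0x555555555555 * rep L.length) (0x333333333333 * rep L.length) (0x0f0f0f0f0f0f * rep L.length) (rep L.length) 14 (pk L))) := by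
  refine JI_or ?_ ?_
  · refine ⟨fun x => decide (pc x &&& 2 ≠ 0), ?_, ?_⟩
    · rw [topm_spec _ _ _ (by norm_num) (by norm_num) L hL le_rfl]
      refine (pk_mul _ _ _).trans (congrArg pk (List.map_congr_left fun x _ => fv_two _))
    · intro x _ hq hP
      have := of_decide_eq_true hq
      have hS := hP.S
      rw [wt_bv] at hS
      exact this (and_two _ hS)
  · refine ⟨fun x => decide (pc x ≤ 14), ?_, ?_⟩
    · rw [flag_spec _ _ (by norm_num) L hL le_rfl]
      refine congrArg pk (List.map_congr_left fun x _ => ?_)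
      simp only [fv, decide_eq_true_eq]
    · intro x _ hq hP
      have := of_decide_eq_true hq
      refine kill_ok (A := X 0) (w := 1) hP ?_ (wt_X 0).le ?_
      · intro h0
        have := congrArg wt h0
        rw [wt_X, wt_zero] at this
        exact one_ne_zero this
      · rw [X_mul, wt_shf, wt_bv]; exact this

theorem block_spec {reps : List ℕ} {b N h : ℕ} (hr : ∀ r ∈ reps, St 1 r) (hh : block reps b N h = true) : St 16777217 b := by
  obtain ⟨h1, h2⟩ := band_eq.1 hh
  obtain ⟨hb, ub⟩ := unit_spec h1
  clear hh h1
  rw [genK_spec, genK_spec, List.append_nil, List.append_nil] at h2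
  set Ks := (List.range 12).map fun i => mulN (Em 24 16777217 (Nat.succ i)) b with hKs
  have hKb : Bd Ks := by
    intro y hy
    obtain ⟨i, hi, rfl⟩ := List.mem_map.1 hy
    have hi := List.mem_range.1 hi
    exact (mulN_spec (lev24.hEl (i + 1) (by omega)) hb).1
  have m25 : ∀ {x : ℕ}, x < 2 ^ 48 → mulm 25 x = msk (mu (mulEq 25 25 (by decide)) (bv x)) := by
    intro x hx
    have := mulm_spec 25 25 (by decide) hx
    exact bv_inj this.1 (msk_lt _) (by rw [bv_msk]; exact this.2)
  have m25x : ∀ x y, x < 2 ^ 48 → y < 2 ^ 48 → mulm 25 (x ^^^ y) = mulm 25 x ^^^ mulm 25 y := by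
    intro x y hx hy
    rw [m25 hx, m25 hy, m25 (Nat.xor_lt_two_pow hx hy), msk_add, bv_xor, mu_add]
  have hK' : ((List.range 12).map fun i => mulm 25 (mulN (Em 24 16777217 (Nat.succ i)) b)) = Ks.map (mulm 25) := by
    rw [hKs, List.map_map]; rfl
  have hb' : mulm 25 b < 2 ^ 48 := by rw [m25 hb]; exact msk_lt _
  have hKb' : Bd (Ks.map (mulm 25)) := by
    intro y hy
    obtain ⟨x, hx, rfl⟩ := List.mem_map.1 hy
    rw [m25 (hKb x hx)]; exact msk_lt _
  have hlen : (Lst b Ks).length ≤ 2 ^ 12 := by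
    rw [Lst_len, hKs, List.length_map, List.length_range]
  rw [hK', bld_spec hb Ks hKb, force_eq, bld_spec hb' _ hKb', Lst_map Ks m25x hb hKb] at h2
  have hLb := Lst_bd hb hKb
  have key : ∀ L : List ℕ, Bd L → L.length ≤ 2 ^ 12 → (lazy (rep L.length) fun R =>
   lazy (Nat.mul 0x555555555555 R) fun m1 => lazy (Nat.mul 0x333333333333 R) fun m2 => lazy (Nat.mul 0x0f0f0f0f0f0f R) fun m4 =>
   force (Nat.lor (Nat.mul (topm m1 m2 m4 R 0 2 (pk L)) 64) (flag m1 m2 m4 R 14 (pk L))) fun J =>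
   mach (flag m1 m2 m4 R) (fun d => rotp R d (pk L)) 2000 N [(0, 1, pk L)] J fun J =>
   mach (flag m1 m2 m4 R) (fun d => rotp R d (pk (L.map (mulm 25)))) 2000 N [(0, 1, pk (L.map (mulm 25)))] J fun J => fin reps (pk L) R h J) = true →
    ∀ x ∈ L, Gd 1 (bv x) := by
    intro L hL hl h3
    rw [lazy_eq, lazy_eq, lazy_eq, lazy_eq, force_eq] at h3
    have hC : pk L = pk (L.map fun x => msk (bv x)) := by
      refine congrArg pk ?_
      conv_lhs => rw [← List.map_id L]
      exact List.map_congr_left fun x hx => (msk_bv (hL x hx)).symm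
    have hC' : pk (L.map (mulm 25)) = pk (L.map fun x => msk (mu (mulEq 25 25 (by decide)) (bv x))) :=
      congrArg pk (List.map_congr_left fun x hx => m25 (hL x hx))
    obtain ⟨J1, hJ1, h4⟩ := mach_spec (env_mk L bv (fun _ _ h => h) hC) 2000 (ji_base L hL) (si_mk L _ hC) h3
    obtain ⟨J2, hJ2, h5⟩ := mach_spec (env_mk L _ (fun _ _ h => P_mu _ h) hC') 2000 hJ1 (si_mk L _ hC') h4
    exact fin_spec hr hL hl hJ2 h5
  have hG := key _ hLb hlen h2
  clear key h2
  have hA : All (Gd 1) Ks (bv b) := by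
    have := All_Lst (Q := Gd 1) (b := b) Ks 0 (fun x hx => by rw [zero_add]; exact hG x hx)
    rwa [zero_add] at this
  intro f hf he
  obtain ⟨e, de, h5⟩ := lev_T lev24 hf.U ub he
  rw [bv_one, one_mul, one_mul, Finset.sum_range_succ'] at h5
  have h6 := All_sum _ _ hA (fun i => e (i + 1))
  have e6 : (∑ i ∈ Finset.range Ks.length, if e (i + 1) then bv (Ks.getD i 0) else 0) =
      ∑ i ∈ Finset.range 12, if e (i + 1) then bv (Em 24 16777217 (i + 1)) * bv b else 0 := by
    rw [hKs, List.length_map, List.length_range]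
    refine Finset.sum_congr rfl fun i hi => ?_
    have hi := Finset.mem_range.1 hi
    by_cases hc : e (i + 1)
    · rw [if_pos hc, if_pos hc, List.getD_eq_getElem _ _ (by simpa using hi), List.getElem_map, List.getElem_range]
      exact (mulN_spec (lev24.hEl (i + 1) (by omega)) hb).2
    · rw [if_neg hc, if_neg hc]
  rw [e6] at h6
  generalize (∑ i ∈ Finset.range 12, if e (i + 1) then bv (Em 24 16777217 (i + 1)) * bv b else 0) = Z at h5 h6
  by_cases he0 : e 0
  · rw [if_pos he0] at h5
    have hE : bv (Em 24 16777217 0) = bv 16777217 := congrArg bv (by decide +kernel)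
    rw [hE, ← he, lev24.dec, bv_one, one_mul, add_mul, one_mul, X_mul] at h5
    refine (Concl_shf 24 f).1 (h6 _ (P_shf _ hf) ?_)
    rw [bv_one, one_mul]
    have h7 : f + f = f + (bv b + (Z + (f + shf 24 f))) := congrArg (fun t => f + t) h5
    rw [cv_add_self, show f + (bv b + (Z + (f + shf 24 f))) = (f + f) + (bv b + Z + shf 24 f) by ring, cv_add_self, zero_add] at h7
    exact (cv_eq_of_add h7.symm).symm
  · rw [if_neg he0, add_zero] at h5
    exact h6 f hf (by rw [bv_one, one_mul, h5])
end DC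

namespace DC
set_option maxRecDepth 100000
def B6 : List ℕ := [1, 158887710935282]
def B12 : List ℕ := [103492981010227, 158887710935282, 163854958406151, 96102180535687, 69936331984149]
def B24 : List ℕ := [103492981010227, 158887710935282, 163854958406151, 96102180535687, 101728856760085, 101474312513967, 69936331984149, 177818284023492, 121449518339320, 138814089011695, 189639342609698, 214966398348060, 189200737201669, 198168426441745, 226333012750269, 239319949016819]
theorem s3_0 (hr : ∀ r ∈ B6, St 4467856773185 r) : St 40210710958665 1 :=
  stage_spec (d := 0) (AL := []) (h := 3592976941899475201) lev3 (nl0 _) hr (by decide +kernel)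
theorem s6_0 (hr : ∀ r ∈ B12, St 68736258049 r) : St 4467856773185 1 :=
  stage_spec (d := 6) (AL := [1]) (h := 3540354276003335663165531185) lev6 nl12 hr (by decide +kernel)
theorem s6_1 (hr : ∀ r ∈ B12, St 68736258049 r) : St 4467856773185 158887710935282 :=
  stage_spec (d := 6) (AL := []) (h := 2176924938988986384375413766209632745473) lev6 nl12 hr (by decide +kernel)
theorem s12_0 (hr : ∀ r ∈ B24, St 16777217 r) : St 68736258049 103492981010227 :=
  stage_spec (d := 12) (AL := [65793, 2051, 16387, 133, 524293]) (h := 2436603228045013473591063246142795602456429563096539485923051392779372792205057) lev12 nl24 hr (by decide +kernel)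
theorem s12_1 (hr : ∀ r ∈ B24, St 16777217 r) : St 68736258049 158887710935282 :=
  stage_spec (d := 12) (AL := [65793, 1048579, 131089]) (h := 2033335636686132741413571565370914095232863235289120700014488148554096508351184254448614925264809731112744761964238214657) lev12 nl24 hr (by decide +kernel)
theorem s12_2 (hr : ∀ r ∈ B24, St 16777217 r) : St 68736258049 163854958406151 :=
  stage_spec (d := 12) (AL := [65793, 67, 524291, 8257, 131137]) (h := 5360937817131493142933326963365494018576224708718596194300928264574374062402507290657487522235721518853646645618724550401) lev12 nl24 hr (by decide +kernel)
theorem s12_3 (hr : ∀ r ∈ B24, St 16777217 r) : St 68736258049 96102180535687 :=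
  stage_spec (d := 12) (AL := [65793, 257]) (h := 926777977666137241827511100931892458432645416144018982610742651946513886255154722213648904198345059986553074713167389842608443786765084569089) lev12 nl24 hr (by decide +kernel)
theorem s12_4 (hr : ∀ r ∈ B24, St 16777217 r) : St 68736258049 69936331984149 :=
  stage_spec (d := 12) (AL := [65793, 257, 19, 137, 529, 8209]) (h := 28690150448453549420574119770619230736814991813395838316749102305367605467430748837730901593567662849) lev12 nl24 hr (by decide +kernel)
theorem start (hs : St 40210710958665 1) : ∀ f, P f → Concl f := start_spec (AL := [7, 3]) (h := 12756457777) hs (by decide +kernel)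

theorem all_of_24 (h : ∀ r ∈ B24, St 16777217 r) : ∀ f, P f → Concl f :=
  start (s3_0 (by
    have h12 : ∀ r ∈ B12, St 68736258049 r := by
      intro r hr
      simp only [B12, List.mem_cons, List.not_mem_nil, or_false] at hr
      rcases hr with rfl | rfl | rfl | rfl | rfl
      exacts [s12_0 h, s12_1 h, s12_2 h, s12_3 h, s12_4 h]
    intro r hr
    simp only [B6, List.mem_cons, List.not_mem_nil, or_false] at hr
    rcases hr with rfl | rfl
    exacts [s6_0 h12, s6_1 h12]))
end DC

namespace DC
set_option maxRecDepth 100000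
theorem St1 {r : ℕ} (h : P (bv r) → Concl (bv r)) : St 1 r := by
  intro f hf he
  rw [bv_one, one_mul, one_mul] at he
  subst he
  exact h hf
theorem c0 : St 1 48764737895 := St1 (chk_concl _ 1 8 41 rfl (by decide) (by decide +kernel))
theorem c1 : St 1 51345619487 := St1 (chk_concl _ 0 1 47 rfl (by decide) (by decide +kernel))
theorem c2 : St 1 71301530297 := St1 (chk_concl _ 0 5 19 rfl (by decide) (by decide +kernel))
theorem c3 : St 1 71354813391 := St1 (chk_concl _ 5 16 13 rfl (by decide) (by decide +kernel))
theorem c4 : St 1 79419905133 := St1 (chk_concl _ 0 5 19 rfl (by decide) (by decide +kernel))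
theorem c5 : St 1 85799473079 := St1 (chk_concl _ 5 18 11 rfl (by decide) (by decide +kernel))
theorem c6 : St 1 139896241967 := St1 (chk_concl _ 0 5 19 rfl (by decide) (by decide +kernel))
theorem c7 : St 1 157017864281 := St1 (chk_concl _ 2 9 41 rfl (by decide) (by decide +kernel))
theorem c8 : St 1 179232859319 := St1 (chk_concl _ 0 1 47 rfl (by decide) (by decide +kernel))
theorem c9 : St 1 183245166207 := St1 (chk_concl _ 10 11 47 rfl (by decide) (by decide +kernel))
theorem c10 : St 1 222217797743 := St1 (chk_concl _ 0 1 47 rfl (by decide) (by decide +kernel))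
theorem c11 : St 1 234522364175 := St1 (chk_concl _ 1 2 47 rfl (by decide) (by decide +kernel))
theorem c12 : St 1 295439589115 := St1 (chk_concl _ 0 5 19 rfl (by decide) (by decide +kernel))
theorem c13 : St 1 324618125659 := St1 (chk_concl _ 1 2 47 rfl (by decide) (by decide +kernel))
theorem c14 : St 1 401687144975 := St1 (chk_concl _ 2 9 41 rfl (by decide) (by decide +kernel))
theorem c15 : St 1 565575210341 := St1 (chk_concl _ 0 1 47 rfl (by decide) (by decide +kernel))
theorem c16 : St 1 597250596293 := St1 (chk_concl _ 2 19 31 rfl (by decide) (by decide +kernel))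
theorem c17 : St 1 717415100079 := St1 (chk_concl _ 0 5 19 rfl (by decide) (by decide +kernel))
theorem c18 : St 1 721243182045 := St1 (chk_concl _ 3 4 47 rfl (by decide) (by decide +kernel))
theorem c19 : St 1 732275951931 := St1 (chk_concl _ 1 2 47 rfl (by decide) (by decide +kernel))
theorem c20 : St 1 739514818255 := St1 (chk_concl _ 3 8 19 rfl (by decide) (by decide +kernel))
theorem c21 : St 1 811891053367 := St1 (chk_concl _ 6 7 47 rfl (by decide) (by decide +kernel))
theorem c22 : St 1 823202530767 := St1 (chk_concl _ 1 6 19 rfl (by decide) (by decide +kernel))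
theorem c23 : St 1 963675552959 := St1 (chk_concl _ 0 1 47 rfl (by decide) (by decide +kernel))
theorem c24 : St 1 1005676134255 := St1 (chk_concl _ 0 7 41 rfl (by decide) (by decide +kernel))
theorem c25 : St 1 1130207601461 := St1 (chk_concl _ 0 1 47 rfl (by decide) (by decide +kernel))
theorem c26 : St 1 1142377651141 := St1 (chk_concl _ 2 3 47 rfl (by decide) (by decide +kernel))
theorem c27 : St 1 1172522931143 := St1 (chk_concl _ 4 27 25 rfl (by decide) (by decide +kernel))
theorem c28 : St 1 1319223193691 := St1 (chk_concl _ 0 7 41 rfl (by decide) (by decide +kernel))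
theorem c29 : St 1 1330628599289 := St1 (chk_concl _ 3 20 31 rfl (by decide) (by decide +kernel))
theorem c30 : St 1 1505726212255 := St1 (chk_concl _ 0 17 31 rfl (by decide) (by decide +kernel))
theorem c31 : St 1 1663487378359 := St1 (chk_concl _ 1 2 47 rfl (by decide) (by decide +kernel))
theorem c32 : St 1 1807570904987 := St1 (chk_concl _ 4 5 47 rfl (by decide) (by decide +kernel))
theorem c33 : St 1 1893287561151 := St1 (chk_concl _ 1 18 31 rfl (by decide) (by decide +kernel))
theorem c34 : St 1 1956061787319 := St1 (chk_concl _ 0 5 19 rfl (by decide) (by decide +kernel))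
theorem c35 : St 1 2450909527513 := St1 (chk_concl _ 3 8 19 rfl (by decide) (by decide +kernel))
theorem c36 : St 1 2470008837295 := St1 (chk_concl _ 1 6 19 rfl (by decide) (by decide +kernel))
theorem c37 : St 1 2494851972403 := St1 (chk_concl _ 8 13 19 rfl (by decide) (by decide +kernel))
theorem c38 : St 1 2529934814941 := St1 (chk_concl _ 1 8 41 rfl (by decide) (by decide +kernel))
theorem c39 : St 1 2742444461933 := St1 (chk_concl _ 1 6 19 rfl (by decide) (by decide +kernel))
theorem c40 : St 1 2743540355965 := St1 (chk_concl _ 0 1 47 rfl (by decide) (by decide +kernel))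
theorem c41 : St 1 2883107331451 := St1 (chk_concl _ 0 11 13 rfl (by decide) (by decide +kernel))
theorem c42 : St 1 3145391230719 := St1 (chk_concl _ 2 7 19 rfl (by decide) (by decide +kernel))
theorem c43 : St 1 3514621989755 := St1 (chk_concl _ 1 8 41 rfl (by decide) (by decide +kernel))
theorem c44 : St 1 4086637733807 := St1 (chk_concl _ 0 1 47 rfl (by decide) (by decide +kernel))
theorem c45 : St 1 4738522139509 := St1 (chk_concl _ 1 8 41 rfl (by decide) (by decide +kernel))
theorem c46 : St 1 6044971707115 := St1 (chk_concl _ 0 5 19 rfl (by decide) (by decide +kernel))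
theorem c47 : St 1 6422668372957 := St1 (chk_concl _ 0 17 31 rfl (by decide) (by decide +kernel))
theorem c48 : St 1 9174030072637 := St1 (chk_concl _ 8 21 11 rfl (by decide) (by decide +kernel))
def codes : List ℕ := [48764737895, 51345619487, 71301530297, 71354813391, 79419905133, 85799473079, 139896241967, 157017864281, 179232859319, 183245166207, 222217797743, 234522364175, 295439589115, 324618125659, 401687144975, 565575210341, 597250596293, 717415100079, 721243182045, 732275951931, 739514818255, 811891053367, 823202530767, 963675552959, 1005676134255, 1130207601461, 1142377651141, 1172522931143, 1319223193691, 1330628599289, 1505726212255, 1663487378359, 1807570904987, 1893287561151, 1956061787319, 2450909527513, 2470008837295, 2494851972403, 2529934814941, 2742444461933, 2743540355965, 2883107331451, 3145391230719, 3514621989755, 4086637733807, 4738522139509, 6044971707115, 6422668372957, 9174030072637]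
theorem codes_ok : ∀ r ∈ codes, St 1 r := by
  intro r hr
  simp only [codes, List.mem_cons, List.not_mem_nil, or_false] at hr
  rcases hr with rfl | rfl | rfl | rfl | rfl | rfl | rfl | rfl | rfl | rfl | rfl | rfl | rfl | rfl | rfl | rfl | rfl | rfl | rfl | rfl | rfl | rfl | rfl | rfl | rfl | rfl | rfl | rfl | rfl | rfl | rfl | rfl | rfl | rfl | rfl | rfl | rfl | rfl | rfl | rfl | rfl | rfl | rfl | rfl | rfl | rfl | rfl | rfl | rfl
  exacts [c0, c1, c2, c3, c4, c5, c6, c7, c8, c9, c10, c11, c12, c13, c14, c15, c16, c17, c18, c19, c20, c21, c22, c23, c24, c25, c26, c27, c28, c29, c30, c31, c32, c33, c34, c35, c36, c37, c38, c39, c40, c41, c42, c43, c44, c45, c46, c47, c48]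
theorem b0 : St 16777217 103492981010227 := block_spec (N := 3887984561537209977927162175737463006458426724680671463842795513600627357552870834134612758536752383804358251997999573661134032380262848511325102171161435383717671319156329257856438448508576837814589328001194713520069426022238411217684817593254168119323910483481512492237285567644637734172705161811527282628851933173240814372066120792277561479482679518459066577137447425862169312165999704578209169279929814072474684048184567816190811954716210208104785896396657553761144884085535494649955662513611225599030939072903414828660120332612023404783831397814067403227082438020558215637532657252281300043565954971821477275216221647691051548407463361073707991822869494288644558192900101146479632439582650198218873529327064138286847350181064482012146789501664488579799105899448766605515677960721979879516432352066253216283161437559623849180555700880846738492706169737428683745983941167455487856475744376314786962350287713077742021167218627457656245202366457696866325699065222677455639688625423446093676231513456599587227480684241840542167432825248951020592312943010519696662977887418253684621800005273686803426993271363400999514541113886732105126828086746120409936423640921220281119678348530640964844805155492059864927154474340023362790355448398436974266066374800274825624549077005176393157772714312360357637271113672634529553277667015007978031078300809890886218286159377103705088790631345608909146523827685821515900592258696866904490) (h := 13962189159055051979865602003160994295137) codes_ok (by decide +kernel)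
theorem b1 : St 16777217 158887710935282 := block_spec (N := 677424614715107394568173247697097213052700922444715594602893664000139552830042142414151166542633570990811563969824177686193069012781602380947092182958055525382450296851974140670591263046253990793564796095604774365420287564812692105208400701422293440136106770578258595606893323356229076707514885322141086751602327538474116698088737578216235721123718571573190104634492576972919322068309945996105022802712310986516281652927243754038190883024965872886686355205564492790366771258219586829545328588513741106666605850523684712025791395450443230490902601858072170210402184681480604174192008055932392157848114732178466518028500548497937515475357173819656062630353932493001181600638709086211800348540038242456377890454148094392133060726721872369034089041345469926262639842581210423826273219673698821997380018325035727928449064698018187377100816327910074772817589726938796036319200254069616516690954113961218164731423941579952993902868311482777767055055842629204826322782359997409247032203448152599076028166970379505331275080682052289293510838543087931752687393700479130283064520108092635106055395387806787218011956801777126087045750277800118090452373620578234246979496668006673332110583928127426725650349664783336665743726498296854880320626139310183632978064602886720546450059122650514535094214436144606055321037852076102067524374785122120119455630133939029548882599929263053475418064941378386878240298157133419006506728549315329326140884529589656221156946874974977742335944158679369508017459815744881194931451601418522705102696345801194016164649072815023376682796550853593490503202434792876906966745797111977195160739295262475903734016566512442557523411607855833519301798301508176745137530470022193150663) (h := 16779360235569608046382910604391855900105)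 codes_ok (by decide +kernel)
theorem b2 : St 16777217 163854958406151 := block_spec (N := 78445374919351623702821296603284456117990345059660275808532998865527586481342868501971077855684128838808483997510238444764523298372438338583001042639125910337736538031231875561866725182473571691648843111528869480214746268852332334042129230661465805981726427505451818319507450761287717975044202330920029557854630452768278208712417950206429011479145846945212763200072181625804523465871030881076721199509967246635211867951704546097435162514596596938871213562355729796391164026064129373909420677745489835150834411129147840302540858888787890785107183225926003540448909331544630525167997017660814555002643720250483221378061562149358858155596783928915980837085551418673780758791629416317568386348876087201912985815546555486548837679581258269132277310316939204716291169441109311405496922274134413558730517090486695985555580775448042563968314131192346608657262854267602196085950062388427469056263495265859970365237849570866287437599405539664043653147869846509413134539146675110341567145671468346198115283565324220556882387915861026848265052135938905446191338200548637540994353862343689364148738911370697635487071832569763307430038760267960962204005972689357646829185559357891045412822880143630367008876354061442742283127190863180037123124130918271238030504306960152744062250520746725312859331634344208520068622283045199468693303612471718423525796553293893678533514313074784299978994287079497285435799694501603735321115282191038654062977898182392577615839595893391748406460473115983962476404896187233566036827685106706224230359579709994886357836662440704397257142568893025368384489932693296622767041316211034094986955384622054630328109593547098396622647711001433774099047322585413743992411617927)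 (h := 274135964109617228402543094070928625422812295039521158621304788225168872547376045) codes_ok (by decide +kernel)
theorem b3 : St 16777217 96102180535687 := block_spec (N := 159580264842386107501638879315189154925924524821142211194948654392690624980679568082328948878013569834624675433202349707543160956295102064295949861731124793443001969600386347175838416932056009912032317106845051292441958628209335875703456456881324564824446136251506996316796066075680516370445878265820512131982352118913021750381600631425670571244713374546421049484884063027344120558979369320045281996868867968383140564856647470379703721711949119408795374366033279918057629370401217192413886318914739103692933070703042910407243985784104382768519012111078701539752972906459828407009079272587894920334362925939883707304304974481529657898270890844183532420151377858841507517615037375878350547695109125272085767522883387862055302607678131675219278012089879053219837854408124669049024248864463903609171088216107515777369677495980796826389314477671) (h := 0) codes_ok (by decide +kernel)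
theorem b4 : St 16777217 101728856760085 := block_spec (N := 3565193854741163454259632216127832140930172442487751604153895729822873408755436047088132291162395160164730520977939219045145431004193468313767087063002715469494560511684522442175078940651019893337364209375353315810835039015750875288191020760592162732944732144705438802331487744328218651821643863575693450556378222696462306361324516524590244373713734256275133410150012027869321942306864628170937939592564084179591145228134243762941108519437474768689283563763133951835006829440048388408866735173259347512727838536402459188778086196507288809143658735612768030366984363837750258288890155790497695985982928691215911273927025567183317885478854252434338453498933305180675533616535046275868082334080231249222215243857188128292346470490575450325430759068070823703866522058617130303160111980520220045233212073145793989441381691611194240402984085833261411822187464330649923307164702429781447371797951639424556338869516825059433709606986754724961298631120280625077968796407044423292316376812392912603650478459741109676857375006988987289854597301625286249826518926158347052141473032675280580237708984115824341621322051742576149163745549768323052461521725754319283039550752533014030980079791914157361309122641790618071142315791522598622977048329007174838815121117259388364238481794930321959807197545779390781889009107905738076459832205310977869227988495563698813839489421300259301488521811889092181681437379022220689029879735493165840838729465387128315906552274958313597184851843061261662690259248222427977157187086352672070587330082220400170526264492205631951332942767588071145738841412663) (h := 109000340393034901555) codes_ok (by decide +kernel)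
theorem b5 : St 16777217 101474312513967 := block_spec (N := 170189299181374817751546875427617904849922833786994163856843894116635835721547251478817654621182790668777323329370503225117645134090156230764773387893663947928739563671504031490642929833208309637992084408345769635595236522337147180005409680201334510127896764800840640680442640228261624260188935109982153556085283579021571125529116985728932017702960334456642730184018518822992246809918778839874562142031724071578172441466366414856168947279091464134861402541463007683802439258139142885407715775648066885158450340598358543500170387551631055649474733018332572596811078661786921449848463284790600787519835893763732699985435560163184056343164675703814470609869508462699926572875602848283498045004994308047240388187989591976091182751013389072504627582866865793292281490112302484715342539023079806607008382679249613458678586919105082983613210692055177221636338544269159917597072646037735300611997373029274692231139568319426700751956152727488152249543282748827168322271096598223875665140276707448472373012008958503310116898104729024182952119632770049624777464802420764558526441310023380766745275523625081926753023208019196938329997925217110184831040120235498679956901508569002741171152593683940759025955568836175211877614928355091067636707951149608222777363389162266747968879061007953732679503268950838553013741859832313172718809497055157129850393515625306815935928326868944286800212493448930034875964573893215775816691284664872534826) (h := 1412160285124627375372592723545107183094605478974732651294365) codes_ok (by decide +kernel)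
theorem b6 : St 16777217 69936331984149 := block_spec (N := 104175866609343241976269438827974743893960308022713144314990898448014662780360950838237761818599395227895001007285370359512278034108092285164189779456584571703329836166062611621983207859755235320131289326203113213398988808859874056505311114157821336012487466384834878128192610583020095796041872144624732930045187245560755317253472158838607706376766770507793911051537197852393870141232316770355796614943041233479870357673160983712179626123061174347345326807086729929219797753643116059671996756058815625714698315054344072620017377596926252705777597570835325396726594844211371504687343544332703797729628431448676546666257393669432965017075009150464642551906357914907026918440809873492613604587047117890184147351125812579981747960406741892538312074203344493910050748372633260938066982156229719410490810009886396287825533819968609667246055674460376729143768970539465519057747381032284878545010811601226549498134344888199666440048350043316465108563652339071751387790694467195867925948875747657701481557079870300658636051160686206953459102974210729383145087804871156264864309902680723165230868183102219469454023951242777989604348878062227620811010410035984329378412516712125737046782590113017417372986887867626491188425541986827763938225619508576478490298888349337589222012348408977297777600) (h := 42639456476191794311339340520185965622681575205890407429156567659916175323829795539821004614753612269) codes_ok (by decide +kernel)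
theorem b7 : St 16777217 177818284023492 := block_spec (N := 1120154483554310367283929162249244629898219239487179099944927680586873298775962086425393681598490526952949989411013762921392811054941349197595591038791216837234599015586996761664319642253284067882058391894479587585309107881302589313278376341958658813729903026924841509111486740895575396422551077457573687526605752229553938060949835406575898346775759947659083255389959912504341457983407186727424567623775535197984220538046425341385873840791296721450499466721536775505184529201253541864869237673286938185301577756939085233305935740971120212303264495304534056849013957270766299016596267588589327921193850316363542202750538066585569624652566730998454978052804500109028882078454778850739899176892691327015645356890782829137766359306682360688714678133717607390076251620515546884717286228203297022469769094202641710800698836400123630802011597762523321560323211529214910160435533141535565568538730584421942528608559329017979512171900168329787055642079165199623694657406804677802776319623870602641992578902943757554477127886483776098686128787980870652238627782861025288416930996340678944116015690608422256789010269881511585221393877453152187885671875073642392854265561709819659786982005299621503969643628928270017632308016867498888139447906594591370893105422980919730544273405980877370389006157143645274667709659032230246376434816148378472696233786816192494250581311946954938900965533003611085655097445123031380983194961705202501915891341159438276456057645126226342599737314318093401420378942914132244989098971989144038307023256844563094343124495709065849820062893873900455517460263159896723153143029580753375514327503033005379435672361) (h := 26301260318082604757514061076052360062137) codes_ok (by decide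 +kernel)
theorem b8 : St 16777217 121449518339320 := block_spec (N := 364544814752921630883754576856622617197796357049320189867062675355902432108966894700734098237768245319866603861875578091091611128108195509050148539251813175965613172405167722915192516265647256170218326132036954075599710613750610127111813185888794219933106174442266611317535315218671172993568115152752176907998651581955546612081816151628188270389198624904579976783525333529445122899605941314109685206006352028381317012804985221222913615774169894405139483832556866345738721165320422719712124614597421051274445618541378144294748261189105108741653688910541886972750305661660750595723058499792534106745894867932508688626375084789841124578664502833118040736279745591840011850810886272788108862846861482497868183331897638629543423904488206166056429323835194921800910173315649518102538814967334850302265039468764269238710089208191355048662274262863368819600586557581658810791166335656764282118103984599204254259006031639570235224158963550279745376961884744483919320067863185473232999940372288186723923523596700596099218678739672884546897948828991102358687857890366493372437838645457156255779250225212352334756671999110186477860587919226254148604415192424265470805408335954230673476600096612280846650106830988085238631846764030441594794949247138964672393933517597335997974407958629455387593893364925138151426603128796138789679679220172028795629030790307234131964155291) (h := 17245371440278927733212391347814356618426107830839518375389172829718815622595877106089148069481831493084808014808048500985) codes_ok (by decide +kernel)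
theorem b9 : St 16777217 138814089011695 := block_spec (N := 396338367757420405177894806989437848378917450142313678432938252710529678124070822826007358776007446497915233233579123891097263702016410613967349737103092187928083431492048790659672160833392297855423430507861594846474487859930161873365486224829653948255937332992453335922731791368331565438492491051551583739154774459308071465009679424088032050569715241017890024812225806927073658365390317844135911649749655902000615734110740173956240559658303497055136872967471196067424750982835743640190272803977614512739388300967502851366559587740783363870410025238037674780113955064156271620162320464653143489917757081867408671970984650272504628974579575921740776730264788679539817912789103368166952204675762509554125199303794091268638231030313915261622751563863749914382227427007642339834658151257737566503523185160495565000797429909240374715120674952214348047712871162678431464971042612229013858869081248886717918990970869222613656427805996377019350297202321982901416297234282395936659384063313406466465978728254313757406416448849944392135185030950359) (h := 0) codes_ok (by decide +kernel)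
theorem b10 : St 16777217 189639342609698 := block_spec (N := 206403130719749007705075759283481923208676735804283578157835339734258661625540164737366587621258908747939094410548576428403097747330499789177674739204492709706126861276983998139026351041328996618197475415294659272781709017708266089625545981473297120630376189467091101509756565381967162426079951529310580046211955966308230378828908222080306436958690141650763535671541514733684994222087342045628144475771066320560263705253770433969001989190313351958503127516399224493446164296499225342944373586901429358896373251436670458977734426922370394799151555409030404997388913545271637150499922290695860256948516097260125237659361554986844723170942181351430375165975172162402200081852439613855255379322872931214050054408092494404995250686951877988731837396801298826628765024287521555739454166071918233767061857928440687204200111964467645469183278990039326985317418895701026659092233813964009470029451533218717561803735073520496858277089551238029324021044215994666990276913715380773744853562884481804671634372896496081344678917401674889585027702653375452046443422001238549790489968961341977310209422360730278755658434381902670028838810860730926784110227555915280228310062657520465328691654079422575175493907672756945427010379303407376366380238486024449863681275816830235029313567719040993373005594486924340368642571041671341825977459129819618098772728439668685700949986480867604654678241436159089362392495508744910960118803840136134408099426216707113855112728990486439598884355482979094800451518284442007411609234872064215) (h := 17416643434470694106531153961910351906670307763600844876193726020627760301236805623019546851339357302317784225645684851499) codes_ok (by decide +kernel)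
theorem b11 : St 16777217 214966398348060 := block_spec (N := 51858190808554100260469052505838081441399630208882322931031552636456759867811425068558727657408165047737945788088114206332419770030467063984945477032833637859111746969953775500063588823233993476059046202872521930736369069140863506341109876826121923390676640429436364824250334662264545046992433384670431735912075098999427846653762711210800823128839713213805429561102963853322583205879739859889569792211364099263085302825174743544856089649819777135964410453736193637247278470079226264318617078102463861124102335517225136020071340520490004945042333350469248280608279649534296486509097474786837222030093927866042213483502334137592271171412369020418656703003091738640537647944285687780079250609653743837678739765008891507103565357505749941086997480488278065206268702353704705492260122754821731373468211289439658338971000883580544293173140590405509689374711433908299892821171132356607673289979658929104218275136571046105748106934635816767712150538299988833748697875229203383070677114534417774092891912530443553764678003988) (h := 0) codes_ok (by decide +kernel)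
theorem b12 : St 16777217 189200737201669 := block_spec (N := 1070739370806962514955257965748690153823531945190322833879013300550520497707537616740908766544965868880830197609660899348143667503885203177773338023415063573160378930546728545039233433013988084776455686705277094265902200273788615331955812345021417132690686202116438686296945403029396986110085110476491831407099523400771578857498024620774417287127784494230465426419226990780538447499723840720123391799830301593183630198101543399290107308127485266669177829752651228691417119206143723200267488009259011204994984120247508665508546207806829989348393543715854129045068941017944215716662704217430883329585653052472230967736433186516501126061892859903857991391630570697918350167778144656704015217911865600297542406233257197404566909257358623186195274681225097273533929401654381543044602827474207039942140816272411357999638788589055499441753995865398378961943077184340213963904480412154135349658708888108358102912637320519145951030290062320252003268377170894716796446611380723288477617003016954924454312605430781438119131462768520661983920803818804691857845204746317750136103053332722783283774464582887502185115521385181891157004877282868287290950640382179535336135923333242765065562400608511737503997834588073908935627219289954730750167880630105878796860098207894029346788482780001383190939858038262370512525635774462314894784678044635592384354907887406716459235971115204258270084356474792636971852072159245143050344871572318664671258629702233844188733038780849690488736264735099477106024034062122080753211034995951544590170858372762675956985708796115868024230120934) (h := 238065032083247192853642354241323454277091386824109) codes_ok (by decide +kernel)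
theorem b13 : St 16777217 198168426441745 := block_spec (N := 2000336723599884649050243826081855078152151233313005359090319249546818102419902772663649527988880555967555974366770379130435311277646789486396099061003663462289065782269220471228028069891220492505085513143184383608019955153063343625069520671145226119253440931337407532497265047334974574851771855296552850658405563972935367426749977378889743293893366115086003000325379554820281470163646739588772126524233802589963558313887967477238455039119824918196249428702596465799896253299101890782140275332628535814965449981340080731524809694704299498644230819794832375381740856001912512013740348796405957526830876113781486646335902612365075782811943381929182005110319888883127303064763636141784452026821739664873754961519141819945408539839522586205602197343115166611863177707466567254633113268027380747726381270338860668392625748725816292936503039949132483224405199224099071387904811406848500913474219617576374930054980857750793615902908860057008965912028533571857113614150249766589966288944985756041732535675716858351893095651163629417303480994964863351191101268044342417010750491235000527692334343168344132386842270025286074163443562963383406616425958094515216070461939827579282263343608715282063937463492564450799033186837812094814752738292704226908520799794292597354582266897936124724752916) (h := 307186908532909432063391405459848555827660462234572208052296917311097168593988959) codes_ok (by decide +kernel)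
theorem b14 : St 16777217 226333012750269 := block_spec (N := 4854701502702031874981596850221544809620752359352818504648133830789362830445913372864702491995162577948865898116841643994544994274099614407862219490244916060007523750435578962625098501766003833041292906282426656190650349745460130835821329477639364995381225804309938097505217538603557414365589560579586828980024280642227809715151625052451611485497399185832189182555307507782077658865501394206050274011122802156492849424256253529298663012364526889470918236087348998612713786763458100851608580273883322682572003431073791682465428891597196739863634169221810657221291428315278164934165464999929715836984333367441058256022032421636900839530374401256034939642303725162420356568930591540908498171062730095523481823885160235830864594926195230425113266543931701733637983370446118806552897685970018801942124951131956147497816072406753231770365380778957879003164139576874143027711537733295071714394425805079418305838055005915974145535646635171437371919100119198287003499953570157337814456066530891907620103524895640578654841117702970557180311592856655887511337780282426811990249337425752713645557461404762556493788746614794566252797660205461543381244600531418416754302859036075117692921462093392545168194640190945279998093266084739505557124974668799622427005272722807744129580579658894248743292779927312284222202960602654228058925512848938283057457972507250199563010824962774338037595558950568302940378864759040237021006703631695131300958125868798538) (h := 153171059403233975237144941408530205640950256884202773667851) codes_ok (by decide +kernel)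
theorem b15 : St 16777217 239319949016819 := block_spec (N := 578328803355001877867027592097466670239206406716257474102325286404444988093375523990967774816433829360956539196987486261085153145950816591339945783756611538045534556354987551395435011507557912216421608792963830850822258265844753865457841296412926830220205824248096684393527803595628968092231948841773435008810656286380168496484262573370767661484098175885622559613112674864508781851409958553859593787874849242202907954991648777981290779290667033318075892413157815620964516397639222931060009838817831062034540594846351352562909946425292388074263729767949254234200492591371984742063351779796149633859489405348220739326443048463764290726322264866462162642606992046865798077162151035887648829659319338092754441650675933155919999119568837753968627465018809620340345767373912075569872620997647658857470070302681843741403733440422078785895937524625639869723800826280317500271569748605518901063343907436748976658487361760633490986580332469954611611441643255425588299405910005404953906693045248861937607982027828195666265183528614445701519487105602478633399937262289881459136093629472681298377040667184863598447711583093151413706972700852172552498371100772192257247330880191695797305088940180268934130572998406481060932279118718949575530762419074484865813431045768000558084812064541691404829474154316929682279682242707483729073531286391382342636593802014107931787012205192946744785997276962124837909438178470196) (h := 0) codes_ok (by decide +kernel)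
theorem b24 : ∀ r ∈ B24, St 16777217 r := by
  intro r hr
  simp only [B24, List.mem_cons, List.not_mem_nil, or_false] at hr
  rcases hr with rfl | rfl | rfl | rfl | rfl | rfl | rfl | rfl | rfl | rfl | rfl | rfl | rfl | rfl | rfl | rfl
  exacts [b0, b1, b2, b3, b4, b5, b6, b7, b8, b9, b10, b11, b12, b13, b14, b15]
end DC

theorem aut_group_pure_dcc_96_singly_even (R : Matrix (Fin 48) (Fin 48) (ZMod 2))
    (hR : IsCirculant R) (hsd : IsSelfDual (pureDCC R))
    (hse : ∃ x ∈ pureDCC R, hammingNorm x % 4 = 2)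
    (hmin : MinWeightIs (pureDCC R) 16) :
    autGroupOrder (pureDCC R) = 96 := by
  obtain ⟨v, rfl⟩ := hR
  have e : DC.code ⟨fun i => v (-i)⟩ = pureDCC (Matrix.circulant v) := by
    have : (fun i : Fin 48 => (⟨fun i => v (-i)⟩ : DC.Cv) (-i)) = v := by
      funext i
      change v (- -i) = v i
      rw [neg_neg]
    unfold DC.code
    rw [this]
  rw [← e] at hsd hse hmin ⊢
  exact DC.all_of_24 DC.b24 _ (DC.P_of_hyp _ hsd hse hmin)
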